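/- arXiv:0902.4895 — 4 statements merged into one kernel-verified Lean document; each statement's English description precedes it below -/
import Mathlib

section
/- Let p(x) be a real polynomial of degree at least 1 with positive leading coefficient, and suppose that at least one coefficient of a non-constant term of p is irrational. Then the sequence (⌊p(n)⌋)_{n∈ℕ} is an asymptotic basis. -/
open Finset Polynomial



noncomputable def ee (x : ℝ) : ℂ := Complex.exp ((2 * Real.pi * x : ℝ) * Complex.I)

lemma ee_add (x y : ℝ) : ee (x + y) = ee x * ee y := by
  unfold ee
  rw [← Complex.exp_add]
  congr 1
  push_cast
  ring

lemma norm_ee (x : ℝ) : ‖ee x‖ = 1 := by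
  unfold ee
  exact Complex.norm_exp_ofReal_mul_I _

lemma ee_zero : ee 0 = 1 := by simp [ee]

lemma conj_ee (x : ℝ) : (starRingEnd ℂ) (ee x) = ee (-x) := by
  unfold ee
  rw [← Complex.exp_conj]
  congr 1
  rw [map_mul, Complex.conj_ofReal, Complex.conj_I]
  push_cast
  ring

lemma ee_int (m : ℤ) : ee m = 1 := by
  unfold ee
  rw [Complex.exp_eq_one_iff]
  exact ⟨m, by push_cast; ring⟩

lemma ee_add_int (x : ℝ) (m : ℤ) : ee (x + m) = ee x := by
  rw [ee_add, ee_int, mul_one]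

lemma ee_re (x : ℝ) : (ee x).re = Real.cos (2 * Real.pi * x) := by
  unfold ee
  rw [Complex.exp_ofReal_mul_I_re]

lemma ee_im (x : ℝ) : (ee x).im = Real.sin (2 * Real.pi * x) := by
  unfold ee
  rw [Complex.exp_ofReal_mul_I_im]

/-- `IsP k a f`: `f` behaves like a polynomial of degree `k+1` with leading coefficient `a`. -/
def IsP : ℕ → ℝ → (ℕ → ℝ) → Prop
  | 0, a, f => ∃ b : ℝ, ∀ n : ℕ, f n = a * n + b
  | (k + 1), a, f => ∀ h : ℕ, IsP k ((k + 2) * h * a) (fun n => f (n + h) - f n)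

lemma isP_poly (k : ℕ) : ∀ P : ℝ[X], P.natDegree ≤ k + 1 →
    IsP k (P.coeff (k + 1)) (fun n => P.eval (n : ℝ)) := by
  induction k with
  | zero =>
    intro P hP
    refine ⟨P.coeff 0, fun n => ?_⟩
    have h := Polynomial.eq_X_add_C_of_natDegree_le_one hP
    conv_lhs => rw [h]
    simp
  | succ k ih =>
    intro P hP h
    have key : ∀ n, k + 1 < n → (taylor (h : ℝ) P - P).coeff n = 0 := by
      intro n hn
      rw [coeff_sub, taylor_coeff]
      rcases Nat.lt_or_ge (k + 1 + 1) n with h1 | h1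
      · rw [hasseDeriv_eq_zero_of_lt_natDegree _ _ (by omega), coeff_eq_zero_of_natDegree_lt (by omega)]
        simp
      · have : n = k + 1 + 1 := by omega
        subst this
        have h2 : hasseDeriv (k + 1 + 1) P = C (P.coeff (k + 1 + 1)) := by
          ext i
          rw [hasseDeriv_coeff, coeff_C]
          split_ifs with hi
          · subst hi; simp
          · rw [coeff_eq_zero_of_natDegree_lt (by omega)]; simp
        rw [h2]; simp
    have hdeg : (taylor (h : ℝ) P - P).natDegree ≤ k + 1 := by
      rw [natDegree_le_iff_coeff_eq_zero]
      intro n hn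
      exact key n hn
    have h3 := ih _ hdeg
    have hc : (taylor (h : ℝ) P - P).coeff (k + 1) = ((k : ℕ) + 2) * h * P.coeff (k + 1 + 1) := by
      rw [coeff_sub, taylor_coeff]
      have h2 : hasseDeriv (k + 1) P = C (P.coeff (k + 1)) + C (((k : ℝ) + 2) * P.coeff (k + 1 + 1)) * X := by
        ext i
        rw [hasseDeriv_coeff, coeff_add, coeff_C, coeff_C_mul, coeff_X]
        rcases i with _ | _ | i
        · simp
        · have : (0 + 1 + (k + 1)).choose (k + 1) = k + 2 := by
            rw [show 0 + 1 + (k + 1) = (k + 1) + 1 by ring, Nat.choose_succ_self_right]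
          rw [this, show 0 + 1 + (k + 1) = k + 1 + 1 by ring]
          simp
        · rw [coeff_eq_zero_of_natDegree_lt (by omega)]; simp
      rw [h2]
      simp
      ring
    rw [hc] at h3
    convert h3 using 2
    rename_i n
    simp [taylor_eval]

lemma vdc (u : ℕ → ℂ) (hu : ∀ n, ‖u n‖ = 1) (L : ℕ) :
    ‖∑ n ∈ range L, u n‖ ^ 2 = (L : ℝ) + 2 * (∑ h ∈ range L, ∑ n ∈ range (L - (h + 1)),
      u (n + (h + 1)) * (starRingEnd ℂ) (u n)).re := by
  induction L with
  | zero => simp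
  | succ L ih =>
    have h1 : ∑ h ∈ range (L + 1), ∑ n ∈ range (L + 1 - (h + 1)),
        u (n + (h + 1)) * (starRingEnd ℂ) (u n) =
        (∑ h ∈ range L, ∑ n ∈ range (L - (h + 1)), u (n + (h + 1)) * (starRingEnd ℂ) (u n)) +
        u L * (starRingEnd ℂ) (∑ n ∈ range L, u n) := by
      rw [sum_range_succ]
      simp only [Nat.sub_self, range_zero, sum_empty, add_zero]
      rw [← sum_range_reflect u L, map_sum, mul_sum, ← sum_add_distrib]
      refine sum_congr rfl fun h hh => ?_
      rw [mem_range] at hh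
      rw [show L + 1 - (h + 1) = (L - (h + 1)) + 1 by omega, sum_range_succ,
        show L - (h + 1) + (h + 1) = L by omega, show L - 1 - h = L - (h + 1) by omega]
    rw [h1, sum_range_succ, Complex.add_re, mul_add, ← add_assoc]
    have h2 : ∀ s z : ℂ, ‖z‖ = 1 → ‖s + z‖ ^ 2 = ‖s‖ ^ 2 + 1 + 2 * (z * (starRingEnd ℂ) s).re := by
      intro s z hz
      have hz2 : ‖z‖ ^ 2 = 1 := by rw [hz]; norm_num
      rw [← Complex.normSq_eq_norm_sq] at hz2 ⊢
      rw [← Complex.normSq_eq_norm_sq, Complex.normSq_add, hz2]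
      congr 2
      simp
      ring
    rw [h2 _ _ (hu L), ih]
    push_cast
    ring

lemma vdc_ineq (f : ℕ → ℝ) (L : ℕ) :
    ‖∑ n ∈ range L, ee (f n)‖ ^ 2 ≤ (L : ℝ) + 2 * ∑ h ∈ range L, ‖∑ n ∈ range (L - (h + 1)),
      ee (f (n + (h + 1)) - f n)‖ := by
  rw [vdc (fun n => ee (f n)) (fun n => norm_ee _)]
  gcongr
  refine (Complex.re_le_norm _).trans ((norm_sum_le _ _).trans (le_of_eq ?_))
  refine sum_congr rfl fun h _ => ?_
  congr 1
  refine sum_congr rfl fun n _ => ?_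
  rw [conj_ee, ← ee_add, sub_eq_add_neg]

lemma norm_ee_sub_one (θ : ℝ) (h : |θ| ≤ 1 / 2) : 4 * |θ| ≤ ‖ee θ - 1‖ := by
  have h1 : ‖ee θ - 1‖ = ‖2 * Real.sin (2 * Real.pi * θ / 2)‖ := by
    unfold ee
    rw [mul_comm, Complex.norm_exp_I_mul_ofReal_sub_one]
  rw [h1, norm_mul, Real.norm_eq_abs, Real.norm_eq_abs]
  have hpi := Real.pi_pos
  have h2 : |2 * Real.pi * θ / 2| = Real.pi * |θ| := by
    rw [show 2 * Real.pi * θ / 2 = Real.pi * θ by ring, abs_mul, abs_of_pos hpi]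
  have h3 := Real.mul_abs_le_abs_sin (x := 2 * Real.pi * θ / 2) (by rw [h2]; nlinarith)
  rw [h2] at h3
  have h4 : 2 / Real.pi * (Real.pi * |θ|) = 2 * |θ| := by field_simp
  rw [h4] at h3
  have : |(2:ℝ)| = 2 := by norm_num
  rw [this]
  linarith

lemma weyl_base (a b : ℝ) (L : ℕ) : ‖∑ n ∈ range L, ee (a * n + b)‖ * |a - round a| ≤ 1 / 2 := by
  set θ := a - round a with hθ
  have hθ2 : |θ| ≤ 1 / 2 := abs_sub_round a
  have h1 : ∀ n : ℕ, ee (a * n + b) = ee (θ * n) * ee b := by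
    intro n
    rw [ee_add]
    congr 1
    have : a * n = θ * n + ((round a * n : ℤ) : ℝ) := by push_cast; rw [hθ]; ring
    rw [this, ee_add_int]
  have h2 : (∑ n ∈ range L, ee (a * n + b)) * (ee θ - 1) = ee b * (ee (θ * L) - 1) := by
    induction L with
    | zero => simp [ee_zero]
    | succ L ih =>
      rw [sum_range_succ, add_mul, ih, h1]
      have : ee (θ * (L + 1 : ℕ)) = ee (θ * L) * ee θ := by
        rw [← ee_add]; congr 1; push_cast; ring
      rw [this]; ring
  have h3 := congrArg norm h2
  rw [norm_mul, norm_mul, norm_ee] at h3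
  have h4 : ‖ee (θ * L) - 1‖ ≤ 2 := by
    refine (norm_sub_le _ _).trans ?_
    rw [norm_ee]; norm_num
  have h5 := norm_ee_sub_one θ hθ2
  have h6 := norm_nonneg (∑ n ∈ range L, ee (a * n + b))
  nlinarith

/-- lattice points in a thin strip -/
lemma strip (b ε : ℝ) (B r : ℕ) (x : ℕ) (H : Finset ℕ) (hH : ∀ h ∈ H, x ≤ h ∧ h < x + B)
    (hr : 1 ≤ r) (hcard : r + 1 ≤ H.card) (hε : ∀ h ∈ H, ∃ m : ℤ, |h * b - m| ≤ ε)
    (hB : 4 * B * ε < 1) : ∃ q : ℕ, 1 ≤ q ∧ q * r ≤ B ∧ ∃ m : ℤ, |q * b - m| * r ≤ 2 * ε := by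
  choose! μ hμ using hε
  have hne : H.Nonempty := card_pos.mp (by omega)
  obtain ⟨h0, h0H, hmin⟩ := H.exists_min_image id hne
  obtain ⟨h1, h1H, hmax⟩ := H.exists_max_image id hne
  simp only [id] at hmin hmax
  have hε0 : 0 ≤ ε := (abs_nonneg _).trans (hμ h0 h0H)
  -- differences
  have hd : ∀ h ∈ H, |((h : ℝ) - h0) * b - ((μ h - μ h0 : ℤ) : ℝ)| ≤ 2 * ε := by
    intro h hh
    have e1 := hμ h hh
    have e2 := hμ h0 h0H
    have : ((h : ℝ) - h0) * b - ((μ h - μ h0 : ℤ) : ℝ) = (h * b - μ h) - (h0 * b - μ h0) := by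
      push_cast; ring
    rw [this]
    refine (abs_sub _ _).trans ?_
    linarith
  have hdB : ∀ h ∈ H, |(h : ℝ) - h0| ≤ B := by
    intro h hh
    have e1 := hH h hh
    have e2 := hH h0 h0H
    have e3 := hmin h hh
    rw [abs_le]
    constructor
    · have : (h0 : ℝ) ≤ h := by exact_mod_cast e3
      have : (0 : ℝ) ≤ B := by positivity
      linarith
    · have : (h : ℝ) ≤ h0 + B := by exact_mod_cast (by omega : h ≤ h0 + B)
      linarith
  have hcol : ∀ h ∈ H, ((h : ℤ) - h0) * (μ h1 - μ h0) = ((h1 : ℤ) - h0) * (μ h - μ h0) := by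
    intro h hh
    have a1 := hd h hh
    have a2 := hd h1 h1H
    have b1 := hdB h hh
    have b2 := hdB h1 h1H
    have : |(((h1 : ℤ) - h0) * (μ h - μ h0) - ((h : ℤ) - h0) * (μ h1 - μ h0) : ℤ)| < 1 := by
      have : |((((h1 : ℤ) - h0) * (μ h - μ h0) - ((h : ℤ) - h0) * (μ h1 - μ h0) : ℤ) : ℝ)| < 1 := by
        have e : ((((h1 : ℤ) - h0) * (μ h - μ h0) - ((h : ℤ) - h0) * (μ h1 - μ h0) : ℤ) : ℝ) =
          ((h : ℝ) - h0) * (((h1 : ℝ) - h0) * b - ((μ h1 - μ h0 : ℤ) : ℝ)) -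
          ((h1 : ℝ) - h0) * (((h : ℝ) - h0) * b - ((μ h - μ h0 : ℤ) : ℝ)) := by
          push_cast; ring
        rw [e]
        refine (abs_sub _ _).trans_lt ?_
        rw [abs_mul, abs_mul]
        have c1 := mul_le_mul b1 a2 (abs_nonneg _) (by positivity)
        have c2 := mul_le_mul b2 a1 (abs_nonneg _) (by positivity)
        linarith
      exact_mod_cast this
    have := Int.abs_lt_one_iff.mp this
    linarith
  have hlt : h0 < h1 := by
    by_contra hcon
    have : H ⊆ {h0} := by
      intro h hh
      have := hmin h hh
      have := hmax h hh
      rw [mem_singleton]; omega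
    have := card_le_card this
    simp at this
    omega
  set d : ℕ := h1 - h0 with hdd
  have hd0 : 0 < d := by omega
  set ν : ℤ := μ h1 - μ h0 with hν
  have hdz : ((h1 : ℤ) - h0) = d := by omega
  set g : ℕ := Int.gcd d ν with hg
  have hg0 : 0 < g := Int.gcd_pos_of_ne_zero_left _ (by omega)
  obtain ⟨q, m, hcop, hq, hm⟩ := Int.exists_gcd_one (m := (d : ℤ)) (n := ν) hg0
  rw [← hg] at hq hm
  have hq0 : 0 < q := by
    by_contra hcon
    have : q * g ≤ 0 := mul_nonpos_of_nonpos_of_nonneg (by omega) (by omega)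
    omega
  lift q to ℕ using hq0.le
  have hdq : d = q * g := by exact_mod_cast hq
  have hdvd : ∀ h ∈ H, q ∣ h - h0 := by
    intro h hh
    have e := hcol h hh
    rw [hdz, hm, hq] at e
    have e2 : ((h : ℤ) - h0) * m = q * (μ h - μ h0) := by
      have : (g : ℤ) ≠ 0 := by omega
      apply mul_right_cancel₀ this
      linarith
    have e3 : (q : ℤ) ∣ ((h : ℤ) - h0) := by
      have : (q : ℤ) ∣ ((h : ℤ) - h0) * m := ⟨_, e2⟩
      exact Int.dvd_of_dvd_mul_left_of_gcd_one this hcop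
    have e4 := hmin h hh
    have : ((h - h0 : ℕ) : ℤ) = (h : ℤ) - h0 := by omega
    rw [← this] at e3
    exact_mod_cast e3
  have hgr : r ≤ g := by
    have : H.card ≤ (range (g + 1)).card := by
      apply card_le_card_of_injOn (fun h => (h - h0) / q)
      · intro h hh
        have hh' : h ∈ H := hh
        have := hmax h hh'
        simp only [coe_range, Set.mem_Iio]
        have : (h - h0) / q ≤ d / q := Nat.div_le_div_right (by omega)
        rw [hdq, Nat.mul_div_cancel_left _ (by omega)] at this
        omega
      · intro x hx y hy hxy
        have hx' := hdvd x hx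
        have hy' := hdvd y hy
        have := hmin x hx
        have := hmin y hy
        simp only at hxy
        have := Nat.div_mul_cancel hx'
        have := Nat.div_mul_cancel hy'
        rw [hxy] at *
        omega
    rw [card_range] at this
    omega
  refine ⟨q, by omega, ?_, m, ?_⟩
  · have e1 := hH h1 h1H
    have e2 := hH h0 h0H
    have : q * r ≤ q * g := Nat.mul_le_mul_left _ hgr
    omega
  · have e := hd h1 h1H
    have e1 : ((h1 : ℝ) - h0) = q * g := by
      have : ((h1 : ℤ) - h0) = q * g := by rw [hdz, hq]
      exact_mod_cast this
    rw [e1, ← hν, hm] at e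
    have e2 : (q : ℝ) * g * b - ((m * g : ℤ) : ℝ) = (q * b - m) * g := by push_cast; ring
    rw [e2, abs_mul, Nat.abs_cast] at e
    refine le_trans ?_ e
    have : (r : ℝ) ≤ g := by exact_mod_cast hgr
    gcongr


lemma weyl_step (k : ℕ) (a : ℝ) (f : ℕ → ℝ) (D Q N L : ℕ) (hD : 1 ≤ D) (hQ : 1 ≤ Q)
    (hL : L ≤ N) (hN : 272 * D ^ 2 * Q ^ 2 ≤ N)
    (hS : (N : ℝ) ≤ D * ‖∑ n ∈ range L, ee (f n)‖)
    (ih : ∀ h L' : ℕ, L' ≤ N → (N : ℝ) ≤ (8 * D ^ 2 : ℕ) * ‖∑ n ∈ range L', ee (f (n + h) - f n)‖ →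
      ∃ q : ℕ, 1 ≤ q ∧ q ≤ Q ∧ ∃ m : ℤ, (N : ℝ) ^ (k + 1) * |q * ((k + 2) * h * a) - m| ≤ Q) :
    ∃ q : ℕ, 1 ≤ q ∧ q ≤ (k + 2) * Q * (272 * D ^ 2 * Q ^ 2) ∧
      ∃ m : ℤ, (N : ℝ) ^ (k + 2) * |q * a - m| ≤ (2 * Q * (272 * D ^ 2 * Q ^ 2) : ℕ) := by
  classical
  set R : ℕ := 272 * D ^ 2 * Q ^ 2 with hR
  have hD2 : 1 ≤ D ^ 2 := Nat.one_le_pow _ _ hD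
  have hQ2 : Q ≤ Q ^ 2 := by nlinarith
  have hRQ : 272 * Q ≤ R := by rw [hR]; nlinarith
  have hRD : 272 * D ^ 2 ≤ R := by rw [hR]; nlinarith
  have hN0 : 0 < N := by omega
  have hNr : (0 : ℝ) < N := by exact_mod_cast hN0
  set S : ℕ → ℝ := fun h => ‖∑ n ∈ range (L - (h + 1)), ee (f (n + (h + 1)) - f n)‖ with hSdef
  set H0 := (range L).filter (fun h => (N : ℝ) ≤ (8 * D ^ 2 : ℕ) * S h) with hH0
  have hSN : ∀ h, S h ≤ N := by
    intro h
    refine (norm_sum_le _ _).trans ?_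
    simp only [norm_ee, sum_const, card_range, nsmul_eq_mul, mul_one]
    exact_mod_cast (by omega : L - (h + 1) ≤ N)
  have hS0 : ∀ h, 0 ≤ S h := fun h => norm_nonneg _
  have hDr : (1 : ℝ) ≤ D := by exact_mod_cast hD
  have hDp : (0 : ℝ) < D := by linarith
  have hsum : ∑ h ∈ range L, S h ≤ H0.card * N + N * (N / (8 * D ^ 2)) := by
    have h1 : ∀ h ∈ range L, S h ≤ (if (N : ℝ) ≤ (8 * D ^ 2 : ℕ) * S h then (N : ℝ) else 0) + N / (8 * D ^ 2) := by
      intro h _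
      have hp : (0 : ℝ) ≤ N / (8 * D ^ 2) := by positivity
      split_ifs with hc
      · have := hSN h
        linarith
      · push Not at hc
        rw [zero_add, le_div_iff₀ (by positivity)]
        push_cast at hc
        linarith
    refine (sum_le_sum h1).trans ?_
    rw [sum_add_distrib, ← sum_filter, sum_const, sum_const, nsmul_eq_mul, nsmul_eq_mul, card_range]
    gcongr
  have hH0card : (N : ℝ) ≤ 4 * D ^ 2 * H0.card := by
    have hv := vdc_ineq f L
    have hsq : (N : ℝ) ^ 2 ≤ D ^ 2 * ‖∑ n ∈ range L, ee (f n)‖ ^ 2 := by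
      rw [← mul_pow]
      gcongr
    have h2 : (D : ℝ) ^ 2 * ‖∑ n ∈ range L, ee (f n)‖ ^ 2 ≤ D ^ 2 * (N + 2 * (H0.card * N + N * (N / (8 * D ^ 2)))) := by
      gcongr
      refine hv.trans ?_
      have : (L : ℝ) ≤ N := by exact_mod_cast hL
      linarith
    have h3 : (D : ℝ) ^ 2 * (N + 2 * (H0.card * N + N * (N / (8 * D ^ 2)))) =
        (D ^ 2 + 2 * D ^ 2 * H0.card + N / 4) * N := by
      field_simp
      ring
    have h4 : (N : ℝ) ≤ D ^ 2 + 2 * D ^ 2 * H0.card + N / 4 := by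
      have : (N : ℝ) * N ≤ (D ^ 2 + 2 * D ^ 2 * H0.card + N / 4) * N := by
        rw [← h3]; nlinarith
      exact le_of_mul_le_mul_right this hNr
    have h5 : 272 * (D : ℝ) ^ 2 ≤ N := by exact_mod_cast hRD.trans hN
    nlinarith
  have ih' : ∀ h ∈ H0, ∃ q : ℕ, 1 ≤ q ∧ q ≤ Q ∧ ∃ m : ℤ,
      (N : ℝ) ^ (k + 1) * |q * ((k + 2) * ((h + 1 : ℕ) : ℝ) * a) - m| ≤ Q := by
    intro h hh
    rw [hH0, mem_filter] at hh
    exact ih (h + 1) (L - (h + 1)) (by omega) hh.2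
  choose! qf hq1 hqQ mf hmf using ih'
  set B : ℕ := N / (8 * Q) with hB
  have hB8 : 8 * Q * B ≤ N := Nat.mul_div_le _ _
  have hB1 : 1 ≤ B := by
    rw [hB, Nat.one_le_div_iff (by omega)]; omega
  have hB17 : N ≤ 17 * Q * B := by
    have : N < 8 * Q * (B + 1) := Nat.lt_mul_div_succ N (by omega)
    nlinarith
  set T := (Finset.Icc 1 Q) ×ˢ (range (17 * Q)) with hT
  have hmaps : ∀ h ∈ H0, (qf h, h / B) ∈ T := by
    intro h hh
    have hhL : h < L := by
      rw [hH0, mem_filter, mem_range] at hh; exact hh.1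
    rw [hT, mem_product, Finset.mem_Icc, mem_range]
    refine ⟨⟨hq1 h hh, hqQ h hh⟩, ?_⟩
    apply Nat.div_lt_of_lt_mul
    calc h < N := by omega
      _ ≤ 17 * Q * B := hB17
      _ = B * (17 * Q) := by ring
  have hTne : T.Nonempty := ⟨(1, 0), by rw [hT, mem_product, Finset.mem_Icc, mem_range]; simp; omega⟩
  have hQr : (1 : ℝ) ≤ Q := by exact_mod_cast hQ
  have hRr : (R : ℝ) = 272 * D ^ 2 * Q ^ 2 := by rw [hR]; push_cast; ring
  have hRpos : (0 : ℝ) < R := by rw [hRr]; positivity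
  obtain ⟨⟨q, y⟩, hqy, hfib⟩ := exists_le_card_fiber_of_nsmul_le_card_of_maps_to (b := (4 * N / R : ℝ)) hmaps hTne (by
    rw [hT, card_product, Nat.card_Icc, card_range, nsmul_eq_mul, hRr]
    have : (((Q + 1 - 1) * (17 * Q) : ℕ) : ℝ) = 17 * Q ^ 2 := by
      rw [Nat.add_sub_cancel]; push_cast; ring
    rw [this]
    have e : (17 * (Q : ℝ) ^ 2) * (4 * N / (272 * D ^ 2 * Q ^ 2)) = N / (4 * D ^ 2) := by
      field_simp
      norm_num
    rw [e, div_le_iff₀ (by positivity)]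
    linarith)
  set H1 := {x ∈ H0 | (qf x, x / B) = (q, y)} with hH1
  have hH1c : 4 ≤ H1.card := by
    have : (4 : ℝ) ≤ 4 * N / R := by
      rw [le_div_iff₀ hRpos]
      have : (R : ℝ) ≤ N := by exact_mod_cast hN
      linarith
    exact_mod_cast this.trans hfib
  obtain ⟨r, hr⟩ : ∃ r, H1.card = r + 1 := ⟨H1.card - 1, by omega⟩
  have hrR : (N : ℝ) ≤ R * r := by
    rw [hr, div_le_iff₀ hRpos] at hfib
    have h3 : (3 : ℝ) ≤ r := by exact_mod_cast (by omega : 3 ≤ r)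
    push_cast at hfib
    nlinarith
  have hNk : (0 : ℝ) < (N : ℝ) ^ (k + 1) := by positivity
  obtain ⟨q', hq'1, hq'r, m, hm⟩ := strip (q * ((k + 2) * a)) (Q / (N : ℝ) ^ (k + 1)) B r (y * B + 1)
    (H1.map (addRightEmbedding 1)) (by
      intro h hh
      rw [mem_map] at hh
      obtain ⟨x, hx, rfl⟩ := hh
      rw [hH1, mem_filter] at hx
      have h2 := hx.2
      simp only [Prod.mk.injEq] at h2
      simp only [addRightEmbedding_apply]
      have e := Nat.div_add_mod x B
      have e2 := Nat.mod_lt x hB1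
      rw [h2.2, mul_comm] at e
      constructor <;> omega)
    (by omega) (by rw [card_map]; omega)
    (by
      intro h hh
      rw [mem_map] at hh
      obtain ⟨x, hx, rfl⟩ := hh
      rw [hH1, mem_filter] at hx
      have h2 := hx.2
      simp only [Prod.mk.injEq] at h2
      simp only [addRightEmbedding_apply]
      refine ⟨mf x, ?_⟩
      rw [le_div_iff₀ hNk, mul_comm]
      have := hmf x hx.1
      rw [h2.1] at this
      have e : ((x + 1 : ℕ) : ℝ) * (q * ((k + 2) * a)) = q * ((k + 2) * ((x + 1 : ℕ) : ℝ) * a) := by ring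
      rw [e]
      exact this)
    (by
      have h1 : (8 : ℝ) * Q * B ≤ N := by exact_mod_cast hB8
      have h2 : (N : ℝ) ≤ (N : ℝ) ^ (k + 1) := by
        exact_mod_cast Nat.le_self_pow (by omega) N
      rw [← mul_div_assoc, div_lt_one hNk]
      nlinarith)
  have hqm : 1 ≤ q ∧ q ≤ Q := by
    rw [hT, mem_product, Finset.mem_Icc] at hqy; exact hqy.1
  have hq'R : q' ≤ R := by
    have h1 : (q' : ℝ) * r ≤ B := by exact_mod_cast hq'r
    have h2 : (B : ℝ) ≤ N := by
      have : B ≤ N := Nat.div_le_self _ _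
      exact_mod_cast this
    have h3 : (q' : ℝ) * N ≤ R * N := by
      calc (q' : ℝ) * N ≤ q' * (R * r) := by gcongr
        _ = R * (q' * r) := by ring
        _ ≤ R * N := by gcongr; linarith
    exact_mod_cast le_of_mul_le_mul_right h3 hNr
  refine ⟨q' * (q * (k + 2)), ?_, ?_, m, ?_⟩
  · have : 0 < q' * (q * (k + 2)) := by
      have := hqm.1
      positivity
    omega
  · calc q' * (q * (k + 2)) ≤ R * (Q * (k + 2)) := by
          gcongr
          exact hqm.2
      _ = _ := by ring
  · have e : ((q' * (q * (k + 2)) : ℕ) : ℝ) * a - m = q' * (q * ((k + 2) * a)) - m := by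
      push_cast; ring
    rw [e]
    set Z := |(q' : ℝ) * (q * ((k + 2) * a)) - m|
    rw [← mul_div_assoc, le_div_iff₀ hNk] at hm
    have hZ : 0 ≤ Z := abs_nonneg _
    calc (N : ℝ) ^ (k + 2) * Z = N * (N ^ (k + 1) * Z) := by ring
      _ ≤ (R * r) * (N ^ (k + 1) * Z) := by gcongr
      _ = R * (Z * r * N ^ (k + 1)) := by ring
      _ ≤ R * (2 * Q) := by gcongr
      _ = _ := by push_cast; ring

theorem weyl (k : ℕ) : ∃ C E : ℕ, 1 ≤ C ∧ ∀ (a : ℝ) (f : ℕ → ℝ), IsP k a f → ∀ D N L : ℕ, 1 ≤ D →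
    1 ≤ N → L ≤ N → (N : ℝ) ≤ D * ‖∑ n ∈ range L, ee (f n)‖ →
    ∃ q : ℕ, 1 ≤ q ∧ q ≤ C * D ^ E ∧ ∃ m : ℤ, (N : ℝ) ^ (k + 1) * |q * a - m| ≤ (C * D ^ E : ℕ) := by
  induction k with
  | zero =>
    refine ⟨1, 1, le_rfl, ?_⟩
    rintro a f ⟨b, hb⟩ D N L hD hN hL hS
    refine ⟨1, le_rfl, by simpa using hD, round a, ?_⟩
    have h1 := weyl_base a b L
    simp only [hb] at hS
    have h2 : 0 ≤ |a - round a| := abs_nonneg _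
    have h3 : (0 : ℝ) ≤ D := by positivity
    simp only [zero_add, pow_one, Nat.cast_one, one_mul]
    calc (N : ℝ) * |a - round a| ≤ D * ‖∑ n ∈ range L, ee (a * n + b)‖ * |a - round a| := by gcongr
      _ = D * (‖∑ n ∈ range L, ee (a * n + b)‖ * |a - round a|) := by ring
      _ ≤ D * (1 / 2) := by gcongr
      _ ≤ D := by linarith
  | succ k ih =>
    obtain ⟨C, E, hC, ih⟩ := ih
    set Qf : ℕ → ℕ := fun D => C * (8 * D ^ 2) ^ E with hQf
    set c1 := 272 * (C * 8 ^ E) ^ 2 with hc1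
    set e1 := 2 + 4 * E with he1
    have hR : ∀ D, 272 * D ^ 2 * (Qf D) ^ 2 = c1 * D ^ e1 := by
      intro D
      simp only [hQf, hc1, he1]
      rw [mul_pow 8, ← pow_mul D, mul_pow, mul_pow, ← pow_mul D, mul_pow, pow_add]
      ring
    have hQ : ∀ D, Qf D = (C * 8 ^ E) * D ^ (2 * E) := by
      intro D
      simp only [hQf]
      rw [mul_pow, ← pow_mul D]
      ring
    refine ⟨2 * (k + 2) * (C * 8 ^ E) * c1 + c1 ^ (k + 2), 2 * E + e1 + e1 * (k + 2), ?_, ?_⟩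
    · have : 1 ≤ c1 := by
        rw [hc1]
        have : 0 < 272 * (C * 8 ^ E) ^ 2 := by positivity
        omega
      have := Nat.one_le_pow (k + 2) c1 this
      omega
    intro a f hf D N L hD hN hL hS
    have hbig1 : 2 * (k + 2) * (Qf D) * (272 * D ^ 2 * (Qf D) ^ 2) ≤
        (2 * (k + 2) * (C * 8 ^ E) * c1 + c1 ^ (k + 2)) * D ^ (2 * E + e1 + e1 * (k + 2)) := by
      rw [hR, hQ]
      calc 2 * (k + 2) * (C * 8 ^ E * D ^ (2 * E)) * (c1 * D ^ e1)
          = (2 * (k + 2) * (C * 8 ^ E) * c1) * D ^ (2 * E + e1) := by rw [pow_add]; ring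
        _ ≤ _ := by
          apply Nat.mul_le_mul
          · exact Nat.le_add_right _ _
          · exact Nat.pow_le_pow_right hD (Nat.le_add_right _ _)
    have hbig2 : (272 * D ^ 2 * (Qf D) ^ 2) ^ (k + 2) ≤
        (2 * (k + 2) * (C * 8 ^ E) * c1 + c1 ^ (k + 2)) * D ^ (2 * E + e1 + e1 * (k + 2)) := by
      rw [hR, mul_pow, ← pow_mul]
      apply Nat.mul_le_mul
      · exact Nat.le_add_left _ _
      · exact Nat.pow_le_pow_right hD (Nat.le_add_left _ _)
    rcases Nat.lt_or_ge N (272 * D ^ 2 * (Qf D) ^ 2) with hsmall | hlarge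
    · refine ⟨1, le_rfl, ?_, round a, ?_⟩
      · refine le_trans ?_ hbig2
        apply Nat.one_le_pow
        omega
      · have h1 : |((1 : ℕ) : ℝ) * a - round a| ≤ 1 := by
          rw [Nat.cast_one, one_mul]
          exact (abs_sub_round a).trans (by norm_num)
        have h2 : (N : ℝ) ^ (k + 2) ≤ ((272 * D ^ 2 * (Qf D) ^ 2) ^ (k + 2) : ℕ) := by
          push_cast
          gcongr
          exact_mod_cast hsmall.le
        calc (N : ℝ) ^ (k + 1 + 1) * |((1 : ℕ) : ℝ) * a - round a| ≤ (N : ℝ) ^ (k + 2) * 1 := by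
              gcongr
          _ ≤ _ := by
            rw [mul_one]
            refine h2.trans ?_
            exact_mod_cast hbig2
    · have hQ1 : 1 ≤ Qf D := by
        have : 0 < Qf D := by simp only [hQf]; positivity
        omega
      obtain ⟨q, h1, h2, m, h3⟩ := weyl_step k a f D (Qf D) N L hD hQ1 hL hlarge hS (by
        intro h L' hL' hS'
        have := ih _ _ (hf h) (8 * D ^ 2) N L' (by nlinarith [Nat.one_le_pow 2 D hD]) hN hL' hS'
        exact this)
      refine ⟨q, h1, h2.trans (le_trans ?_ hbig1), m, h3.trans ?_⟩
      · gcongr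
        omega
      · have : 2 * (Qf D) * (272 * D ^ 2 * (Qf D) ^ 2) ≤ 2 * (k + 2) * (Qf D) * (272 * D ^ 2 * (Qf D) ^ 2) := by
          gcongr
          omega
        exact_mod_cast this.trans hbig1

lemma weyl_irr (k : ℕ) (a : ℝ) (ha : Irrational a) (f : ℕ → ℝ) (hf : IsP k a f) (D : ℕ) (hD : 1 ≤ D) :
    ∃ N0 : ℕ, ∀ N : ℕ, N0 ≤ N → D * ‖∑ n ∈ range N, ee (f n)‖ < N := by
  obtain ⟨C, E, hC, hw⟩ := weyl k
  set F := C * D ^ E with hF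
  have hF1 : 1 ≤ F := Nat.mul_pos hC (Nat.pow_pos hD)
  obtain ⟨q0, hq0, hmin⟩ := (Finset.Icc 1 F).exists_min_image (fun q : ℕ => |(q : ℝ) * a - round ((q : ℝ) * a)|)
    ⟨1, by simp; omega⟩
  set c := |(q0 : ℝ) * a - round ((q0 : ℝ) * a)| with hc
  have hcpos : 0 < c := by
    rw [hc, abs_pos, sub_ne_zero]
    have : Irrational ((q0 : ℝ) * a) := ha.natCast_mul (by rw [Finset.mem_Icc] at hq0; omega)
    exact this.ne_int _
  obtain ⟨N1, hN1⟩ := exists_nat_gt ((F : ℝ) / c)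
  refine ⟨N1 + 1, fun N hN => ?_⟩
  by_contra hcon
  push Not at hcon
  obtain ⟨q, h1, h2, m, h3⟩ := hw a f hf D N N hD (by omega) le_rfl hcon
  have h4 := hmin q (by rw [Finset.mem_Icc]; exact ⟨h1, h2⟩)
  have h5 := round_le ((q : ℝ) * a) m
  have h6 : (N : ℝ) ≤ (N : ℝ) ^ (k + 1) := by exact_mod_cast Nat.le_self_pow (by omega) N
  rw [div_lt_iff₀ hcpos] at hN1
  have h7 : (N1 : ℝ) ≤ N := by exact_mod_cast (by omega : N1 ≤ N)
  have : (N1 : ℝ) * c ≤ (N : ℝ) ^ (k + 1) * |q * a - m| := by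
    apply mul_le_mul (h7.trans h6) (h4.trans h5) hcpos.le (by positivity)
  rw [← hF] at h3
  linarith


lemma card_le_of_diff (s : Finset ℕ) (G : ℕ) (h : ∀ x ∈ s, ∀ y ∈ s, x ≤ y + G) : s.card ≤ G + 1 := by
  rcases s.eq_empty_or_nonempty with rfl | hne
  · simp
  · obtain ⟨x0, hx0, hmin⟩ := s.exists_min_image id hne
    have : s ⊆ Finset.Icc x0 (x0 + G) := by
      intro x hx
      rw [Finset.mem_Icc]
      exact ⟨hmin x hx, h x hx x0 hx0⟩
    refine (card_le_card this).trans ?_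
    rw [Nat.card_Icc]
    omega

noncomputable def SS (f : ℕ → ℝ) (X : ℕ) (β : ℝ) : ℂ := ∑ n ∈ range X, ee (β * f n)

lemma SS_neg (f : ℕ → ℝ) (X : ℕ) (β : ℝ) : ‖SS f X (-β)‖ = ‖SS f X β‖ := by
  have : SS f X (-β) = (starRingEnd ℂ) (SS f X β) := by
    unfold SS
    rw [map_sum]
    refine sum_congr rfl fun n _ => ?_
    rw [conj_ee, neg_mul]
  rw [this, Complex.norm_conj]

lemma level_count (k : ℕ) : ∃ E : ℕ, ∀ (a : ℝ) (f : ℕ → ℝ), 0 < a →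
    (∀ β : ℝ, IsP k (β * a) (fun n => β * f n)) → ∀ L : ℕ, 1 ≤ L → ∃ C : ℕ, ∀ X D : ℕ, 1 ≤ X → 1 ≤ D →
    #((range (X ^ (k + 1))).filter (fun j : ℕ => (X : ℝ) ≤ D * ‖SS f X ((j : ℝ) / (L * X ^ (k + 1)))‖)) ≤ C * D ^ E := by
  classical
  obtain ⟨C, E, hC, hw⟩ := weyl k
  refine ⟨3 * E, ?_⟩
  intro a f ha hf L hL
  obtain ⟨A, hA⟩ := exists_nat_ge a
  obtain ⟨W, hW⟩ := exists_nat_gt (1 / a)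
  have hW0 : 1 ≤ W := by
    have : (0 : ℝ) < W := lt_trans (by positivity) hW
    exact_mod_cast this
  have hWa : 1 ≤ W * a := by
    rw [div_lt_iff₀ ha] at hW; exact hW.le
  refine ⟨9 * C ^ 3 * (A + 1) * L * W, ?_⟩
  intro X D hX hD
  set F := C * D ^ E with hF
  have hF1 : 1 ≤ F := Nat.mul_pos hC (Nat.pow_pos hD)
  set M := X ^ (k + 1) with hM
  have hM1 : 1 ≤ M := Nat.one_le_pow _ _ hX
  have hMr : (1 : ℝ) ≤ M := by exact_mod_cast hM1
  have hMX : (X : ℝ) ^ (k + 1) = M := by rw [hM]; push_cast; ring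
  have hLr : (1 : ℝ) ≤ L := by exact_mod_cast hL
  have hFr : (1 : ℝ) ≤ F := by exact_mod_cast hF1
  set fib : ℕ × ℤ → Finset ℕ := fun qm => {j ∈ range M | |(qm.1 : ℝ) * j * a / L - qm.2 * M| ≤ F} with hfib
  set I := (Finset.Icc 1 F) ×ˢ (Finset.Icc (-(F * (A + 1) : ℤ)) (F * (A + 1))) with hI
  have hsub : (range M).filter (fun j : ℕ => (X : ℝ) ≤ D * ‖SS f X ((j : ℝ) / (L * X ^ (k + 1)))‖) ⊆ I.biUnion fib := by
    intro j hj
    rw [mem_filter] at hj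
    obtain ⟨hjM, hj⟩ := hj
    rw [mem_range] at hjM
    obtain ⟨q, h1, h2, m, h3⟩ := hw _ _ (hf _) D X X hD hX le_rfl hj
    rw [hMX] at h3
    have hjr : (j : ℝ) ≤ M := by exact_mod_cast hjM.le
    have h4 : |(q : ℝ) * j * a / L - m * M| ≤ F := by
      have e : (q : ℝ) * j * a / L - m * M = M * (q * ((j : ℝ) / (L * M) * a) - m) := by
        field_simp
      rw [e, abs_mul, Nat.abs_cast]
      exact h3
    have hqr : (q : ℝ) ≤ F := by exact_mod_cast h2
    have h5 : (q : ℝ) * j * a / L ≤ F * M * A := by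
      rw [div_le_iff₀ (by linarith)]
      calc (q : ℝ) * j * a ≤ F * M * A := by gcongr
        _ ≤ F * M * A * L := by
          apply le_mul_of_one_le_right (by positivity) hLr
    have h6 : 0 ≤ (q : ℝ) * j * a / L := by positivity
    rw [mem_biUnion]
    refine ⟨(q, m), ?_, ?_⟩
    · rw [hI, mem_product, Finset.mem_Icc, Finset.mem_Icc]
      refine ⟨⟨h1, h2⟩, ?_, ?_⟩
      · have : (-(F * (A + 1)) : ℝ) * M ≤ m * M := by
          have := (abs_le.mp h4).2
          have : (0 : ℝ) ≤ F * A * M := by positivity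
          nlinarith
        have := le_of_mul_le_mul_right this (by linarith)
        exact_mod_cast this
      · have : (m : ℝ) * M ≤ (F * (A + 1)) * M := by
          have := (abs_le.mp h4).1
          nlinarith
        have := le_of_mul_le_mul_right this (by linarith)
        exact_mod_cast this
    · rw [hfib, mem_filter, mem_range]
      exact ⟨hjM, h4⟩
  have hfc : ∀ qm ∈ I, (fib qm).card ≤ 2 * F * L * W + 1 := by
    rintro ⟨q, m⟩ hqm
    rw [hI, mem_product, Finset.mem_Icc] at hqm
    have hq1 : (1 : ℝ) ≤ q := by exact_mod_cast hqm.1.1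
    apply card_le_of_diff
    intro x hx y hy
    simp only [hfib, mem_filter] at hx hy
    have hx' := (abs_le.mp hx.2).2
    have hy' := (abs_le.mp hy.2).1
    have h1 : (q : ℝ) * x * a / L - q * y * a / L ≤ 2 * F := by linarith
    have h2 : (q : ℝ) * ((x - y) * a) ≤ 2 * F * L := by
      have e : (q : ℝ) * x * a / L - q * y * a / L = (q * ((x - y) * a)) / L := by ring
      rw [e, div_le_iff₀ (by linarith)] at h1
      exact h1
    by_contra hcon
    push Not at hcon
    have h3 : (y : ℝ) + 2 * F * L * W < x := by exact_mod_cast hcon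
    have h4 : 2 * F * L * W * a < (x - y) * a := by
      apply mul_lt_mul_of_pos_right _ ha
      linarith
    have h5 : 2 * (F : ℝ) * L ≤ 2 * F * L * W * a := by
      have : 2 * (F : ℝ) * L * 1 ≤ 2 * F * L * (W * a) := by gcongr
      linarith
    have h6 : (x - y) * a ≤ (q : ℝ) * ((x - y) * a) := by
      apply le_mul_of_one_le_left _ hq1
      have : 0 ≤ 2 * (F : ℝ) * L := by positivity
      linarith
    linarith
  have hIc : I.card ≤ 3 * F ^ 2 * (A + 1) := by
    rw [hI, card_product, Nat.card_Icc, Int.card_Icc]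
    have : ((F * (A + 1) : ℤ) + 1 - -(F * (A + 1) : ℤ)).toNat = 2 * (F * (A + 1)) + 1 := by
      have : ((F * (A + 1) : ℤ) + 1 - -(F * (A + 1) : ℤ)) = ((2 * (F * (A + 1)) + 1 : ℕ) : ℤ) := by
        push_cast; ring
      rw [this, Int.toNat_natCast]
    rw [this, Nat.add_sub_cancel]
    have : 1 ≤ F * (A + 1) := Nat.mul_pos hF1 (by omega)
    calc F * (2 * (F * (A + 1)) + 1) ≤ F * (2 * (F * (A + 1)) + F * (A + 1)) := by gcongr
      _ = _ := by ring
  calc _ ≤ (I.biUnion fib).card := card_le_card hsub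
    _ ≤ I.card * (2 * F * L * W + 1) := card_biUnion_le_card_mul _ _ _ hfc
    _ ≤ (3 * F ^ 2 * (A + 1)) * (2 * F * L * W + F * L * W) := by
      gcongr
      have : 0 < F * L * W := by positivity
      omega
    _ = 9 * C ^ 3 * (A + 1) * L * W * D ^ (3 * E) := by
      rw [hF, mul_comm 3 E, pow_mul]; ring

lemma moment (k : ℕ) : ∃ u : ℕ, 1 ≤ u ∧ ∀ (a : ℝ) (f : ℕ → ℝ), 0 < a →
    (∀ β : ℝ, IsP k (β * a) (fun n => β * f n)) → ∀ L : ℕ, 1 ≤ L → ∃ C : ℝ, 0 < C ∧ ∀ X : ℕ, 1 ≤ X →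
    ∑ j ∈ range (X ^ (k + 1)), ‖SS f X ((j : ℝ) / (L * X ^ (k + 1)))‖ ^ (2 * u) ≤ C * X ^ (2 * u) := by
  classical
  obtain ⟨E, hE⟩ := level_count k
  refine ⟨E + 1, by omega, ?_⟩
  intro a f ha hf L hL
  obtain ⟨C, hC⟩ := hE a f ha hf L hL
  set Z : ℝ := ∑' D : ℕ, 1 / (D : ℝ) ^ 2 with hZ
  have hsumm : Summable (fun D : ℕ => 1 / (D : ℝ) ^ 2) := Real.summable_one_div_nat_pow.mpr (by norm_num)
  have hZ0 : 0 ≤ Z := tsum_nonneg (fun D => by positivity)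
  refine ⟨C * 2 ^ (2 * (E + 1)) * Z + 1, by positivity, ?_⟩
  intro X hX
  have hXr : (0 : ℝ) < X := by exact_mod_cast hX
  set s : ℕ → ℝ := fun j => ‖SS f X ((j : ℝ) / (L * X ^ (k + 1)))‖ with hs
  have hs0 : ∀ j, 0 ≤ s j := fun j => norm_nonneg _
  have hsX : ∀ j, s j ≤ X := by
    intro j
    refine (norm_sum_le _ _).trans ?_
    simp only [norm_ee, sum_const, card_range, nsmul_eq_mul, mul_one, le_refl]
  set J := {j ∈ range (X ^ (k + 1)) | s j ≠ 0} with hJ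
  set Df : ℕ → ℕ := fun j => ⌈(X : ℝ) / s j⌉₊ with hDf
  have hfacts : ∀ j ∈ J, 1 ≤ Df j ∧ (X : ℝ) ≤ Df j * s j ∧ s j ≤ 2 * X / Df j := by
    intro j hj
    rw [hJ, mem_filter] at hj
    have hp : 0 < s j := lt_of_le_of_ne (hs0 j) (Ne.symm hj.2)
    have h1 : 1 ≤ (X : ℝ) / s j := by rw [le_div_iff₀ hp]; linarith [hsX j]
    have h2 : (X : ℝ) / s j ≤ Df j := Nat.le_ceil _
    have h3 : (Df j : ℝ) < X / s j + 1 := Nat.ceil_lt_add_one (by positivity)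
    have h4 : (1 : ℝ) ≤ Df j := h1.trans h2
    refine ⟨by exact_mod_cast h4, ?_, ?_⟩
    · rwa [div_le_iff₀ hp] at h2
    · rw [le_div_iff₀ (by linarith)]
      have h5 : (Df j : ℝ) ≤ 2 * (X / s j) := by linarith
      calc s j * Df j ≤ s j * (2 * (X / s j)) := by gcongr
        _ = 2 * X := by field_simp
  have hstep1 : ∑ j ∈ range (X ^ (k + 1)), s j ^ (2 * (E + 1)) = ∑ j ∈ J, s j ^ (2 * (E + 1)) := by
    symm
    apply sum_subset (filter_subset _ _)
    intro j hj hj2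
    have : s j = 0 := by
      by_contra hcon
      exact hj2 (mem_filter.mpr ⟨hj, hcon⟩)
    rw [this, zero_pow (by omega)]
  have hstep2 : ∑ j ∈ J, s j ^ (2 * (E + 1)) ≤ ∑ j ∈ J, (2 * X / (Df j : ℝ)) ^ (2 * (E + 1)) := by
    apply sum_le_sum
    intro j hj
    have := hs0 j
    gcongr
    exact (hfacts j hj).2.2
  have hstep3 : ∑ j ∈ J, (2 * X / (Df j : ℝ)) ^ (2 * (E + 1)) =
      ∑ D ∈ J.image Df, #{j ∈ J | Df j = D} • (2 * X / (D : ℝ)) ^ (2 * (E + 1)) :=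
    sum_comp (fun D : ℕ => (2 * X / (D : ℝ)) ^ (2 * (E + 1))) Df
  have hstep4 : ∑ D ∈ J.image Df, #{j ∈ J | Df j = D} • (2 * X / (D : ℝ)) ^ (2 * (E + 1)) ≤
      ∑ D ∈ J.image Df, (C * (2 * X) ^ (2 * (E + 1))) * (1 / (D : ℝ) ^ 2) := by
    apply sum_le_sum
    intro D hD
    rw [mem_image] at hD
    obtain ⟨j0, hj0, rfl⟩ := hD
    set D := Df j0
    have hD1 : 1 ≤ D := (hfacts j0 hj0).1
    have hDr : (1 : ℝ) ≤ D := by exact_mod_cast hD1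
    have hcard : #{j ∈ J | Df j = D} ≤ C * D ^ E := by
      refine le_trans (card_le_card ?_) (hC X D hX hD1)
      intro j hj
      rw [mem_filter] at hj ⊢
      have h1 := hfacts j hj.1
      rw [hj.2] at h1
      refine ⟨?_, h1.2.1⟩
      rw [hJ, mem_filter] at hj
      exact hj.1.1
    rw [nsmul_eq_mul]
    have hcr : (#{j ∈ J | Df j = D} : ℝ) ≤ C * D ^ E := by exact_mod_cast hcard
    calc (#{j ∈ J | Df j = D} : ℝ) * (2 * X / (D : ℝ)) ^ (2 * (E + 1))
        ≤ (C * D ^ E) * (2 * X / (D : ℝ)) ^ (2 * (E + 1)) := by gcongr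
      _ = (C * (2 * X) ^ (2 * (E + 1))) * (D ^ E / (D : ℝ) ^ (2 * (E + 1))) := by
        rw [div_pow]; ring
      _ ≤ _ := by
        refine mul_le_mul_of_nonneg_left ?_ (by positivity)
        rw [div_le_div_iff₀ (by positivity) (by positivity), one_mul, ← pow_add]
        exact pow_le_pow_right₀ hDr (by omega)
  have hstep5 : ∑ D ∈ J.image Df, (C * (2 * X) ^ (2 * (E + 1))) * (1 / (D : ℝ) ^ 2) ≤
      (C * (2 * X) ^ (2 * (E + 1))) * Z := by
    rw [← mul_sum]
    gcongr
    exact hsumm.sum_le_tsum _ (fun i _ => by positivity)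
  rw [hstep1]
  refine hstep2.trans ?_
  rw [hstep3]
  refine hstep4.trans (hstep5.trans ?_)
  rw [mul_pow]
  have : (0 : ℝ) ≤ (X : ℝ) ^ (2 * (E + 1)) := by positivity
  nlinarith

lemma normsq_sum {ι : Type*} (s : Finset ι) (z : ι → ℝ) :
    ((‖∑ i ∈ s, ee (z i)‖ ^ 2 : ℝ) : ℂ) = ∑ i ∈ s, ∑ j ∈ s, ee (z i - z j) := by
  rw [← Complex.normSq_eq_norm_sq, ← Complex.mul_conj, map_sum, sum_mul_sum]
  refine sum_congr rfl fun i _ => sum_congr rfl fun j _ => ?_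
  rw [conj_ee, ← ee_add, sub_eq_add_neg]

lemma dual {ι κ : Type*} (s : Finset ι) (t : Finset κ) (x : ι → ℝ) (y : κ → ℝ) :
    ∑ a ∈ s, ∑ b ∈ s, ‖∑ i ∈ t, ee (y i * (x a - x b))‖ ^ 2 =
    ∑ i ∈ t, ∑ j ∈ t, ‖∑ a ∈ s, ee ((y i - y j) * x a)‖ ^ 2 := by
  have : ((∑ a ∈ s, ∑ b ∈ s, ‖∑ i ∈ t, ee (y i * (x a - x b))‖ ^ 2 : ℝ) : ℂ) =
    ((∑ i ∈ t, ∑ j ∈ t, ‖∑ a ∈ s, ee ((y i - y j) * x a)‖ ^ 2 : ℝ) : ℂ) := by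
    rw [Complex.ofReal_sum, Complex.ofReal_sum]
    simp_rw [Complex.ofReal_sum, normsq_sum]
    calc _ = ∑ a ∈ s, ∑ i ∈ t, ∑ b ∈ s, ∑ j ∈ t, ee (y i * (x a - x b) - y j * (x a - x b)) := by
          refine sum_congr rfl fun a _ => ?_
          rw [sum_comm]
      _ = ∑ i ∈ t, ∑ a ∈ s, ∑ b ∈ s, ∑ j ∈ t, ee (y i * (x a - x b) - y j * (x a - x b)) := by
          rw [sum_comm]
      _ = ∑ i ∈ t, ∑ a ∈ s, ∑ j ∈ t, ∑ b ∈ s, ee (y i * (x a - x b) - y j * (x a - x b)) := by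
          refine sum_congr rfl fun i _ => sum_congr rfl fun a _ => ?_
          rw [sum_comm]
      _ = ∑ i ∈ t, ∑ j ∈ t, ∑ a ∈ s, ∑ b ∈ s, ee (y i * (x a - x b) - y j * (x a - x b)) := by
          refine sum_congr rfl fun i _ => ?_
          rw [sum_comm]
      _ = _ := by
          refine sum_congr rfl fun i _ => sum_congr rfl fun j _ => sum_congr rfl fun a _ =>
            sum_congr rfl fun b _ => ?_
          congr 1
          ring
  exact_mod_cast this

lemma dist_sum (g : ℕ → ℝ) (hg : ∀ d, 0 ≤ g d) (G : ℤ → ℝ) (hG : ∀ d : ℕ, G d = g d ∧ G (-d) = g d) (M i : ℕ)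
    (hi : i < M) : ∑ j ∈ range M, G ((i : ℤ) - j) ≤ 2 * ∑ d ∈ range M, g d := by
  have hmono : ∀ n ≤ M, ∑ d ∈ range n, g d ≤ ∑ d ∈ range M, g d := by
    intro n hn
    exact sum_le_sum_of_subset_of_nonneg (range_subset_range.mpr hn) (fun d _ _ => hg d)
  rw [← sum_range_add_sum_Ico _ (Nat.succ_le_of_lt hi)]
  have h1 : ∑ j ∈ range (i + 1), G ((i : ℤ) - j) ≤ ∑ d ∈ range M, g d := by
    refine le_trans (le_of_eq ?_) (hmono (i + 1) hi)
    rw [← sum_range_reflect g]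
    refine sum_congr rfl fun j hj => ?_
    rw [mem_range] at hj
    rw [← (hG _).1]
    congr 1
    omega
  have h2 : ∑ j ∈ Ico (i + 1) M, G ((i : ℤ) - j) ≤ ∑ d ∈ range M, g d := by
    rw [sum_Ico_eq_sum_range]
    refine le_trans ?_ (hmono (M - (i + 1) + 1) (by omega))
    rw [sum_range_succ']
    have : ∑ j ∈ range (M - (i + 1)), G ((i : ℤ) - ((i + 1 + j : ℕ) : ℤ)) = ∑ j ∈ range (M - (i + 1)), g (j + 1) := by
      refine sum_congr rfl fun j hj => ?_
      rw [← (hG _).2]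
      congr 1
      omega
    rw [this]
    linarith [hg 0]
  change ∑ j ∈ range (i + 1), G ((i : ℤ) - j) + ∑ j ∈ Ico (i + 1) M, G ((i : ℤ) - j) ≤ _
  linarith

lemma density (k : ℕ) : ∃ u : ℕ, 1 ≤ u ∧ ∀ (a : ℝ) (f : ℕ → ℝ), 0 < a →
    (∀ β : ℝ, IsP k (β * a) (fun n => β * f n)) → ∃ C : ℝ, 0 < C ∧ ∀ X : ℕ, 1 ≤ X →
    (X : ℝ) ^ (k + 1) ≤ C * #((univ : Finset (Fin u → Fin X)).image (fun t => ∑ i, ⌊f (t i)⌋)) := by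
  classical
  obtain ⟨u, hu, hmom⟩ := moment k
  refine ⟨u, hu, ?_⟩
  intro a f ha hf
  obtain ⟨C, hC0, hC⟩ := hmom a f ha hf (8 * u) (by omega)
  refine ⟨8 * C, by positivity, ?_⟩
  intro X hX
  have hX0 : (0 : ℝ) < X := by exact_mod_cast hX
  have hur : (1 : ℝ) ≤ u := by exact_mod_cast hu
  specialize hC X hX
  set M := X ^ (k + 1) with hM
  have hMX : (X : ℝ) ^ (k + 1) = M := by rw [hM]; push_cast; ring
  rw [hMX] at hC ⊢
  have hM0 : (0 : ℝ) < M := by rw [← hMX]; positivity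
  set T := (univ : Finset (Fin u → Fin X)) with hT
  set Fl : (Fin u → Fin X) → ℤ := fun t => ∑ i, ⌊f (t i)⌋ with hFl
  set Fv : (Fin u → Fin X) → ℝ := fun t => ∑ i, f (t i) with hFv
  have hclose : ∀ t, (Fl t : ℝ) ≤ Fv t ∧ Fv t ≤ Fl t + u := by
    intro t
    simp only [hFl, hFv]
    push_cast
    constructor
    · exact sum_le_sum fun i _ => Int.floor_le _
    · have : (u : ℝ) = ∑ i : Fin u, (1 : ℝ) := by simp
      rw [this, ← sum_add_distrib]
      exact sum_le_sum fun i _ => (Int.lt_floor_add_one _).le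
  set y : ℕ → ℝ := fun i => (i : ℝ) / (8 * u * M) with hy
  -- lower bound of the kernel
  have hker : ∀ s t, Fl s = Fl t → (M : ℝ) ^ 2 ≤ 4 * ‖∑ i ∈ range M, ee (y i * (Fv s - Fv t))‖ ^ 2 := by
    intro s t hst
    have h1 : |Fv s - Fv t| ≤ u := by
      have := hclose s
      have := hclose t
      rw [hst] at *
      rw [abs_le]
      constructor <;> linarith
    have h2 : (M : ℝ) / 2 ≤ ‖∑ i ∈ range M, ee (y i * (Fv s - Fv t))‖ := by
      refine le_trans ?_ (Complex.re_le_norm _)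
      rw [Complex.re_sum]
      have : (M : ℝ) / 2 = ∑ i ∈ range M, (1 / 2 : ℝ) := by simp; ring
      rw [this]
      apply sum_le_sum
      intro i hi
      rw [mem_range] at hi
      rw [ee_re]
      have hyi : |y i| ≤ 1 / (8 * u) := by
        rw [hy, abs_of_nonneg (by positivity), div_le_div_iff₀ (by positivity) (by positivity)]
        have : (i : ℝ) ≤ M := by exact_mod_cast hi.le
        nlinarith
      have hb : |y i * (Fv s - Fv t)| ≤ 1 / 8 := by
        rw [abs_mul]
        calc |y i| * |Fv s - Fv t| ≤ 1 / (8 * u) * u := by gcongr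
          _ = 1 / 8 := by field_simp
      rw [← Real.cos_abs, ← Real.cos_pi_div_three]
      have hpi := Real.pi_pos
      have e : |2 * Real.pi * (y i * (Fv s - Fv t))| = 2 * Real.pi * |y i * (Fv s - Fv t)| := by
        rw [abs_mul, abs_of_pos (by positivity)]
      rw [e]
      apply Real.cos_le_cos_of_nonneg_of_le_pi (by positivity)
      · linarith
      · nlinarith
    nlinarith
  -- Cauchy-Schwarz
  have hcs : ((X : ℝ) ^ u) ^ 2 ≤ #(T.image Fl) * ∑ v ∈ T.image Fl, (#{t ∈ T | Fl t = v} : ℝ) ^ 2 := by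
    have h1 : ((X : ℝ) ^ u) = ∑ v ∈ T.image Fl, (#{t ∈ T | Fl t = v} : ℝ) := by
      have := card_eq_sum_card_image Fl T
      rw [hT, card_univ, Fintype.card_fun, Fintype.card_fin, Fintype.card_fin] at this
      exact_mod_cast this
    rw [h1]
    exact sq_sum_le_card_mul_sum_sq
  have hpairs : ∑ v ∈ T.image Fl, (#{t ∈ T | Fl t = v} : ℝ) ^ 2 =
      ∑ s ∈ T, ∑ t ∈ T, if Fl s = Fl t then (1 : ℝ) else 0 := by
    have h1 := sum_comp (s := T) (fun v : ℤ => (#{t ∈ T | Fl t = v} : ℝ)) Fl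
    have h2 : ∀ s ∈ T, (∑ t ∈ T, if Fl s = Fl t then (1 : ℝ) else 0) = #{t ∈ T | Fl t = Fl s} := by
      intro s _
      rw [sum_boole]
      congr 2
      ext t
      simp only [mem_filter, eq_comm]
    rw [sum_congr rfl h2, h1]
    refine sum_congr rfl fun v _ => ?_
    rw [nsmul_eq_mul, sq]
  have hE : (M : ℝ) ^ 2 * ∑ s ∈ T, ∑ t ∈ T, (if Fl s = Fl t then (1 : ℝ) else 0) ≤
      4 * ∑ s ∈ T, ∑ t ∈ T, ‖∑ i ∈ range M, ee (y i * (Fv s - Fv t))‖ ^ 2 := by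
    rw [mul_sum, mul_sum]
    refine sum_le_sum fun s _ => ?_
    rw [mul_sum, mul_sum]
    refine sum_le_sum fun t _ => ?_
    split_ifs with h
    · rw [mul_one]; exact hker s t h
    · rw [mul_zero]; positivity
  rw [dual] at hE
  have hprod : ∀ β : ℝ, ∑ t ∈ T, ee (β * Fv t) = (SS f X β) ^ u := by
    intro β
    unfold SS
    rw [Finset.sum_range, Fintype.sum_pow]
    refine sum_congr rfl fun t _ => ?_
    rw [hFv]
    simp only
    rw [mul_sum]
    have : ∀ (w : Finset (Fin u)) (z : Fin u → ℝ), ee (∑ i ∈ w, z i) = ∏ i ∈ w, ee (z i) := by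
      intro w z
      induction w using Finset.induction_on with
      | empty => simp [ee_zero]
      | insert i w hi ih => rw [sum_insert hi, prod_insert hi, ee_add, ih]
    exact this _ _
  set g : ℕ → ℝ := fun d => ‖SS f X ((d : ℝ) / (8 * u * M))‖ ^ (2 * u) with hg
  have hdiag : ∑ i ∈ range M, ∑ j ∈ range M, ‖∑ t ∈ T, ee ((y i - y j) * Fv t)‖ ^ 2 ≤
      M * (2 * ∑ d ∈ range M, g d) := by
    have h1 : ∀ i ∈ range M, ∑ j ∈ range M, ‖∑ t ∈ T, ee ((y i - y j) * Fv t)‖ ^ 2 ≤ 2 * ∑ d ∈ range M, g d := by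
      intro i hi
      rw [mem_range] at hi
      refine le_trans (le_of_eq ?_) (dist_sum g (fun d => by positivity)
        (fun z : ℤ => ‖SS f X ((z : ℝ) / (8 * u * M))‖ ^ (2 * u)) ?_ M i hi)
      · refine sum_congr rfl fun j _ => ?_
        rw [hprod, norm_pow, ← pow_mul, mul_comm u 2]
        congr 3
        rw [hy]
        push_cast
        ring
      · intro d
        refine ⟨by simp [hg], ?_⟩
        simp only [hg]
        push_cast
        rw [neg_div, SS_neg]
    refine (sum_le_sum h1).trans ?_
    rw [sum_const, card_range, nsmul_eq_mul]
  have hg2 : ∑ d ∈ range M, g d ≤ C * X ^ (2 * u) := by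
    refine le_trans (le_of_eq ?_) hC
    refine sum_congr rfl fun d _ => ?_
    simp only [hg]
    push_cast
    rfl
  rw [hpairs] at hcs
  set P := ∑ s ∈ T, ∑ t ∈ T, (if Fl s = Fl t then (1 : ℝ) else 0)
  set K : ℝ := ((#(T.image Fl) : ℕ) : ℝ) with hK
  have hK0 : 0 ≤ K := by positivity
  have hX2 : ((X : ℝ) ^ u) ^ 2 = X ^ (2 * u) := by rw [← pow_mul, mul_comm]
  rw [hX2] at hcs
  have hXp : (0 : ℝ) < X ^ (2 * u) := by positivity
  have hP : (M : ℝ) ^ 2 * P ≤ M * (8 * C * X ^ (2 * u)) := by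
    refine hE.trans ?_
    have : 4 * ((M : ℝ) * (2 * ∑ d ∈ range M, g d)) ≤ 4 * (M * (2 * (C * X ^ (2 * u)))) := by gcongr
    linarith
  have hP2 : (M : ℝ) * P ≤ 8 * C * X ^ (2 * u) := by
    have : (M : ℝ) * (M * P) ≤ M * (8 * C * X ^ (2 * u)) := by linarith
    exact le_of_mul_le_mul_left this hM0
  have hfin : (M : ℝ) * X ^ (2 * u) ≤ (8 * C * K) * X ^ (2 * u) := by
    calc (M : ℝ) * X ^ (2 * u) ≤ M * (K * P) := by gcongr
      _ = K * (M * P) := by ring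
      _ ≤ K * (8 * C * X ^ (2 * u)) := by gcongr
      _ = _ := by ring
  exact le_of_mul_le_mul_right hfin hXp


section sch
open scoped Pointwise
open Classical in
noncomputable def cnt (A : Set ℕ) (n : ℕ) : ℕ := ∑ i ∈ range n, if i + 1 ∈ A then 1 else 0

lemma cnt_succ (A : Set ℕ) (n : ℕ) : cnt A (n + 1) = cnt A n + (open Classical in if n + 1 ∈ A then 1 else 0) := by
  classical
  unfold cnt
  rw [sum_range_succ]

lemma cnt_add (A : Set ℕ) (n m : ℕ) : cnt A (n + m) = cnt A n + cnt {x | n + x ∈ A} m := by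
  classical
  unfold cnt
  rw [sum_range_add]
  rfl

lemma cnt_mono (A B : Set ℕ) (n : ℕ) (h : ∀ i, 1 ≤ i → i ≤ n → i ∈ A → i ∈ B) : cnt A n ≤ cnt B n := by
  classical
  unfold cnt
  apply sum_le_sum
  intro i hi
  rw [mem_range] at hi
  by_cases h1 : i + 1 ∈ A
  · rw [if_pos h1, if_pos (h _ (by omega) (by omega) h1)]
  · rw [if_neg h1]; omega

lemma cnt_le (A : Set ℕ) (n : ℕ) : cnt A n ≤ n := by
  induction n with
  | zero => simp [cnt]
  | succ n ih => rw [cnt_succ]; split_ifs <;> omega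

lemma cnt_eq_zero (A : Set ℕ) (n : ℕ) (h : ∀ i, 1 ≤ i → i ≤ n → i ∉ A) : cnt A n = 0 := by
  classical
  unfold cnt
  apply sum_eq_zero
  intro i hi
  rw [mem_range] at hi
  rw [if_neg (h _ (by omega) (by omega))]

lemma sch_add (A B : Set ℕ) (β : ℝ) (hA : 0 ∈ A) (hB0 : 0 ∈ B) (hB : ∀ n, β * n ≤ cnt B n) (n : ℕ) :
    (cnt A n : ℝ) + β * (n - cnt A n) ≤ cnt (A + B) n := by
  classical
  induction n using Nat.strong_induction_on with
  | _ n ih =>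
    rcases n with _ | n
    · simp [cnt]
    · by_cases hn : n + 1 ∈ A
      · have h1 := ih n (by omega)
        have h2 : n + 1 ∈ A + B := ⟨n + 1, hn, 0, hB0, by simp⟩
        rw [cnt_succ, cnt_succ, if_pos hn, if_pos h2]
        push_cast
        linarith
      · set a := Nat.findGreatest (· ∈ A) (n + 1) with ha
        have haA : a ∈ A := Nat.findGreatest_spec (P := (· ∈ A)) (Nat.zero_le _) hA
        have hale : a ≤ n + 1 := Nat.findGreatest_le _
        have hane : a ≠ n + 1 := fun h => hn (h ▸ haA)
        obtain ⟨m, hm⟩ : ∃ m, n + 1 = a + m := ⟨n + 1 - a, by omega⟩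
        have h1 := ih a (by omega)
        have hz : cnt {x | a + x ∈ A} m = 0 := by
          apply cnt_eq_zero
          intro i hi him hiA
          exact Nat.findGreatest_is_greatest (P := (· ∈ A)) (n := n + 1) (k := a + i) (by omega) (by omega) hiA
        have h2 : cnt B m ≤ cnt {x | a + x ∈ A + B} m := by
          apply cnt_mono
          intro i _ _ hi
          exact ⟨a, haA, i, hi, rfl⟩
        have h3 := hB m
        have h4 : (cnt B m : ℝ) ≤ cnt {x | a + x ∈ A + B} m := by exact_mod_cast h2
        rw [hm, cnt_add, cnt_add, hz]
        push_cast
        linarith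

lemma zero_mem_ns (A : Set ℕ) (hA : 0 ∈ A) (h : ℕ) : 0 ∈ h • A := by
  induction h with
  | zero => simp
  | succ h ih => rw [succ_nsmul]; exact ⟨0, ih, 0, hA, by simp⟩

lemma sch_main (S : Set ℕ) (γ : ℝ) (hγ : 1 / 2 < γ) (h0 : 0 ∈ S) (h : ∀ n, γ * n ≤ cnt S n) (n : ℕ) :
    n ∈ S + S := by
  classical
  by_contra hcon
  rcases n with _ | n
  · exact hcon ⟨0, h0, 0, h0, rfl⟩
  · have hnS : n + 1 ∉ S := fun hh => hcon ⟨n + 1, hh, 0, h0, by simp⟩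
    have h1 := h (n + 1)
    rw [cnt_succ, if_neg hnS, add_zero] at h1
    have h2 : 2 * cnt S n ≤ n := by
      have e : cnt S n = ∑ i ∈ range n, if n - 1 - i + 1 ∈ S then 1 else 0 := by
        unfold cnt
        rw [← sum_range_reflect]
      rw [two_mul]
      nth_rewrite 2 [e]
      unfold cnt
      rw [← sum_add_distrib]
      calc _ ≤ ∑ i ∈ range n, 1 := by
            apply sum_le_sum
            intro i hi
            rw [mem_range] at hi
            split_ifs with c1 c2
            · exfalso
              exact hcon ⟨i + 1, c1, n - 1 - i + 1, c2, by simp only; omega⟩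
            all_goals omega
        _ = n := by simp
    have h3 : 2 * (cnt S n : ℝ) ≤ n := by exact_mod_cast h2
    push_cast at h1
    nlinarith

lemma schnirel (S : Set ℕ) (α : ℝ) (hα : 0 < α) (h0 : 0 ∈ S) (h : ∀ n, α * n ≤ cnt S n) :
    ∃ H : ℕ, ∀ n, n ∈ H • S := by
  have hα1 : α ≤ 1 := by
    have h1 := h 1
    have h2 : (cnt S 1 : ℝ) ≤ 1 := by exact_mod_cast cnt_le S 1
    push_cast at h1
    linarith
  have hd : ∀ m n : ℕ, (1 - (1 - α) ^ m) * n ≤ cnt (m • S) n := by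
    intro m
    induction m with
    | zero => intro n; simp
    | succ m ih =>
      intro n
      rw [succ_nsmul]
      refine le_trans ?_ (sch_add (m • S) S α (zero_mem_ns S h0 m) h0 h n)
      have := ih n
      have e : (1 - (1 - α) ^ (m + 1)) * n = (1 - α) * ((1 - (1 - α) ^ m) * n) + α * n := by ring
      rw [e]
      nlinarith [mul_le_mul_of_nonneg_left this (by linarith : 0 ≤ 1 - α)]
  obtain ⟨m, hm⟩ := exists_pow_lt_of_lt_one (by norm_num : (0 : ℝ) < 1 / 2) (by linarith : 1 - α < 1)
  refine ⟨m + m, fun n => ?_⟩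
  rw [add_nsmul]
  exact sch_main (m • S) (1 - (1 - α) ^ m) (by linarith) (zero_mem_ns S h0 m) (hd m) n

lemma consecutive (A : Set ℕ) (h0 : 0 ∈ A) (hA : ∀ d : ℕ, 2 ≤ d → ¬ ∀ x ∈ A, d ∣ x) :
    ∃ t m : ℕ, m ∈ t • A ∧ m + 1 ∈ t • A := by
  let G : AddSubgroup ℤ :=
    { carrier := {x | ∃ t y z : ℕ, y ∈ t • A ∧ z ∈ t • A ∧ x = (y : ℤ) - z}
      zero_mem' := ⟨0, 0, 0, by simp, by simp, by simp⟩
      add_mem' := by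
        rintro x x' ⟨t, y, z, hy, hz, rfl⟩ ⟨t', y', z', hy', hz', rfl⟩
        refine ⟨t + t', y + y', z + z', ?_, ?_, by push_cast; ring⟩
        · rw [add_nsmul]; exact ⟨y, hy, y', hy', rfl⟩
        · rw [add_nsmul]; exact ⟨z, hz, z', hz', rfl⟩
      neg_mem' := by
        rintro x ⟨t, y, z, hy, hz, rfl⟩
        exact ⟨t, z, y, hz, hy, by ring⟩ }
  have hAG : ∀ x ∈ A, (x : ℤ) ∈ G := by
    intro x hx
    exact ⟨1, x, 0, by simpa using hx, by simpa using h0, by simp⟩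
  obtain ⟨d, hd⟩ := Int.subgroup_cyclic G
  have hmem : ∀ x : ℤ, x ∈ G ↔ d ∣ x := by
    intro x
    rw [hd, AddSubgroup.mem_closure_singleton]
    constructor
    · rintro ⟨n, rfl⟩; exact ⟨n, by simp [mul_comm]⟩
    · rintro ⟨n, rfl⟩; exact ⟨n, by simp [mul_comm]⟩
  have hdvd : ∀ x ∈ A, d.natAbs ∣ x := by
    intro x hx
    exact Int.natCast_dvd_natCast.mp (by
      rw [Int.natAbs_dvd]
      exact (hmem x).mp (hAG x hx))
  have hd1 : d.natAbs = 1 := by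
    by_contra hne
    rcases Nat.lt_or_ge d.natAbs 2 with hlt | hge
    · have hz : d.natAbs = 0 := by omega
      apply hA 2 le_rfl
      intro x hx
      have := hdvd x hx
      rw [hz, zero_dvd_iff] at this
      simp [this]
    · exact hA _ hge hdvd
  have h1 : (1 : ℤ) ∈ G := by
    rw [hmem]
    exact Int.natAbs_dvd.mp (by rw [hd1]; simp)
  obtain ⟨t, y, z, hy, hz, hyz⟩ := h1
  refine ⟨t, z, hz, ?_⟩
  have : y = z + 1 := by omega
  rwa [← this]

lemma run (A : Set ℕ) (t m : ℕ) (h1 : m ∈ t • A) (h2 : m + 1 ∈ t • A) (H : ℕ) :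
    ∀ j ≤ H, H * m + j ∈ (H * t) • A := by
  induction H with
  | zero => intro j hj; simp; omega
  | succ H ih =>
    intro j hj
    rw [Nat.succ_mul, add_nsmul]
    rcases Nat.lt_or_ge H j with hlt | hge
    · exact ⟨H * m + H, ih H le_rfl, m + 1, h2, by simp only; rw [Nat.succ_mul]; omega⟩
    · exact ⟨H * m + j, ih j hge, m, h1, by simp only; rw [Nat.succ_mul]; omega⟩

lemma split_one (A : Set ℕ) (h0 : 0 ∈ A) (u : ℕ) (h : ℕ) :
    ∀ n ∈ h • (u • A ∪ {1}), ∃ y ∈ (h * u) • A, ∃ j ≤ h, n = y + j := by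
  induction h with
  | zero =>
    intro n hn
    have : n = 0 := by simpa using hn
    exact ⟨0, by simp, 0, le_rfl, by omega⟩
  | succ h ih =>
    intro n hn
    rw [succ_nsmul] at hn
    obtain ⟨x, hx, z, hz, rfl⟩ := hn
    obtain ⟨y, hy, j, hj, rfl⟩ := ih x hx
    rw [Nat.succ_mul, add_nsmul]
    rcases hz with hz | hz
    · exact ⟨y + z, ⟨y, hy, z, hz, rfl⟩, j, by omega, by simp only; omega⟩
    · rw [Set.mem_singleton_iff] at hz
      exact ⟨y + 0, ⟨y, hy, 0, zero_mem_ns A h0 u, rfl⟩, j + 1, by omega, by simp only; omega⟩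

lemma mem_ns (g : ℕ → ℕ) (s : ℕ) : ∀ n, n ∈ s • Set.range g ↔ ∃ t : Fin s → ℕ, ∑ i, g (t i) = n := by
  induction s with
  | zero =>
    intro n
    simp [eq_comm]
  | succ s ih =>
    intro n
    rw [succ_nsmul]
    constructor
    · rintro ⟨x, hx, _, ⟨w, rfl⟩, rfl⟩
      obtain ⟨t, rfl⟩ := (ih x).mp hx
      refine ⟨Fin.cons w t, ?_⟩
      rw [Fin.sum_univ_succ]
      simp [add_comm]
    · rintro ⟨t, rfl⟩
      rw [Fin.sum_univ_succ]
      exact ⟨∑ i : Fin s, g (t i.succ), (ih _).mpr ⟨_, rfl⟩, g (t 0), ⟨_, rfl⟩, by simp only; rw [add_comm]⟩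

/-- additive combinatorics: positive density plus gcd condition gives a basis -/
lemma basis_of_density (g : ℕ → ℕ) (hg0 : ∃ n, g n = 0) (hgcd : ∀ d : ℕ, 2 ≤ d → ¬ ∀ n, d ∣ g n)
    (u : ℕ) (α : ℝ) (hα : 0 < α) (hd : ∀ n, α * n ≤ cnt (u • Set.range g ∪ {1}) n) :
    ∃ s N₀ : ℕ, ∀ N ≥ N₀, ∃ t : Fin s → ℕ, ∑ i, g (t i) = N := by
  set A := Set.range g with hA
  have h0 : 0 ∈ A := hg0
  obtain ⟨H, hH⟩ := schnirel (u • A ∪ {1}) α hα (Or.inl (zero_mem_ns A h0 u)) hd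
  obtain ⟨t, m, h1, h2⟩ := consecutive A h0 (by
    intro d hd hall
    exact hgcd d hd (fun n => hall _ ⟨n, rfl⟩))
  refine ⟨H * u + H * t, H * m, fun N hN => ?_⟩
  rw [← mem_ns, add_nsmul]
  obtain ⟨y, hy, j, hj, hyj⟩ := split_one A h0 u H (N - H * m) (hH _)
  exact ⟨y, hy, H * m + j, run A t m h1 h2 H j hj, by simp only; omega⟩

end sch

lemma irr_not_congr (p : ℝ[X]) (hirr : ∃ i : ℕ, 1 ≤ i ∧ Irrational (p.coeff i)) (d : ℕ) (hd : 2 ≤ d) (r : ℤ)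
    (h : ∀ n : ℕ, (d : ℤ) ∣ ⌊p.eval (n : ℝ)⌋ - r) : False := by
  classical
  obtain ⟨i0, hi0, hirr0⟩ := hirr
  have hle : ∀ i, Irrational (p.coeff i) → i ≤ p.natDegree := by
    intro i hi
    apply le_natDegree_of_ne_zero
    exact hi.ne_zero
  set j := Nat.findGreatest (fun i => Irrational (p.coeff i)) p.natDegree with hj
  have hjirr : Irrational (p.coeff j) := Nat.findGreatest_spec (P := fun i => Irrational (p.coeff i)) (hle i0 hirr0) hirr0
  have hj1 : 1 ≤ j := hi0.trans (Nat.le_findGreatest (hle i0 hirr0) hirr0)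
  have hjn : j ≤ p.natDegree := hle j hjirr
  have hdr : (2 : ℝ) ≤ d := by exact_mod_cast hd
  have hdp : (0 : ℝ) < d := by linarith
  have hrat : ∀ i, j < i → ∃ ρ : ℚ, (ρ : ℝ) = p.coeff i / d := by
    intro i hi
    have : ¬ Irrational (p.coeff i) := by
      intro hir
      have := Nat.le_findGreatest (P := fun i => Irrational (p.coeff i)) (hle i hir) hir
      omega
    rw [Irrational, not_not] at this
    obtain ⟨x, hx⟩ := this
    exact ⟨x / d, by push_cast; rw [hx]⟩
  choose! ρ hρ using hrat
  set Q : ℕ := ∏ i ∈ range (p.natDegree + 1), (ρ i).den with hQ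
  have hQ0 : 0 < Q := prod_pos fun i _ => (ρ i).den_pos
  have hzint : ∀ i, j < i → i ≤ p.natDegree → ∃ z : ℤ, p.coeff i / d * Q = z := by
    intro i hi hin
    obtain ⟨c, hc⟩ : (ρ i).den ∣ Q := dvd_prod_of_mem _ (mem_range.mpr (by omega))
    refine ⟨(ρ i).num * c, ?_⟩
    rw [← hρ i hi, hc]
    have : (ρ i : ℝ) * (ρ i).den = (ρ i).num := by exact_mod_cast Rat.mul_den_eq_num (ρ i)
    push_cast
    rw [← mul_assoc, this]
  choose! z hz using hzint
  set W : ℝ[X] := ∑ i ∈ range (j + 1), monomial i (p.coeff i / d * Q ^ i) with hW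
  have hWdeg : W.natDegree ≤ j := by
    apply natDegree_sum_le_of_forall_le
    intro i hi
    rw [mem_range] at hi
    exact (natDegree_monomial_le _).trans (by omega)
  have hWc : W.coeff j = p.coeff j / d * Q ^ j := by
    rw [hW, finsetSum_coeff, sum_eq_single j]
    · simp
    · intro b _ hb
      rw [coeff_monomial, if_neg hb]
    · intro hcon; simp at hcon
  have hWeval : ∀ m : ℕ, ∃ y : ℤ, p.eval ((Q * m : ℕ) : ℝ) / d = W.eval (m : ℝ) + y := by
    intro m
    refine ⟨∑ i ∈ Ico (j + 1) (p.natDegree + 1), z i * Q ^ (i - 1) * m ^ i, ?_⟩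
    rw [eval_eq_sum_range, ← sum_range_add_sum_Ico _ (by omega : j + 1 ≤ p.natDegree + 1), add_div,
      sum_div, sum_div]
    congr 1
    · rw [hW, eval_finsetSum]
      refine sum_congr rfl fun i _ => ?_
      rw [eval_monomial]
      push_cast
      rw [mul_pow]
      ring
    · push_cast
      refine sum_congr rfl fun i hi => ?_
      rw [Finset.mem_Ico] at hi
      rw [← hz i (by omega) (by omega)]
      obtain ⟨i', rfl⟩ : ∃ i', i = i' + 1 := ⟨i - 1, by omega⟩
      rw [Nat.add_sub_cancel, mul_pow, pow_succ (Q : ℝ)]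
      ring
  set W' := W - C ((r : ℝ) / d) with hW'
  have hW'deg : W'.natDegree ≤ j := by
    rw [hW', natDegree_sub_C]; exact hWdeg
  have hW'c : W'.coeff j = p.coeff j / d * Q ^ j := by
    rw [hW', coeff_sub, hWc, coeff_C, if_neg (by omega), sub_zero]
  have hW'irr : Irrational (W'.coeff j) := by
    rw [hW'c]
    have h1 : Irrational (p.coeff j / d) := hjirr.div_natCast (by omega)
    have h2 := h1.mul_natCast (m := Q ^ j) (by positivity)
    push_cast at h2
    exact h2
  have hphi : ∀ m : ℕ, ∃ φ : ℝ, 0 ≤ φ ∧ φ ≤ 1 / 2 ∧ ∃ y : ℤ, W'.eval (m : ℝ) = φ + y := by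
    intro m
    obtain ⟨y, hy⟩ := hWeval m
    obtain ⟨x, hx⟩ := h (Q * m)
    refine ⟨Int.fract (p.eval ((Q * m : ℕ) : ℝ)) / d, ?_, ?_, x - y, ?_⟩
    · have := Int.fract_nonneg (p.eval ((Q * m : ℕ) : ℝ))
      positivity
    · rw [div_le_iff₀ hdp]
      have := Int.fract_lt_one (p.eval ((Q * m : ℕ) : ℝ))
      linarith
    · have e1 : W.eval (m : ℝ) = p.eval ((Q * m : ℕ) : ℝ) / d - y := by rw [hy]; ring
      have e2 : (⌊p.eval ((Q * m : ℕ) : ℝ)⌋ : ℝ) = r + d * x := by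
        have : ⌊p.eval ((Q * m : ℕ) : ℝ)⌋ = r + d * x := by linarith
        rw [this]; push_cast; ring
      rw [hW', eval_sub, eval_C, e1, Int.fract, e2]
      push_cast
      field_simp
      ring
  obtain ⟨k, hk⟩ : ∃ k, j = k + 1 := ⟨j - 1, by omega⟩
  have hP1 := isP_poly k W' (by omega)
  have hP2 := isP_poly k (C 2 * W') (by
    refine (natDegree_C_mul_le _ _).trans (by omega))
  rw [hk] at hW'irr
  obtain ⟨N1, hN1⟩ := weyl_irr k _ hW'irr _ hP1 6 (by norm_num)
  obtain ⟨N2, hN2⟩ := weyl_irr k _ (by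
    rw [coeff_C_mul]
    have := hW'irr.natCast_mul (m := 2) (by norm_num)
    exact_mod_cast this) _ hP2 6 (by norm_num)
  set N := N1 + N2 + 1 with hN
  have a1 := hN1 N (by omega)
  have a2 := hN2 N (by omega)
  set S1 := ∑ n ∈ range N, ee (W'.eval (n : ℝ)) with hS1
  set S2 := ∑ n ∈ range N, ee ((C 2 * W').eval (n : ℝ)) with hS2
  have key : (N : ℝ) / 4 ≤ S1.im + 1 / 4 * S2.re := by
    rw [hS1, hS2, Complex.im_sum, Complex.re_sum, mul_sum, ← sum_add_distrib]
    have : (N : ℝ) / 4 = ∑ i ∈ range N, (1 / 4 : ℝ) := by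
      rw [sum_const, card_range, nsmul_eq_mul]; ring
    rw [this]
    apply sum_le_sum
    intro m _
    obtain ⟨φ, h1, h2, y, hy⟩ := hphi m
    have e1 : ee (W'.eval (m : ℝ)) = ee φ := by rw [hy, ee_add_int]
    have e2 : ee ((C 2 * W').eval (m : ℝ)) = ee (2 * φ) := by
      rw [eval_mul, eval_C, hy]
      have : (2 : ℝ) * (φ + y) = 2 * φ + ((2 * y : ℤ) : ℝ) := by push_cast; ring
      rw [this, ee_add_int]
    rw [e1, e2, ee_im, ee_re]
    have e3 : 2 * Real.pi * (2 * φ) = 2 * (2 * Real.pi * φ) := by ring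
    have hpi := Real.pi_pos
    have hs0 : 0 ≤ Real.sin (2 * Real.pi * φ) := by
      apply Real.sin_nonneg_of_nonneg_of_le_pi (by positivity)
      nlinarith
    have hs1 := Real.sin_le_one (2 * Real.pi * φ)
    rw [e3, Real.cos_two_mul, Real.cos_sq']
    nlinarith
  have b1 := Complex.abs_im_le_norm S1
  have b2 := Complex.re_le_norm S2
  have b3 := le_abs_self S1.im
  have hNr : (0 : ℝ) < N := by rw [hN]; positivity
  push_cast at a1 a2
  linarith


lemma card_le_cnt (s : Finset ℕ) (A : Set ℕ) (n : ℕ) (h : ∀ x ∈ s, x ∈ A ∧ x ≤ n) :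
    #s ≤ cnt A n + 1 := by
  classical
  have h1 : s ⊆ insert 0 (((range n).filter (fun i => i + 1 ∈ A)).image (fun i => i + 1)) := by
    intro x hx
    obtain ⟨ha, hn⟩ := h x hx
    rcases x with _ | y
    · simp
    · apply mem_insert_of_mem
      exact mem_image.2 ⟨y, mem_filter.2 ⟨mem_range.2 (by omega), ha⟩, rfl⟩
  have h2 := card_le_card h1
  have h3 := card_insert_le 0 (((range n).filter (fun i => i + 1 ∈ A)).image (fun i => i + 1))
  have h4 := card_image_le (s := (range n).filter (fun i => i + 1 ∈ A)) (f := fun i => i + 1)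
  have h5 : #((range n).filter (fun i => i + 1 ∈ A)) = cnt A n := by
    unfold cnt
    rw [card_filter]
  omega

lemma cnt_mono_right (A : Set ℕ) (n m : ℕ) (h : n ≤ m) : cnt A n ≤ cnt A m := by
  obtain ⟨c, rfl⟩ := Nat.exists_eq_add_of_le h
  rw [cnt_add]; omega

lemma dens_all (D : Set ℕ) (h1 : 1 ∈ D) (k K : ℕ) (hK : 1 ≤ K) (C : ℝ) (hC : 0 < C)
    (h : ∀ X : ℕ, 1 ≤ X → (X : ℝ) ^ (k + 1) ≤ C * (cnt D (K * X ^ (k + 1)) + 1)) :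
    ∃ α : ℝ, 0 < α ∧ ∀ n : ℕ, α * n ≤ cnt D n := by
  have hKr : (1:ℝ) ≤ K := by exact_mod_cast hK
  set M : ℝ := K * 2 ^ (k + 1) * (2 * C + 1) with hM
  have h2 : (1:ℝ) ≤ 2 ^ (k + 1) := one_le_pow₀ (by norm_num)
  have hMpos : 0 < M := by positivity
  refine ⟨1 / M, by positivity, fun n => ?_⟩
  rw [div_mul_eq_mul_div, one_mul, div_le_iff₀ hMpos]
  rcases Nat.eq_zero_or_pos n with rfl | hn
  · simp; positivity
  have hc1 : 1 ≤ cnt D n := by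
    have := cnt_mono_right D 1 n hn
    have e : cnt D 1 = 1 := by
      rw [show (1:ℕ) = 0 + 1 from rfl, cnt_succ, if_pos h1]; simp [cnt]
    omega
  have hc1r : (1:ℝ) ≤ cnt D n := by exact_mod_cast hc1
  set X := Nat.findGreatest (fun X => K * X ^ (k + 1) ≤ n) n with hX
  have hXs : K * X ^ (k + 1) ≤ n := by
    have := @Nat.findGreatest_spec 0 (fun X => K * X ^ (k + 1) ≤ n) _ n (Nat.zero_le _) (by simp)
    exact this
  have hXg : n < K * (X + 1) ^ (k + 1) := by
    by_contra hcon
    push Not at hcon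
    have hle : X + 1 ≤ n := by
      calc X + 1 ≤ (X + 1) ^ (k + 1) := Nat.le_self_pow (by omega) _
        _ ≤ K * (X + 1) ^ (k + 1) := Nat.le_mul_of_pos_left _ hK
        _ ≤ n := hcon
    have := @Nat.le_findGreatest (X + 1) (fun X => K * X ^ (k + 1) ≤ n) _ n hle hcon
    omega
  have hXgr : (n:ℝ) ≤ K * ((X:ℝ) + 1) ^ (k + 1) := by exact_mod_cast hXg.le
  rcases Nat.eq_zero_or_pos X with h0 | hpos
  · rw [h0] at hXgr
    have hXgr : (n:ℝ) ≤ K := by simpa using hXgr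
    have : (K:ℝ) ≤ M := by
      rw [hM]
      have : (1:ℝ) ≤ 2 ^ (k + 1) * (2 * C + 1) := by nlinarith
      nlinarith
    nlinarith
  · have hXr : (1:ℝ) ≤ X := by exact_mod_cast hpos
    have e1 : ((X:ℝ) + 1) ^ (k + 1) ≤ 2 ^ (k + 1) * (X:ℝ) ^ (k + 1) := by
      rw [← mul_pow]
      exact pow_le_pow_left₀ (by positivity) (by linarith) _
    have e2 := h X hpos
    have e3 : (cnt D (K * X ^ (k + 1)) : ℝ) ≤ cnt D n := by
      exact_mod_cast cnt_mono_right D _ _ hXs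
    have e4 : (X:ℝ) ^ (k + 1) ≤ (2 * C + 1) * cnt D n := by nlinarith
    calc (n:ℝ) ≤ K * ((X:ℝ) + 1) ^ (k + 1) := hXgr
      _ ≤ K * (2 ^ (k + 1) * ((2 * C + 1) * cnt D n)) := by gcongr; exact e1.trans (by gcongr)
      _ = cnt D n * M := by rw [hM]; ring

lemma poly_growth (p : ℝ[X]) (k : ℕ) (hk : p.natDegree = k + 1) :
    ∃ B : ℝ, 0 ≤ B ∧ ∀ n X : ℕ, n < X → p.eval (n : ℝ) ≤ B * (X : ℝ) ^ (k + 1) := by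
  refine ⟨∑ i ∈ range (p.natDegree + 1), |p.coeff i|, sum_nonneg fun _ _ => abs_nonneg _, ?_⟩
  intro n X h
  rw [eval_eq_sum_range, sum_mul]
  apply sum_le_sum
  intro i hi
  rw [mem_range] at hi
  have hX : (1:ℝ) ≤ X := by exact_mod_cast (by omega : 1 ≤ X)
  have hn : (n:ℝ) ≤ X := by exact_mod_cast h.le
  have e1 : (n:ℝ) ^ i ≤ (X:ℝ) ^ (k + 1) :=
    (pow_le_pow_left₀ (by positivity) hn i).trans (pow_le_pow_right₀ hX (by omega))
  calc p.coeff i * (n:ℝ) ^ i ≤ |p.coeff i| * (n:ℝ) ^ i := by gcongr; exact le_abs_self _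
    _ ≤ _ := by gcongr

section fin
open scoped Pointwise

lemma main_basis (p : ℝ[X]) (hdeg : 1 ≤ p.natDegree) (hlead : 0 < p.leadingCoeff)
    (hirr : ∃ i : ℕ, 1 ≤ i ∧ Irrational (p.coeff i)) :
    ∃ (a0 : ℤ) (g : ℕ → ℕ), (∀ n : ℕ, ⌊p.eval (n : ℝ)⌋ = a0 + g n) ∧
      ∃ s N₀ : ℕ, ∀ N ≥ N₀, ∃ t : Fin s → ℕ, ∑ i, g (t i) = N := by
  obtain ⟨k, hk⟩ : ∃ k, p.natDegree = k + 1 := ⟨p.natDegree - 1, by omega⟩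
  have hlim : Filter.Tendsto (fun n : ℕ => ⌊p.eval (n : ℝ)⌋) Filter.atTop Filter.atTop := by
    have h1 := p.tendsto_atTop_of_leadingCoeff_nonneg (natDegree_pos_iff_degree_pos.1 hdeg) hlead.le
    exact tendsto_floor_atTop.comp (h1.comp tendsto_natCast_atTop_atTop)
  obtain ⟨a0, ⟨n0, hn0⟩, hmin⟩ : ∃ a0 : ℤ, (∃ n : ℕ, ⌊p.eval (n : ℝ)⌋ = a0) ∧
      ∀ z : ℤ, (∃ n : ℕ, ⌊p.eval (n : ℝ)⌋ = z) → a0 ≤ z := by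
    apply Int.exists_least_of_bdd
    · obtain ⟨b, hb⟩ := hlim.isBoundedUnder_ge_atTop.bddBelow_range
      refine ⟨b, ?_⟩
      rintro z ⟨n, rfl⟩
      exact hb ⟨n, rfl⟩
    · exact ⟨_, 0, rfl⟩
  set g : ℕ → ℕ := fun n => (⌊p.eval (n : ℝ)⌋ - a0).toNat with hg
  have hga : ∀ n : ℕ, ⌊p.eval (n : ℝ)⌋ = a0 + g n := by
    intro n
    have := hmin _ ⟨n, rfl⟩
    simp only [hg]
    omega
  refine ⟨a0, g, hga, ?_⟩
  obtain ⟨u, hu, hdens⟩ := density k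
  obtain ⟨C, hC, hd⟩ := hdens p.leadingCoeff (fun n => p.eval (n : ℝ)) hlead (by
    intro β
    have := isP_poly k (C β * p) ((natDegree_C_mul_le _ _).trans hk.le)
    simpa [coeff_C_mul, eval_mul, eval_C, leadingCoeff, hk] using this)
  obtain ⟨B, hB, hgrow⟩ := poly_growth p k hk
  obtain ⟨K, hK⟩ := exists_nat_ge (B + |(a0:ℝ)| + 1)
  have hK1 : 1 ≤ K := by
    have : (1:ℝ) ≤ K := by have := abs_nonneg (a0:ℝ); linarith
    exact_mod_cast this
  have hgK : ∀ n X : ℕ, n < X → g n ≤ K * X ^ (k + 1) := by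
    intro n X h
    have h1 := hgrow n X h
    have h2 : (a0:ℝ) + g n ≤ p.eval (n:ℝ) := by
      have := Int.floor_le (p.eval (n:ℝ))
      rw [hga n] at this
      exact_mod_cast this
    have hX : (1:ℝ) ≤ (X:ℝ) ^ (k + 1) := one_le_pow₀ (by exact_mod_cast (by omega : 1 ≤ X))
    have h3 := neg_abs_le (a0:ℝ)
    have h4 := abs_nonneg (a0:ℝ)
    have : (g n : ℝ) ≤ K * (X:ℝ) ^ (k + 1) := by nlinarith
    exact_mod_cast this
  obtain ⟨α, hα, hαn⟩ := dens_all (u • Set.range g ∪ {1}) (by simp) k (u * K)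
    (Nat.mul_pos hu hK1) C hC (by
      intro X hX
      refine (hd X hX).trans ?_
      gcongr
      have hcard : #((univ : Finset (Fin u → Fin X)).image (fun t => ∑ i, ⌊p.eval (((t i : Fin X) : ℕ) : ℝ)⌋))
          ≤ #((univ : Finset (Fin u → Fin X)).image (fun t => ∑ i, g (t i))) := by
        have : (univ : Finset (Fin u → Fin X)).image (fun t => ∑ i, ⌊p.eval (((t i : Fin X) : ℕ) : ℝ)⌋)
          = ((univ : Finset (Fin u → Fin X)).image (fun t => ∑ i, g (t i))).image
            (fun m : ℕ => (u:ℤ) * a0 + m) := by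
          rw [image_image]
          apply image_congr
          intro t _
          simp [hga, sum_add_distrib]
        rw [this]
        exact card_image_le
      have h2 := card_le_cnt ((univ : Finset (Fin u → Fin X)).image (fun t => ∑ i, g (t i)))
        (u • Set.range g ∪ {1}) (u * K * X ^ (k + 1)) (by
          intro x hx
          obtain ⟨t, -, rfl⟩ := mem_image.1 hx
          refine ⟨Or.inl ((mem_ns g u _).2 ⟨fun i => t i, rfl⟩), ?_⟩
          calc ∑ i, g (t i) ≤ ∑ i : Fin u, K * X ^ (k + 1) :=
                sum_le_sum fun i _ => hgK _ _ (t i).2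
            _ = u * K * X ^ (k + 1) := by simp [mul_assoc])
      exact_mod_cast hcard.trans h2)
  refine basis_of_density g ⟨n0, by simp [hg, hn0]⟩ ?_ u α hα hαn
  intro d hd2 hdiv
  apply irr_not_congr p hirr d hd2 a0
  intro n
  rw [hga n, add_sub_cancel_left]
  exact_mod_cast hdiv n
end fin


/-- If `p` is a real polynomial of degree at least `1` with positive leading
coefficient and with an irrational coefficient of a non-constant term, then
`(⌊p(n)⌋)_{n ∈ ℕ}` is an asymptotic basis. -/
theorem stmt_12 (p : Polynomial ℝ) (hdeg : 1 ≤ p.natDegree)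
    (hlead : 0 < p.leadingCoeff) (hirr : ∃ i : ℕ, 1 ≤ i ∧ Irrational (p.coeff i)) :
    ∃ s : ℕ, ∃ N₀ : ℤ, ∀ N : ℤ, N₀ ≤ N →
      ∃ n : Fin s → ℕ, ∑ i, ⌊p.eval ((n i : ℝ))⌋ = N := by
  obtain ⟨a0, g, hga, s, N₀, h⟩ := main_basis p hdeg hlead hirr
  refine ⟨s, s * a0 + N₀, fun N hN => ?_⟩
  obtain ⟨t, ht⟩ := h (N - s * a0).toNat (by omega)
  refine ⟨t, ?_⟩
  have h2 : (∑ i, (g (t i) : ℤ)) = N - s * a0 := by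
    rw [← Nat.cast_sum, ht]; omega
  simp only [hga, sum_add_distrib, h2]
  simp
end

section
/- The sequence (⌊n² / log n⌋)_{n ≥ 2} is an asymptotic basis: there exist s ∈ ℕ and N_0 such that every integer N ≥ N_0 can be written as a sum of s terms of the form ⌊n_i² / log n_i⌋ with integers n_i ≥ 2. -/
open Finset

namespace NLog

/-- `N` is a sum of exactly `s` terms of the sequence. -/
def Rep (s : ℕ) (N : ℤ) : Prop :=
  ∃ n : Fin s → ℕ, (∀ i, 2 ≤ n i) ∧ ∑ i, ⌊((n i : ℝ) ^ 2 / Real.log (n i))⌋ = N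

lemma Rep.add {s t : ℕ} {M N : ℤ} (h1 : Rep s M) (h2 : Rep t N) : Rep (s + t) (M + N) := by
  obtain ⟨a, ha, hM⟩ := h1
  obtain ⟨b, hb, hN⟩ := h2
  refine ⟨Fin.append a b, ?_, ?_⟩
  · intro i
    refine Fin.addCases (fun j => ?_) (fun j => ?_) i
    · simpa using ha j
    · simpa using hb j
  · rw [Fin.sum_univ_add]
    simp only [Fin.append_left, Fin.append_right]
    rw [hM, hN]

lemma rep_one (m : ℕ) (hm : 2 ≤ m) : Rep 1 ⌊((m : ℝ) ^ 2 / Real.log m)⌋ :=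
  ⟨fun _ => m, fun _ => hm, by simp⟩

lemma rep5 : Rep 1 5 := by
  have h := rep_one 2 le_rfl
  have e : ⌊(((2 : ℕ) : ℝ) ^ 2 / Real.log (2 : ℕ))⌋ = 5 := by
    have h1 := Real.log_two_gt_d9
    have h2 := Real.log_two_lt_d9
    rw [Int.floor_eq_iff]
    push_cast
    rw [le_div_iff₀ (by linarith), div_lt_iff₀ (by linarith)]
    constructor <;> linarith
  rwa [e] at h

lemma rep11 : Rep 1 11 := by
  have h := rep_one 4 (by norm_num)
  have e : ⌊(((4 : ℕ) : ℝ) ^ 2 / Real.log (4 : ℕ))⌋ = 11 := by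
    have h1 := Real.log_two_gt_d9
    have h2 := Real.log_two_lt_d9
    have h3 : Real.log (4 : ℕ) = 2 * Real.log 2 := by
      rw [show ((4 : ℕ) : ℝ) = 2 ^ 2 by norm_num, Real.log_pow]; norm_num
    rw [Int.floor_eq_iff, h3]
    push_cast
    rw [le_div_iff₀ (by linarith), div_lt_iff₀ (by linarith)]
    constructor <;> linarith
  rwa [e] at h

lemma rep30 : Rep 1 30 := by
  have h := rep_one 8 (by norm_num)
  have e : ⌊(((8 : ℕ) : ℝ) ^ 2 / Real.log (8 : ℕ))⌋ = 30 := by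
    have h1 := Real.log_two_gt_d9
    have h2 := Real.log_two_lt_d9
    have h3 : Real.log (8 : ℕ) = 3 * Real.log 2 := by
      rw [show ((8 : ℕ) : ℝ) = 2 ^ 3 by norm_num, Real.log_pow]; norm_num
    rw [Int.floor_eq_iff, h3]
    push_cast
    rw [le_div_iff₀ (by linarith), div_lt_iff₀ (by linarith)]
    constructor <;> linarith
  rwa [e] at h

lemma rep49 : Rep 5 49 := (((rep11.add rep11).add rep11).add rep11).add rep5

lemma rep50 : Rep 5 50 := (((rep30.add rep5).add rep5).add rep5).add rep5

lemma rep_zero : Rep 0 0 := ⟨fun _ => 2, fun _ => le_rfl, by simp⟩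

lemma rep_interval (C : ℕ) : ∀ j : ℕ, j ≤ C → Rep (5 * C) (49 * C + j) := by
  induction C with
  | zero =>
    intro j hj
    obtain rfl : j = 0 := by omega
    simpa using rep_zero
  | succ C ih =>
    intro j hj
    by_cases h : j ≤ C
    · have := (ih j h).add rep49
      convert this using 1 <;> (push_cast; ring)
    · obtain rfl : j = C + 1 := by omega
      have := (ih C le_rfl).add rep50
      convert this using 1 <;> (push_cast; ring)

noncomputable def f (y : ℝ) : ℝ := y ^ 2 / Real.log y
noncomputable def w (y : ℝ) : ℝ := (Real.log y)⁻¹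
noncomputable def f1 (y : ℝ) : ℝ := 2 * y * w y - y * w y ^ 2
noncomputable def f2 (y : ℝ) : ℝ := 2 * w y - 3 * w y ^ 2 + 2 * w y ^ 3
noncomputable def f3 (y : ℝ) : ℝ := y⁻¹ * (-2 * w y ^ 2 + 6 * w y ^ 3 - 6 * w y ^ 4)
noncomputable def f4 (y : ℝ) : ℝ :=
  (y⁻¹) ^ 2 * (2 * w y ^ 2 - 2 * w y ^ 3 - 12 * w y ^ 4 + 24 * w y ^ 5)

lemma hw {y : ℝ} (hy : 3 ≤ y) : HasDerivAt w (-(w y) ^ 2 * y⁻¹) y := by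
  have hl : 0 < Real.log y := Real.log_pos (by linarith)
  have := (Real.hasDerivAt_log (by linarith : y ≠ 0)).inv hl.ne'
  refine this.congr_deriv ?_
  unfold w
  field_simp

lemma hf {y : ℝ} (hy : 3 ≤ y) : HasDerivAt f (f1 y) y := by
  have h := ((hasDerivAt_id y).pow 2).mul (hw hy)
  have e : f = (id ^ 2 * w : ℝ → ℝ) := by
    funext z; simp [f, w, div_eq_mul_inv]
  rw [e]
  refine h.congr_deriv ?_
  have : y ≠ 0 := by linarith
  simp [f1]
  field_simp
  ring

lemma hf1 {y : ℝ} (hy : 3 ≤ y) : HasDerivAt f1 (f2 y) y := by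
  have h := (((hasDerivAt_id y).const_mul 2).mul (hw hy)).sub
    ((hasDerivAt_id y).mul ((hw hy).pow 2))
  have e : f1 = ((fun y => 2 * id y) * w - id * w ^ 2 : ℝ → ℝ) := by
    funext z; simp [f1]
  rw [e]
  refine h.congr_deriv ?_
  have : y ≠ 0 := by linarith
  simp [f2]
  field_simp
  ring

lemma hf2 {y : ℝ} (hy : 3 ≤ y) : HasDerivAt f2 (f3 y) y := by
  have h := (((hw hy).const_mul 2).sub (((hw hy).pow 2).const_mul 3)).add
    (((hw hy).pow 3).const_mul 2)
  refine h.congr_deriv ?_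
  have : y ≠ 0 := by linarith
  simp [f3]
  field_simp
  ring

lemma hf3 {y : ℝ} (hy : 3 ≤ y) : HasDerivAt f3 (f4 y) y := by
  have h0 : y ≠ 0 := by linarith
  have h := (hasDerivAt_inv h0).mul (((((hw hy).pow 2).const_mul (-2)).add
    (((hw hy).pow 3).const_mul 6)).sub (((hw hy).pow 4).const_mul 6))
  refine h.congr_deriv ?_
  simp [f4]
  field_simp
  ring

lemma w_bd {y : ℝ} (hy : 3 ≤ y) : 0 < w y ∧ w y ≤ 1 := by
  have hl : 1 ≤ Real.log y := by
    rw [Real.le_log_iff_exp_le (by linarith)]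
    linarith [Real.exp_one_lt_three]
  exact ⟨inv_pos.2 (by linarith), inv_le_one_of_one_le₀ hl⟩

lemma w_bd2 {y : ℝ} (hy : 9 ≤ y) : 0 < w y ∧ w y ≤ 1 / 2 := by
  have hl : 2 ≤ Real.log y := by
    rw [Real.le_log_iff_exp_le (by linarith)]
    have : Real.exp 2 = Real.exp 1 ^ 2 := by rw [← Real.exp_nat_mul]; norm_num
    rw [this]
    nlinarith [Real.exp_one_lt_three, Real.exp_pos 1]
  refine ⟨inv_pos.2 (by linarith), ?_⟩
  unfold w
  rw [one_div]
  exact inv_anti₀ (by norm_num) hl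

lemma f4_bd {y : ℝ} (hy : 3 ≤ y) : |f4 y| ≤ 60 * (y⁻¹) ^ 2 := by
  obtain ⟨h0, h1⟩ := w_bd hy
  unfold f4
  rw [abs_mul, abs_of_nonneg (by positivity : 0 ≤ (y⁻¹) ^ 2), mul_comm]
  refine mul_le_mul_of_nonneg_right ?_ (by positivity)
  have p2 : w y ^ 2 ≤ 1 := pow_le_one₀ h0.le h1
  have p3 : w y ^ 3 ≤ 1 := pow_le_one₀ h0.le h1
  have p4 : w y ^ 4 ≤ 1 := pow_le_one₀ h0.le h1
  have p5 : w y ^ 5 ≤ 1 := pow_le_one₀ h0.le h1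
  have q2 : 0 < w y ^ 2 := by positivity
  have q3 : 0 < w y ^ 3 := by positivity
  have q4 : 0 < w y ^ 4 := by positivity
  have q5 : 0 < w y ^ 5 := by positivity
  rw [abs_le]
  constructor <;> linarith

/-- Crude integration of a power bound. -/
lemma step {g g' : ℝ → ℝ} {X C : ℝ} (k : ℕ) (hC : 0 ≤ C) (h0 : g 0 = 0)
    (hd : ∀ t, 0 ≤ t → t ≤ X → HasDerivAt g (g' t) t)
    (hb : ∀ t, 0 ≤ t → t ≤ X → |g' t| ≤ C * t ^ k) :
    ∀ t, 0 ≤ t → t ≤ X → |g t| ≤ C * t ^ (k + 1) := by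
  intro t ht htX
  have := norm_image_sub_le_of_norm_deriv_le_segment' (f := g) (f' := g') (a := 0) (b := t)
    (C := C * t ^ k)
    (fun x hx => (hd x hx.1 (hx.2.trans htX)).hasDerivWithinAt)
    (fun x hx => by
      rw [Real.norm_eq_abs]
      refine (hb x hx.1 (hx.2.le.trans htX)).trans ?_
      exact mul_le_mul_of_nonneg_left (pow_le_pow_left₀ hx.1 hx.2.le k) hC)
    t ⟨ht, le_rfl⟩
  rw [h0, sub_zero, sub_zero, Real.norm_eq_abs] at this
  rw [pow_succ, ← mul_assoc]
  exact this

lemma taylor {n : ℝ} (hn : 6 ≤ n) {x : ℝ} (hx : 0 ≤ x) (hxn : x ≤ n / 2) :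
    |f (n + x) + f (n - x) - 2 * f n - f2 n * x ^ 2| ≤ 480 * (n⁻¹) ^ 2 * x ^ 4 := by
  have hp : ∀ t : ℝ, HasDerivAt (fun t => n + t) 1 t := fun t => (hasDerivAt_id t).const_add n
  have hm : ∀ t : ℝ, HasDerivAt (fun t => n - t) (-1) t := fun t => (hasDerivAt_id t).const_sub n
  have hC : 0 ≤ 480 * (n⁻¹) ^ 2 := by positivity
  have b4 : ∀ t, 0 ≤ t → t ≤ n / 2 → |f4 (n + t) + f4 (n - t)| ≤ 480 * (n⁻¹) ^ 2 * t ^ 0 := by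
    intro t ht htn
    have key : ∀ y, n / 2 ≤ y → |f4 y| ≤ 240 * (n⁻¹) ^ 2 := by
      intro y hy
      refine (f4_bd (by linarith)).trans ?_
      have h1 : y⁻¹ ≤ 2 * n⁻¹ := by
        have := inv_anti₀ (by linarith : 0 < n / 2) hy
        rwa [inv_div, div_eq_mul_inv] at this
      have h2 : 0 ≤ y⁻¹ := inv_nonneg.2 (by linarith)
      nlinarith [pow_le_pow_left₀ h2 h1 2]
    refine (abs_add_le _ _).trans ?_
    have := key (n + t) (by linarith)
    have := key (n - t) (by linarith)
    rw [pow_zero]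
    linarith
  have b3 := step (g := fun t => f3 (n + t) - f3 (n - t)) (X := n / 2) 0 hC (by simp)
    (fun t ht htn => by
      have h1 := (hf3 (y := n + t) (by linarith)).comp t (hp t)
      have h2 := (hf3 (y := n - t) (by linarith)).comp t (hm t)
      have := h1.sub h2
      refine this.congr_deriv ?_
      ring) b4
  have b2 := step (g := fun t => f2 (n + t) + f2 (n - t) - 2 * f2 n) (X := n / 2) 1 hC
    (by simp; ring)
    (fun t ht htn => by
      have h1 := (hf2 (y := n + t) (by linarith)).comp t (hp t)
      have h2 := (hf2 (y := n - t) (by linarith)).comp t (hm t)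
      have := (h1.add h2).sub_const (2 * f2 n)
      refine this.congr_deriv ?_
      ring) b3
  have b1 := step (g := fun t => f1 (n + t) - f1 (n - t) - 2 * f2 n * t) (X := n / 2) 2 hC
    (by simp)
    (fun t ht htn => by
      have h1 := (hf1 (y := n + t) (by linarith)).comp t (hp t)
      have h2 := (hf1 (y := n - t) (by linarith)).comp t (hm t)
      have := (h1.sub h2).sub ((hasDerivAt_id t).const_mul (2 * f2 n))
      refine this.congr_deriv ?_
      ring) b2
  have b0 := step (g := fun t => f (n + t) + f (n - t) - 2 * f n - f2 n * t ^ 2) (X := n / 2) 3 hC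
    (by simp; ring)
    (fun t ht htn => by
      have h1 := (hf (y := n + t) (by linarith)).comp t (hp t)
      have h2 := (hf (y := n - t) (by linarith)).comp t (hm t)
      have := ((h1.add h2).sub_const (2 * f n)).sub (((hasDerivAt_id t).pow 2).const_mul (f2 n))
      refine this.congr_deriv ?_
      simp
      ring) b1
  exact b0 x hx hxn

lemma diff {n : ℝ} (hn : 9 ≤ n) : f (n + 1) - f n ≤ 2 * (n + 1) * w n := by
  have := norm_image_sub_le_of_norm_deriv_le_segment' (f := f) (f' := f1) (a := n) (b := n + 1)
    (C := 2 * (n + 1) * w n)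
    (fun x hx => (hf (by linarith [hx.1])).hasDerivWithinAt)
    (fun x hx => by
      obtain ⟨h0, h1⟩ := w_bd (y := x) (by linarith [hx.1])
      have hl : 0 < Real.log n := Real.log_pos (by linarith)
      have hwn : w x ≤ w n := inv_anti₀ hl (Real.log_le_log (by linarith) hx.1)
      have hx0 : 0 < x := by linarith [hx.1]
      have hxw : 0 < x * w x := by positivity
      have e : f1 x = x * w x * (2 - w x) := by unfold f1; ring
      rw [Real.norm_eq_abs, e, abs_of_nonneg (mul_nonneg hxw.le (by linarith))]
      have h3 : x * w x ≤ (n + 1) * w n :=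
        mul_le_mul hx.2.le hwn h0.le (by linarith)
      nlinarith)
    (n + 1) ⟨by linarith, le_rfl⟩
  rw [add_sub_cancel_left, mul_one] at this
  exact (le_abs_self _).trans this

lemma f_ge {n : ℝ} (hn : 3 ≤ n) : n ≤ f n := by
  have hl : 0 < Real.log n := Real.log_pos (by linarith)
  unfold f
  rw [le_div_iff₀ hl]
  have := Real.log_le_sub_one_of_pos (by linarith : 0 < n)
  nlinarith

lemma choose_n (N : ℤ) (hN : ⌈8 * f 256⌉ ≤ N) :
    ∃ n : ℕ, 256 ≤ n ∧ 8 * f n ≤ N ∧ (N : ℝ) < 8 * f (n + 1) := by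
  have hex : ∃ k : ℕ, (N : ℝ) < 8 * f ((256 + k : ℕ) : ℝ) := by
    refine ⟨N.toNat + 1, ?_⟩
    have h1 := f_ge (n := ((256 + (N.toNat + 1) : ℕ) : ℝ)) (by push_cast; linarith [(Nat.cast_nonneg N.toNat : (0:ℝ) ≤ _)])
    have h2 : (N : ℝ) ≤ (N.toNat : ℝ) := by exact_mod_cast Int.self_le_toNat N
    have h3 : (0 : ℝ) ≤ (N.toNat : ℝ) := Nat.cast_nonneg _
    push_cast at h1 ⊢
    linarith
  classical
  have hs := Nat.find_spec hex
  have hm := fun m => Nat.find_min (m := m) hex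
  rcases hk : Nat.find hex with _ | j
  · rw [hk] at hs
    have := Int.ceil_le.1 hN
    norm_num at hs
    linarith
  · rw [hk] at hs
    refine ⟨256 + j, by omega, ?_, ?_⟩
    · exact not_lt.1 (hm j (by omega))
    · convert hs using 3
      push_cast; ring

lemma main (N : ℤ) (hN : ⌈8 * f 256⌉ ≤ N) :
    ∃ b : ℤ, Rep 8 b ∧ N - 7864340 ≤ b ∧ b ≤ N + 7864340 := by
  obtain ⟨n, hn, h1, h2⟩ := choose_n N hN
  have hnR : (256 : ℝ) ≤ n := by exact_mod_cast hn
  obtain ⟨w0, w1⟩ := w_bd2 (y := n) (by linarith)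
  have hd := diff (n := n) (by linarith)
  have e2 : f2 n = w n * (2 - 3 * w n + 2 * w n ^ 2) := by unfold f2; ring
  have lo : w n / 2 ≤ f2 n := by rw [e2]; nlinarith [sq_nonneg (w n)]
  have hi : f2 n ≤ 1 := by
    rw [e2]; nlinarith [mul_nonneg w0.le (sub_nonneg.2 w1)]
  have hpos : 0 < f2 n := by linarith
  have hq : 0 ≤ ((N : ℝ) - 8 * f n) / f2 n := div_nonneg (by linarith) hpos.le
  obtain ⟨a, b, c, d, hM⟩ := Nat.sum_four_squares ⌊((N : ℝ) - 8 * f n) / f2 n⌋₊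
  have m1 := Nat.floor_le hq
  have m2 := Nat.lt_floor_add_one (((N : ℝ) - 8 * f n) / f2 n)
  rw [← hM] at m1 m2
  rw [le_div_iff₀ hpos] at m1
  rw [div_lt_iff₀ hpos] at m2
  push_cast at m1 m2
  have hMn : ((a:ℝ) ^ 2 + b ^ 2 + c ^ 2 + d ^ 2) ≤ 64 * n := by
    by_contra hcon
    push Not at hcon
    have : 64 * n * (w n / 2) < ((a:ℝ) ^ 2 + b ^ 2 + c ^ 2 + d ^ 2) * f2 n :=
      mul_lt_mul' hcon.le (lt_of_le_of_ne lo (by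
        intro h
        rw [e2] at h
        have : w n * (3 / 2 - 3 * w n + 2 * w n ^ 2) = 0 := by linarith
        rcases mul_eq_zero.1 this with h | h
        · linarith
        · nlinarith)) (by positivity) (by linarith)
    nlinarith
  have key : ∀ x : ℕ, (x : ℝ) ^ 2 ≤ 64 * n → ∃ p q : ℕ, 2 ≤ p ∧ 2 ≤ q ∧
      |f p + f q - 2 * f n - f2 n * (x : ℝ) ^ 2| ≤ 1966080 := by
    intro x hx
    have hxn : (x : ℝ) ≤ n / 2 := by
      refine abs_le_of_sq_le_sq' (by nlinarith) (by positivity) |>.2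
    have hx' : 2 * x ≤ n := by
      have : (2 * x : ℝ) ≤ n := by linarith
      exact_mod_cast this
    refine ⟨n + x, n - x, by omega, by omega, ?_⟩
    have ht := taylor (n := n) (by linarith) (Nat.cast_nonneg x) hxn
    rw [Nat.cast_sub (by omega)]
    push_cast
    refine ht.trans ?_
    have hn0 : (n : ℝ) ≠ 0 := by linarith
    have h4 : (x : ℝ) ^ 4 ≤ (64 * n) ^ 2 := by
      have := pow_le_pow_left₀ (by positivity) hx 2
      calc (x : ℝ) ^ 4 = ((x : ℝ) ^ 2) ^ 2 := by ring
        _ ≤ _ := this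
    calc 480 * ((n : ℝ)⁻¹) ^ 2 * (x : ℝ) ^ 4 ≤ 480 * ((n : ℝ)⁻¹) ^ 2 * (64 * n) ^ 2 :=
          mul_le_mul_of_nonneg_left h4 (by positivity)
      _ = 1966080 := by field_simp; norm_num
  have sa := sq_nonneg (a : ℝ)
  have sb := sq_nonneg (b : ℝ)
  have sc := sq_nonneg (c : ℝ)
  have sd := sq_nonneg (d : ℝ)
  obtain ⟨a1, a2, ha1, ha2, ha⟩ := key a (by linarith)
  obtain ⟨b1, b2, hb1, hb2, hb⟩ := key b (by linarith)
  obtain ⟨c1, c2, hc1, hc2, hc⟩ := key c (by linarith)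
  obtain ⟨d1, d2, hd1, hd2, hd'⟩ := key d (by linarith)
  have R := (((((((rep_one a1 ha1).add (rep_one a2 ha2)).add (rep_one b1 hb1)).add
    (rep_one b2 hb2)).add (rep_one c1 hc1)).add (rep_one c2 hc2)).add
    (rep_one d1 hd1)).add (rep_one d2 hd2)
  refine ⟨_, R, ?_⟩
  have fl : ∀ m : ℕ, (⌊((m : ℝ) ^ 2 / Real.log m)⌋ : ℝ) ≤ f m ∧
      f m < (⌊((m : ℝ) ^ 2 / Real.log m)⌋ : ℝ) + 1 := fun m =>
    ⟨Int.floor_le _, Int.lt_floor_add_one _⟩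
  have u1 := fl a1
  have u2 := fl a2
  have u3 := fl b1
  have u4 := fl b2
  have u5 := fl c1
  have u6 := fl c2
  have u7 := fl d1
  have u8 := fl d2
  rw [abs_le] at ha hb hc hd'
  constructor
  · rw [← @Int.cast_le ℝ]
    push_cast
    linarith [ha.1, hb.1, hc.1, hd'.1, u1.2, u2.2, u3.2, u4.2, u5.2, u6.2, u7.2, u8.2]
  · rw [← @Int.cast_le ℝ]
    push_cast
    linarith [ha.2, hb.2, hc.2, hd'.2, u1.1, u2.1, u3.1, u4.1, u5.1, u6.1, u7.1, u8.1]

lemma final : ∃ s : ℕ, ∃ N₀ : ℤ, ∀ N : ℤ, N₀ ≤ N → Rep s N := by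
  obtain ⟨D, hD⟩ : ∃ D : ℕ, (D : ℤ) = 7864340 := ⟨7864340, rfl⟩
  refine ⟨8 + 5 * (2 * D), ⌈8 * f 256⌉ + 49 * (2 * D) + D, fun N hN => ?_⟩
  obtain ⟨b, hb, h1, h2⟩ := main (N - 49 * (2 * D) - D) (by linarith)
  rw [← hD] at h1 h2
  have := hb.add (rep_interval (2 * D) (N - 49 * (2 * D) - b).toNat (by omega))
  convert this using 1
  rw [Int.toNat_of_nonneg (by omega)]
  push_cast
  ring

end NLog

/-- The sequence `(⌊n² / log n⌋)_{n ≥ 2}` is an asymptotic basis. -/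
theorem stmt_13 :
    ∃ s : ℕ, ∃ N₀ : ℤ, ∀ N : ℤ, N₀ ≤ N →
      ∃ n : Fin s → ℕ, (∀ i, 2 ≤ n i) ∧
        ∑ i, ⌊((n i : ℝ) ^ 2 / Real.log (n i))⌋ = N := by
  exact NLog.final
end

section
/- The sequence (⌊π n³ + n^{√2} / log log n⌋)_{n ≥ 3} is an asymptotic basis: there exist s ∈ ℕ and N_0 such that every integer N ≥ N_0 can be written as a sum of s terms of the form ⌊π n_i³ + n_i^{√2} / log log n_i⌋ with integers n_i ≥ 3. -/
open Finset

noncomputable def bG (x : ℝ) : ℝ := x ^ Real.sqrt 2 / Real.log (Real.log x)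

noncomputable def bF (x : ℝ) : ℝ := Real.pi * x ^ 3 + bG x

noncomputable def bG1 (x : ℝ) : ℝ :=
  x ^ (Real.sqrt 2 - 1) *
    (Real.sqrt 2 / Real.log (Real.log x) - 1 / (Real.log x * Real.log (Real.log x) ^ 2))

noncomputable def bG2 (x : ℝ) : ℝ :=
  x ^ (Real.sqrt 2 - 2) *
    (Real.sqrt 2 * (Real.sqrt 2 - 1) / Real.log (Real.log x)
      - (2 * Real.sqrt 2 - 1) / (Real.log x * Real.log (Real.log x) ^ 2)
      + 1 / (Real.log x ^ 2 * Real.log (Real.log x) ^ 2)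
      + 2 / (Real.log x ^ 2 * Real.log (Real.log x) ^ 3))

lemma log_ge_exp_one {x : ℝ} (hx : 16 ≤ x) : Real.exp 1 ≤ Real.log x := by
  have h1 : Real.log 16 ≤ Real.log x := Real.log_le_log (by norm_num) hx
  have h2 : Real.log 16 = 4 * Real.log 2 := by
    rw [show (16 : ℝ) = 2 ^ (4 : ℕ) by norm_num, Real.log_pow]; norm_num
  have := Real.log_two_gt_d9
  have := Real.exp_one_lt_d9
  linarith

lemma log_ge_one {x : ℝ} (hx : 16 ≤ x) : 1 ≤ Real.log x := by
  have := log_ge_exp_one hx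
  have := Real.exp_one_gt_d9
  linarith

lemma loglog_ge_one {x : ℝ} (hx : 16 ≤ x) : 1 ≤ Real.log (Real.log x) := by
  rw [Real.le_log_iff_exp_le (by linarith [log_ge_one hx])]
  exact log_ge_exp_one hx

lemma hasDeriv_loglog {x : ℝ} (hx : 16 ≤ x) :
    HasDerivAt (fun y => Real.log (Real.log y)) (1 / (x * Real.log x)) x := by
  have h1 := (Real.hasDerivAt_log (show x ≠ 0 by linarith)).log
    (show Real.log x ≠ 0 by linarith [log_ge_one hx])
  convert h1 using 1
  field_simp

lemma hasDeriv_bG {x : ℝ} (hx : 16 ≤ x) : HasDerivAt bG (bG1 x) x := by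
  have hx0 : 0 < x := by linarith
  have hl := log_ge_one hx
  have hll := loglog_ge_one hx
  have h1 := (Real.hasDerivAt_rpow_const (p := Real.sqrt 2) (Or.inl hx0.ne')).div
    (hasDeriv_loglog hx) (by linarith)
  have e : bG = (fun x : ℝ => x ^ Real.sqrt 2) / (fun y => Real.log (Real.log y)) := rfl
  rw [e]
  refine h1.congr_deriv ?_
  have : x ^ Real.sqrt 2 = x ^ (Real.sqrt 2 - 1) * x := by
    rw [Real.rpow_sub_one hx0.ne']; field_simp
  rw [this, bG1]
  generalize x ^ (Real.sqrt 2 - 1) = A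
  have h3 : Real.log x ≠ 0 := by linarith
  have h4 : Real.log (Real.log x) ≠ 0 := by linarith
  field_simp

lemma hasDeriv_bG1 {x : ℝ} (hx : 16 ≤ x) : HasDerivAt bG1 (bG2 x) x := by
  have hx0 : 0 < x := by linarith
  have hl := log_ge_one hx
  have hll := loglog_ge_one hx
  have h3 : Real.log x ≠ 0 := by linarith
  have h4 : Real.log (Real.log x) ≠ 0 := by linarith
  have hL := hasDeriv_loglog hx
  have h1 := (Real.hasDerivAt_rpow_const (p := Real.sqrt 2 - 1) (Or.inl hx0.ne')).mul
    (((hasDerivAt_const x (Real.sqrt 2)).div hL h4).sub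
      ((hasDerivAt_const x (1:ℝ)).div ((Real.hasDerivAt_log hx0.ne').mul (hL.pow 2))
        (by simp [h3, h4])))
  refine HasDerivAt.congr_deriv (f' := _) (h1.congr_of_eventuallyEq ?_) ?_
  · filter_upwards with y
    simp [bG1]
  · have : x ^ (Real.sqrt 2 - 1) = x ^ (Real.sqrt 2 - 2) * x := by
      rw [show Real.sqrt 2 - 2 = Real.sqrt 2 - 1 - 1 by ring,
        Real.rpow_sub_one hx0.ne' (Real.sqrt 2 - 1), div_mul_cancel₀ _ hx0.ne']
    have e2 : Real.sqrt 2 - 1 - 1 = Real.sqrt 2 - 2 := by ring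
    simp only [e2, this, bG2, Pi.mul_apply, Pi.pow_apply, Pi.sub_apply, Pi.div_apply]
    generalize x ^ (Real.sqrt 2 - 2) = A
    generalize Real.log (Real.log x) = u at *
    generalize Real.log x = v at *
    field_simp
    ring

lemma abs_bG2 {x : ℝ} (hx : 16 ≤ x) : |bG2 x| ≤ 10 / Real.sqrt x := by
  have hx0 : 0 < x := by linarith
  have hl := log_ge_one hx
  have hll := loglog_ge_one hx
  have ha : Real.sqrt 2 ≤ 3 / 2 := by
    rw [Real.sqrt_le_left (by norm_num)]; norm_num
  have ha1 : 1 ≤ Real.sqrt 2 := by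
    rw [Real.one_le_sqrt]; norm_num
  have h1 : x ^ (Real.sqrt 2 - 2) ≤ 1 / Real.sqrt x := by
    rw [one_div, Real.sqrt_eq_rpow x, ← Real.rpow_neg hx0.le]
    exact Real.rpow_le_rpow_of_exponent_le (by linarith) (by linarith)
  rw [bG2, abs_mul, abs_of_nonneg (Real.rpow_nonneg hx0.le _)]
  have key : ∀ c d : ℝ, 0 ≤ c → 1 ≤ d → 0 ≤ c / d ∧ c / d ≤ c := fun c d hc hd =>
    ⟨by positivity, div_le_self hc hd⟩
  generalize Real.log (Real.log x) = u at *
  generalize Real.log x = v at *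
  have p2 : 1 ≤ u ^ 2 := one_le_pow₀ hll
  have p3 : 1 ≤ u ^ 3 := one_le_pow₀ hll
  have q2 : 1 ≤ v ^ 2 := one_le_pow₀ hl
  have k1 := key (Real.sqrt 2 * (Real.sqrt 2 - 1)) u (by nlinarith) hll
  have k2 := key (2 * Real.sqrt 2 - 1) (v * u ^ 2) (by nlinarith) (one_le_mul_of_one_le_of_one_le hl p2)
  have k3 := key 1 (v ^ 2 * u ^ 2) (by norm_num) (one_le_mul_of_one_le_of_one_le q2 p2)
  have k4 := key 2 (v ^ 2 * u ^ 3) (by norm_num) (one_le_mul_of_one_le_of_one_le q2 p3)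
  have : Real.sqrt 2 * (Real.sqrt 2 - 1) ≤ 2 := by nlinarith
  have hb : |Real.sqrt 2 * (Real.sqrt 2 - 1) / u - (2 * Real.sqrt 2 - 1) / (v * u ^ 2) +
      1 / (v ^ 2 * u ^ 2) + 2 / (v ^ 2 * u ^ 3)| ≤ 10 := by
    rw [abs_le]; constructor <;> linarith
  calc _ ≤ (1 / Real.sqrt x) * 10 := by gcongr
    _ = _ := by ring

lemma second_diff {x h : ℝ} (hx : 32 ≤ x) (h0 : 0 ≤ h) (hh : h ≤ x / 2) :
    |bG (x + h) + bG (x - h) - 2 * bG x| ≤ 40 * h ^ 2 / Real.sqrt x := by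
  have hx0 : 0 < x := by linarith
  have hs : 0 < Real.sqrt x := Real.sqrt_pos.2 hx0
  -- bound for the second derivative
  have b2 : ∀ y, x / 2 ≤ y → |bG2 y| ≤ 20 / Real.sqrt x := by
    intro y hy
    refine (abs_bG2 (by linarith)).trans ?_
    have : Real.sqrt x ≤ 2 * Real.sqrt y := by
      rw [Real.sqrt_le_left (by positivity), mul_pow, Real.sq_sqrt (by linarith)]
      linarith
    have hy : 0 < Real.sqrt y := Real.sqrt_pos.2 (by linarith)
    rw [div_le_div_iff₀ hy hs]
    linarith
  have b1 : ∀ t, 0 ≤ t → t ≤ h → |bG1 (x + t) - bG1 (x - t)| ≤ 40 * h / Real.sqrt x := by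
    intro t t0 th
    have := Convex.norm_image_sub_le_of_norm_hasDerivWithin_le (f := bG1) (f' := bG2)
      (s := Set.Ici (x / 2)) (C := 20 / Real.sqrt x) (x := x - t) (y := x + t)
      (fun y hy => (hasDeriv_bG1 (by simp at hy; linarith)).hasDerivWithinAt)
      (fun y hy => b2 y hy) (convex_Ici _) (by simp; linarith) (by simp; linarith)
    rw [Real.norm_eq_abs, Real.norm_eq_abs] at this
    refine this.trans ?_
    rw [show x + t - (x - t) = 2 * t by ring, abs_of_nonneg (by positivity), div_mul_eq_mul_div]
    exact div_le_div_of_nonneg_right (by linarith) hs.le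
  have := Convex.norm_image_sub_le_of_norm_hasDerivWithin_le
    (f := fun t => bG (x + t) + bG (x - t)) (f' := fun t => bG1 (x + t) - bG1 (x - t))
      (s := Set.Icc 0 h) (C := 40 * h / Real.sqrt x) (x := 0) (y := h)
      (fun t ht => by
        obtain ⟨t0, th⟩ := ht
        have d1 : HasDerivAt (fun t => bG (x + t)) (bG1 (x + t)) t :=
          (hasDeriv_bG (x := x + t) (by linarith)).comp_const_add x t
        have d2 : HasDerivAt (fun t => bG (x - t)) (-bG1 (x - t)) t :=
          (hasDeriv_bG (x := x - t) (by linarith)).comp_const_sub x t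
        exact (d1.add d2).hasDerivWithinAt)
      (fun t ht => b1 t ht.1 ht.2) (convex_Icc _ _) (by simp [h0]) (by simp [h0])
  simp only [Real.norm_eq_abs, add_zero, sub_zero, abs_of_nonneg h0] at this
  rw [show bG (x + h) + bG (x - h) - 2 * bG x = bG (x + h) + bG (x - h) - (bG x + bG x) by ring]
  refine this.trans (le_of_eq ?_)
  ring

lemma second_diff_F {x h : ℝ} (hx : 32 ≤ x) (h0 : 0 ≤ h) (hh : h ≤ x / 2) :
    |bF (x + h) + bF (x - h) - 2 * bF x - 6 * Real.pi * x * h ^ 2| ≤ 40 * h ^ 2 / Real.sqrt x := by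
  have := second_diff hx h0 hh
  convert this using 2
  simp only [bF]; ring

lemma bG_nonneg {x : ℝ} (hx : 16 ≤ x) : 0 ≤ bG x := by
  have := loglog_ge_one hx
  have : 0 ≤ x := by linarith
  unfold bG; positivity

lemma bG_le {x : ℝ} (hx : 16 ≤ x) : bG x ≤ x ^ 2 := by
  have := loglog_ge_one hx
  have h0 : 0 ≤ x := by linarith
  unfold bG
  refine (div_le_self (by positivity) this).trans ?_
  rw [← Real.rpow_two]
  refine Real.rpow_le_rpow_of_exponent_le (by linarith) ?_
  rw [Real.sqrt_le_left (by norm_num)]; norm_num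

lemma bF_ge {x : ℝ} (hx : 16 ≤ x) : x ^ 3 ≤ bF x := by
  have := bG_nonneg hx
  have h3 := Real.pi_gt_three
  have : 0 ≤ x ^ 3 := by positivity
  unfold bF
  nlinarith

lemma bF_le {x : ℝ} (hx : 16 ≤ x) : bF x ≤ 5 * x ^ 3 := by
  have := bG_le hx
  have h3 := Real.pi_lt_four
  have : 0 ≤ x ^ 3 := by positivity
  have : x ^ 2 ≤ x ^ 3 := pow_le_pow_right₀ (by linarith) (by norm_num)
  unfold bF
  nlinarith

lemma bF_step {x : ℝ} (hx : 16 ≤ x) : bF (x + 1) - bF x ≤ 20 * x ^ 2 := by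
  have := bG_le (x := x + 1) (by linarith)
  have := bG_nonneg hx
  have h3 := Real.pi_lt_four
  have : Real.pi * (3 * x ^ 2 + 3 * x + 1) ≤ 4 * (3 * x ^ 2 + 3 * x + 1) := by
    gcongr
  unfold bF
  nlinarith

lemma greedy {T : ℝ} (hT : bF 16 ≤ T) :
    ∃ y : ℕ, 16 ≤ y ∧ bF y ≤ T ∧ T - bF y ≤ 20 * (y : ℝ) ^ 2 ∧ (y : ℝ) ^ 3 ≤ T := by
  have hex : ∃ n : ℕ, T < bF ((n + 16 : ℕ) : ℝ) := by
    obtain ⟨n, hn⟩ := exists_nat_gt T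
    refine ⟨n, hn.trans_le ?_⟩
    have h16 : (16 : ℝ) ≤ ((n + 16 : ℕ) : ℝ) := by push_cast; linarith [Nat.cast_nonneg (α := ℝ) n]
    refine le_trans ?_ (bF_ge h16)
    calc (n : ℝ) ≤ ((n + 16 : ℕ) : ℝ) := by push_cast; linarith
      _ ≤ _ := le_self_pow₀ (by linarith) (by norm_num)
  classical
  have h1 := Nat.find_spec hex
  rcases hm : Nat.find hex with _ | m
  · rw [hm] at h1; norm_num at h1; linarith
  · have h2 := Nat.find_min hex (m := m) (by omega)
    rw [hm] at h1
    push Not at h2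
    have h16 : (16 : ℝ) ≤ ((m + 16 : ℕ) : ℝ) := by push_cast; linarith [Nat.cast_nonneg (α := ℝ) m]
    refine ⟨m + 16, by omega, h2, ?_, (bF_ge h16).trans h2⟩
    have h3 := bF_step h16
    have h4 : ((m + 1 + 16 : ℕ) : ℝ) = ((m + 16 : ℕ) : ℝ) + 1 := by push_cast; ring
    rw [h4] at h1
    linarith

lemma pair_lemma {z x a m : ℕ} (hz : 10 ≤ z) (hx : z ^ 2 ≤ x) (ham : a ^ 2 ≤ m) (hm : m ≤ 3 * z) :
    ∃ p q : ℕ, 3 ≤ p ∧ 3 ≤ q ∧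
      |bF p + bF q - 2 * bF x - 6 * Real.pi * x * (a : ℝ) ^ 2| ≤ 120 := by
  have h2 : 2 * a ≤ x := by nlinarith
  have hx100 : 100 ≤ x := by nlinarith
  refine ⟨x + a, x - a, by omega, by omega, ?_⟩
  have hxr : (100 : ℝ) ≤ x := by exact_mod_cast hx100
  have h2r : 2 * (a : ℝ) ≤ x := by exact_mod_cast h2
  have := second_diff_F (x := x) (h := a) (by linarith) (by positivity) (by linarith)
  rw [Nat.cast_add, Nat.cast_sub (by omega)]
  refine this.trans ?_
  have hs : (z : ℝ) ≤ Real.sqrt x := by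
    apply Real.le_sqrt_of_sq_le; exact_mod_cast hx
  have hz0 : (10 : ℝ) ≤ z := by exact_mod_cast hz
  have ha : (a : ℝ) ^ 2 ≤ 3 * z := by exact_mod_cast ham.trans hm
  rw [div_le_iff₀ (by linarith)]
  linarith

lemma eight_lemma {z x m : ℕ} (hz : 10 ≤ z) (hx : z ^ 2 ≤ x) (hm : m ≤ 3 * z) :
    ∃ s : Multiset ℕ, s.card = 8 ∧ (∀ n ∈ s, 3 ≤ n) ∧
      |(s.map (fun n : ℕ => bF n)).sum - 8 * bF x - 6 * Real.pi * x * m| ≤ 480 := by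
  obtain ⟨a, b, c, d, h⟩ := Nat.sum_four_squares m
  obtain ⟨p1, q1, hp1, hq1, e1⟩ := pair_lemma (a := a) hz hx (by nlinarith) hm
  obtain ⟨p2, q2, hp2, hq2, e2⟩ := pair_lemma (a := b) hz hx (by nlinarith) hm
  obtain ⟨p3, q3, hp3, hq3, e3⟩ := pair_lemma (a := c) hz hx (by nlinarith) hm
  obtain ⟨p4, q4, hp4, hq4, e4⟩ := pair_lemma (a := d) hz hx (by nlinarith) hm
  refine ⟨{p1, q1, p2, q2, p3, q3, p4, q4}, by simp, by simp; omega, ?_⟩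
  have hr : (m : ℝ) = a ^ 2 + b ^ 2 + c ^ 2 + d ^ 2 := by exact_mod_cast h.symm
  rw [hr]
  simp only [Multiset.insert_eq_cons, Multiset.map_cons, Multiset.sum_cons,
    Multiset.map_singleton, Multiset.sum_singleton]
  rw [abs_le] at *
  constructor <;> linarith

lemma core : ∃ C : ℝ, ∃ N₀ : ℤ, ∀ N : ℤ, N₀ ≤ N → ∃ s : Multiset ℕ, s.card = 26 ∧
    (∀ n ∈ s, 3 ≤ n) ∧ |(s.map (fun n : ℕ => bF n)).sum - N| ≤ C := by
  have hf16 : bF 16 ≤ 20480 := (bF_le (le_refl _)).trans (by norm_num)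
  have hf16' : 0 ≤ bF 16 := le_trans (by norm_num) (bF_ge (le_refl 16))
  refine ⟨bF 16 + 24 + 1440, 1000 * (10 ^ 14) ^ 6, fun N hN => ?_⟩
  -- choose z
  obtain ⟨z, hz, hzN, hNz⟩ : ∃ z : ℕ, 10 ^ 14 ≤ z ∧ 1000 * (z : ℤ) ^ 6 ≤ N ∧
      N < 1000 * ((z : ℤ) + 1) ^ 6 := by
    have hex : ∃ n : ℕ, N < 1000 * ((n : ℤ) + 10 ^ 14 + 1) ^ 6 := by
      refine ⟨N.toNat, ?_⟩
      have h1 := Int.self_le_toNat N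
      have h2 : (1 : ℤ) ≤ (N.toNat : ℤ) + 10 ^ 14 + 1 := by omega
      have h3 := le_self_pow₀ h2 (show 6 ≠ 0 by norm_num)
      linarith
    classical
    have h1 := Nat.find_spec hex
    rcases hm : Nat.find hex with _ | m
    · rw [hm] at h1
      exact ⟨10 ^ 14, le_refl _, by push_cast; exact hN, by push_cast at h1 ⊢; simpa using h1⟩
    · have h2 := Nat.find_min hex (m := m) (by omega)
      rw [hm] at h1
      push Not at h2
      refine ⟨m + 1 + 10 ^ 14, by omega, ?_, ?_⟩
      · have e : (((m + 1 + 10 ^ 14 : ℕ) : ℕ) : ℤ) = (m : ℤ) + 10 ^ 14 + 1 := by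
          push_cast; ring
        rw [e]; exact h2
      · push_cast; push_cast at h1; exact h1
  have hzr : (10 : ℝ) ^ 14 ≤ z := by exact_mod_cast hz
  have hzNr : 1000 * (z : ℝ) ^ 6 ≤ N := by exact_mod_cast hzN
  have hNzr : (N : ℝ) ≤ 1000 * ((z : ℝ) + 1) ^ 6 := by exact_mod_cast hNz.le
  set w : ℝ := (z : ℝ) with hw
  have hw1 : 1 ≤ w := le_trans (by norm_num) hzr
  have hw0 : 0 ≤ w := by linarith
  have hw2 : (10 : ℝ) ^ 14 ≤ w ^ 2 := hzr.trans (le_self_pow₀ hw1 (by norm_num))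
  have hww : w ≤ w ^ 2 := le_self_pow₀ hw1 (by norm_num)
  have hw4 : (10 : ℝ) ^ 14 ≤ w ^ 4 := hzr.trans (le_self_pow₀ hw1 (by norm_num))
  have hw36 : (10 : ℝ) ^ 14 * w ^ 3 ≤ w ^ 6 := by
    have : (10 : ℝ) ^ 14 ≤ w ^ 3 := hzr.trans (le_self_pow₀ hw1 (by norm_num))
    calc (10 : ℝ) ^ 14 * w ^ 3 ≤ w ^ 3 * w ^ 3 := by gcongr
      _ = _ := by ring
  have hw6 : (10 : ℝ) ^ 14 ≤ w ^ 6 := hzr.trans (le_self_pow₀ hw1 (by norm_num))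
  have hNup : (N : ℝ) ≤ 64000 * w ^ 6 := by
    refine hNzr.trans ?_
    calc 1000 * (w + 1) ^ 6 ≤ 1000 * (2 * w) ^ 6 := by gcongr; linarith
      _ = _ := by ring
  have hpi3 := Real.pi_gt_three
  have hpi4 := Real.pi_lt_four
  have F1 : bF (w ^ 2) ≤ 5 * w ^ 6 := (bF_le (by linarith)).trans (le_of_eq (by ring))
  have F2 : bF (w ^ 2 + 1) ≤ 40 * w ^ 6 := (bF_le (by linarith)).trans (by
    calc 5 * (w ^ 2 + 1) ^ 3 ≤ 5 * (2 * w ^ 2) ^ 3 := by gcongr; linarith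
      _ = _ := by ring)
  have F3 : bF (w ^ 2 + w) ≤ 40 * w ^ 6 := (bF_le (by linarith)).trans (by
    calc 5 * (w ^ 2 + w) ^ 3 ≤ 5 * (2 * w ^ 2) ^ 3 := by gcongr; linarith
      _ = _ := by ring)
  have G1 : 0 ≤ bF (w ^ 2) := le_trans (by positivity) (bF_ge (by linarith))
  have G2 : 0 ≤ bF (w ^ 2 + 1) := le_trans (by positivity) (bF_ge (by linarith))
  have G3 : 0 ≤ bF (w ^ 2 + w) := le_trans (by positivity) (bF_ge (by linarith))
  have hw3 : 0 ≤ w ^ 3 := by positivity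
  have hpw : Real.pi * w ^ 3 ≤ 4 * w ^ 3 := by gcongr
  have hpw0 : 0 ≤ Real.pi * w ^ 3 := by positivity
  obtain ⟨T0, hT0⟩ : ∃ T0, T0 = N - 8 * bF (w ^ 2) - 8 * bF (w ^ 2 + 1) - 8 * bF (w ^ 2 + w)
    - 12 * (Real.pi * w ^ 3) := ⟨_, rfl⟩
  obtain ⟨y1, hy1, a1, b1, c1⟩ := greedy (T := T0) (by linarith)
  have d1 : (y1 : ℝ) ≤ 40 * w ^ 2 := by
    refine le_of_pow_le_pow_left₀ (n := 3) (by norm_num) (by positivity) ?_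
    calc (y1 : ℝ) ^ 3 ≤ 64000 * w ^ 6 := by linarith
      _ = _ := by ring
  have e1 : (y1 : ℝ) ^ 2 ≤ 1600 * w ^ 4 := by
    calc (y1 : ℝ) ^ 2 ≤ (40 * w ^ 2) ^ 2 := by gcongr
      _ = _ := by ring
  obtain ⟨y2, hy2, a2, b2, c2⟩ := greedy (T := T0 - bF y1 + bF 16) (by linarith)
  obtain ⟨T2, hT2⟩ : ∃ T2, T2 = T0 - bF y1 + bF 16 - bF y2 := ⟨_, rfl⟩
  rw [← hT2] at b2
  have hT20 : 0 ≤ T2 := by linarith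
  have d2 : (y2 : ℝ) ^ 3 ≤ 40000 * w ^ 4 := by linarith
  have e2 : T2 ≤ w ^ 3 := by
    refine b2.trans ?_
    refine le_of_pow_le_pow_left₀ (n := 3) (by norm_num) (by positivity) ?_
    calc (20 * (y2 : ℝ) ^ 2) ^ 3 = 8000 * ((y2 : ℝ) ^ 3) ^ 2 := by ring
      _ ≤ 8000 * (40000 * w ^ 4) ^ 2 := by gcongr
      _ = (8000 * 40000 ^ 2) * w ^ 8 := by ring
      _ ≤ w * w ^ 8 := by gcongr; linarith
      _ = _ := by ring
  -- the fine part
  obtain ⟨q, hq⟩ : ∃ q : ℕ, q = ⌊T2 / (6 * Real.pi)⌋₊ := ⟨_, rfl⟩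
  have hq1 : (q : ℝ) ≤ T2 / (6 * Real.pi) := by
    rw [hq]; exact Nat.floor_le (by positivity)
  have hq2 : T2 / (6 * Real.pi) < q + 1 := by
    rw [hq]; exact Nat.lt_floor_add_one _
  rw [le_div_iff₀ (by positivity)] at hq1
  rw [div_lt_iff₀ (by positivity)] at hq2
  have hqz : q ≤ z ^ 3 := by
    have : (q : ℝ) ≤ w ^ 3 := by nlinarith [Nat.cast_nonneg (α := ℝ) q]
    rw [hw] at this
    exact_mod_cast this
  have hzpos : 0 < z := by omega
  obtain ⟨q2, hq2d⟩ : ∃ k, k = q / z ^ 2 := ⟨_, rfl⟩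
  obtain ⟨r, hr⟩ : ∃ k, k = q % z ^ 2 := ⟨_, rfl⟩
  obtain ⟨m2, hm2⟩ : ∃ k, k = r / z := ⟨_, rfl⟩
  obtain ⟨m1, hm1⟩ : ∃ k, k = r % z := ⟨_, rfl⟩
  have k1 : z ^ 2 * q2 + r = q := by rw [hq2d, hr]; exact Nat.div_add_mod _ _
  have k2 : z * m2 + m1 = r := by rw [hm2, hm1]; exact Nat.div_add_mod _ _
  have k3 : q2 ≤ z := by
    rw [hq2d]; apply Nat.div_le_of_le_mul; rw [← pow_succ]; exact hqz
  have k4 : m1 < z := by rw [hm1]; exact Nat.mod_lt _ hzpos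
  have k5 : m2 < z := by
    rw [hm2]; apply Nat.div_lt_of_lt_mul; rw [hr, ← pow_two]; exact Nat.mod_lt _ (by positivity)
  obtain ⟨m0, hm0⟩ : ∃ m0, m0 + m1 + m2 = 2 * z + q2 := ⟨2 * z + q2 - m1 - m2, by omega⟩
  obtain ⟨s0, cs0, hs0, es0⟩ := eight_lemma (z := z) (x := z ^ 2) (m := m0) (by omega)
    (le_refl _) (by omega)
  obtain ⟨s1, cs1, hs1, es1⟩ := eight_lemma (z := z) (x := z ^ 2 + 1) (m := m1) (by omega)
    (by omega) (by omega)
  obtain ⟨s2, cs2, hs2, es2⟩ := eight_lemma (z := z) (x := z ^ 2 + z) (m := m2) (by omega)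
    (by omega) (by omega)
  refine ⟨s0 + s1 + s2 + {y1, y2}, by simp [cs0, cs1, cs2], ?_, ?_⟩
  · intro n hn
    simp only [Multiset.mem_add, Multiset.insert_eq_cons, Multiset.mem_cons,
      Multiset.mem_singleton] at hn
    rcases hn with ((hn | hn) | hn) | hn | hn
    · exact hs0 n hn
    · exact hs1 n hn
    · exact hs2 n hn
    · omega
    · omega
  · have key : w ^ 2 * m0 + (w ^ 2 + 1) * m1 + (w ^ 2 + w) * m2 = 2 * w ^ 3 + q := by
      have k1r : w ^ 2 * q2 + r = q := by rw [hw]; exact_mod_cast k1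
      have k2r : w * m2 + m1 = r := by rw [hw]; exact_mod_cast k2
      have hm0r : (m0 : ℝ) + m1 + m2 = 2 * w + q2 := by rw [hw]; exact_mod_cast hm0
      linear_combination w ^ 2 * hm0r + k1r + k2r
    have key2 : 6 * Real.pi * w ^ 2 * m0 + 6 * Real.pi * (w ^ 2 + 1) * m1
        + 6 * Real.pi * (w ^ 2 + w) * m2 = 12 * (Real.pi * w ^ 3) + q * (6 * Real.pi) := by
      linear_combination 6 * Real.pi * key
    push_cast at es0 es1 es2
    rw [← hw] at es0 es1 es2
    simp only [Multiset.map_add, Multiset.sum_add, Multiset.insert_eq_cons, Multiset.map_cons,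
      Multiset.sum_cons, Multiset.map_singleton, Multiset.sum_singleton]
    rw [abs_le] at *
    constructor <;> linarith

def RepA (k : ℕ) (N : ℤ) : Prop := ∃ s : Multiset ℕ, s.card = k ∧ (∀ n ∈ s, 3 ≤ n) ∧
    (s.map (fun n : ℕ => ⌊bF n⌋)).sum = N

lemma RepA.add {k l : ℕ} {M N : ℤ} (h : RepA k M) (h' : RepA l N) : RepA (k + l) (M + N) := by
  obtain ⟨s, h1, h2, h3⟩ := h
  obtain ⟨t, h4, h5, h6⟩ := h'
  refine ⟨s + t, by simp [h1, h4], ?_, by simp [h3, h6]⟩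
  intro n hn
  rcases Multiset.mem_add.1 hn with hn | hn
  · exact h2 n hn
  · exact h5 n hn

lemma RepA.smul {k : ℕ} {M : ℤ} (h : RepA k M) (j : ℕ) : RepA (j * k) (j * M) := by
  induction j with
  | zero => exact ⟨0, by simp, by simp, by simp⟩
  | succ j ih =>
    have := ih.add h
    convert this using 1
    · ring
    · push_cast; ring

lemma repA_single {n : ℕ} (hn : 3 ≤ n) {N : ℤ} (h : ⌊bF n⌋ = N) : RepA 1 N :=
  ⟨{n}, by simp, by simp [hn], by simp [h]⟩

lemma core_int : ∃ D : ℕ, ∃ N₀ : ℤ, ∀ N : ℤ, N₀ ≤ N → ∃ e : ℤ, |e| ≤ D ∧ RepA 26 (N + e) := by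
  obtain ⟨C, N₀, h⟩ := core
  refine ⟨⌈C + 26⌉₊, N₀, fun N hN => ?_⟩
  obtain ⟨s, h1, h2, h3⟩ := h N hN
  refine ⟨(s.map (fun n : ℕ => ⌊bF n⌋)).sum - N, ?_, s, h1, h2, by ring⟩
  have key : ∀ t : Multiset ℕ,
      |(((t.map (fun n : ℕ => ⌊bF n⌋)).sum : ℤ) : ℝ) - (t.map (fun n : ℕ => bF n)).sum| ≤ t.card := by
    intro t
    induction t using Multiset.induction_on with
    | empty => simp
    | cons a t ih =>
      simp only [Multiset.map_cons, Multiset.sum_cons, Multiset.card_cons]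
      rw [Int.cast_add, Nat.cast_add, Nat.cast_one]
      have u1 := Int.floor_le (bF a)
      have u2 := Int.lt_floor_add_one (bF a)
      rw [abs_le] at *
      constructor <;> linarith
  have k := key s
  rw [h1] at k
  have hc := Nat.le_ceil (C + 26)
  have : |(((s.map (fun n : ℕ => ⌊bF n⌋)).sum - N : ℤ) : ℝ)| ≤ (⌈C + 26⌉₊ : ℝ) := by
    push_cast at k ⊢
    rw [abs_le] at *
    constructor <;> linarith
  exact_mod_cast this

lemma main_of {k : ℕ} {b : ℤ} (hb : RepA k b) (hb1 : RepA k (b + 1)) :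
    ∃ s : ℕ, ∃ N₀ : ℤ, ∀ N : ℤ, N₀ ≤ N → RepA s N := by
  obtain ⟨D, N₀, h⟩ := core_int
  refine ⟨26 + 2 * D * k, N₀ + 2 * D * b + D, fun N hN => ?_⟩
  obtain ⟨e, he, hr⟩ := h (N - 2 * D * b - D) (by linarith)
  rw [abs_le] at he
  obtain ⟨j, hj⟩ := Int.eq_ofNat_of_zero_le (show 0 ≤ D - e by linarith)
  obtain ⟨i, hi⟩ : ∃ i, i + j = 2 * D := ⟨2 * D - j, by omega⟩
  have := hr.add ((hb1.smul j).add (hb.smul i))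
  convert this using 1
  · rw [← hi]; ring
  · have hi' : (i : ℤ) + j = 2 * D := by exact_mod_cast hi
    linear_combination hj - b * hi'

lemma rpow_bounds {x lo hi : ℝ} (hx : 1 ≤ x) (hlo : 0 ≤ lo) (hhi : 0 ≤ hi)
    (h1 : lo ^ 29 ≤ x ^ 41) (h2 : x ^ 17 ≤ hi ^ 12) :
    lo ≤ x ^ Real.sqrt 2 ∧ x ^ Real.sqrt 2 ≤ hi := by
  have hx0 : 0 ≤ x := by linarith
  constructor
  · have : lo ≤ x ^ ((41 : ℝ) / 29) := by
      refine le_of_pow_le_pow_left₀ (n := 29) (by norm_num) (by positivity) ?_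
      rw [← Real.rpow_natCast (x ^ ((41 : ℝ) / 29)), ← Real.rpow_mul hx0]
      refine h1.trans (le_of_eq ?_)
      rw [← Real.rpow_natCast]; norm_num
    refine this.trans (Real.rpow_le_rpow_of_exponent_le hx ?_)
    apply Real.le_sqrt_of_sq_le; norm_num
  · have : x ^ ((17 : ℝ) / 12) ≤ hi := by
      refine le_of_pow_le_pow_left₀ (n := 12) (by norm_num) (by positivity) ?_
      rw [← Real.rpow_natCast (x ^ ((17 : ℝ) / 12)), ← Real.rpow_mul hx0]
      refine le_trans (le_of_eq ?_) h2
      rw [← Real.rpow_natCast]; norm_num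
    refine le_trans (Real.rpow_le_rpow_of_exponent_le hx ?_) this
    rw [Real.sqrt_le_left (by norm_num)]; norm_num

lemma log_near {y c : ℝ} (hy : 0 < y) (hc : 0 < c) :
    Real.log c + 1 - c / y ≤ Real.log y ∧ Real.log y ≤ Real.log c + y / c - 1 := by
  have h1 := Real.log_le_sub_one_of_pos (show 0 < y / c by positivity)
  have h2 := Real.log_le_sub_one_of_pos (show 0 < c / y by positivity)
  rw [Real.log_div (by positivity) (by positivity)] at h1 h2
  constructor <;> linarith

lemma floor_of {x p lo hi l u : ℝ} {N : ℤ} (hp : lo ≤ x ^ Real.sqrt 2 ∧ x ^ Real.sqrt 2 ≤ hi)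
    (hlo : 0 ≤ lo) (hl : 0 < l) (hx : x ^ 3 = p) (hp0 : 0 ≤ p)
    (h1 : l ≤ Real.log (Real.log x)) (h2 : Real.log (Real.log x) ≤ u)
    (a : N ≤ 3.1415 * p + lo / u) (b : 3.1416 * p + hi / l < N + 1) : ⌊bF x⌋ = N := by
  have e1 : x ^ Real.sqrt 2 / Real.log (Real.log x) ≤ hi / l := by
    apply div_le_div₀ <;> linarith
  have e2 : lo / u ≤ x ^ Real.sqrt 2 / Real.log (Real.log x) := by
    apply div_le_div₀ <;> linarith
  have p1 := Real.pi_gt_d4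
  have p2 := Real.pi_lt_d4
  rw [Int.floor_eq_iff, bF, bG, hx]
  constructor <;> nlinarith

lemma val9 : ⌊bF (9 : ℕ)⌋ = 2318 := by
  have l2 := Real.log_two_gt_d9
  have l2' := Real.log_two_lt_d9
  have l3 := Real.log_three_gt_d9
  have l3' := Real.log_three_lt_d9
  have hlog : Real.log 9 = 2 * Real.log 3 := by
    rw [show (9 : ℝ) = 3 ^ (2 : ℕ) by norm_num, Real.log_pow]; norm_num
  have hc : Real.log (9 / 4) = 2 * Real.log 3 - 2 * Real.log 2 := by
    rw [Real.log_div (by norm_num) (by norm_num), hlog,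
      show (4 : ℝ) = 2 ^ (2 : ℕ) by norm_num, Real.log_pow]; norm_num
  have h := log_near (y := Real.log 9) (c := 9 / 4) (by linarith) (by norm_num)
  have hd : 9 / 4 / Real.log 9 ≤ 1.0241 := by
    rw [div_le_iff₀ (by linarith)]; linarith
  push_cast
  refine floor_of (p := 729) (lo := 22.32) (hi := 22.5) (l := 0.7868) (u := 0.79)
    (rpow_bounds (by norm_num) (by norm_num) (by norm_num) (by norm_num) (by norm_num))
    (by norm_num) (by norm_num) (by norm_num) (by norm_num) (by linarith) (by linarith)
    (by norm_num) (by norm_num)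

lemma val10 : ⌊bF (10 : ℕ)⌋ = 3172 := by
  have l2 := Real.log_two_gt_d9
  have l2' := Real.log_two_lt_d9
  have l3 := Real.log_three_gt_d9
  have l3' := Real.log_three_lt_d9
  have l5 := Real.log_five_gt_d9
  have l5' := Real.log_five_lt_d9
  have hlog : Real.log 10 = Real.log 2 + Real.log 5 := by
    rw [show (10 : ℝ) = 2 * 5 by norm_num, Real.log_mul (by norm_num) (by norm_num)]
  have hc : Real.log (9 / 4) = 2 * Real.log 3 - 2 * Real.log 2 := by
    rw [Real.log_div (by norm_num) (by norm_num), show (9 : ℝ) = 3 ^ (2 : ℕ) by norm_num,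
      show (4 : ℝ) = 2 ^ (2 : ℕ) by norm_num, Real.log_pow, Real.log_pow]; norm_num
  have h := log_near (y := Real.log 10) (c := 9 / 4) (by linarith) (by norm_num)
  have hd : 9 / 4 / Real.log 10 ≤ 0.9772 := by
    rw [div_le_iff₀ (by linarith)]; linarith
  push_cast
  refine floor_of (p := 1000) (lo := 25.92) (hi := 26.11) (l := 0.8337) (u := 0.8346)
    (rpow_bounds (by norm_num) (by norm_num) (by norm_num) (by norm_num) (by norm_num))
    (by norm_num) (by norm_num) (by norm_num) (by norm_num) (by linarith) (by linarith)
    (by norm_num) (by norm_num)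

lemma val12 : ⌊bF (12 : ℕ)⌋ = 5465 := by
  have l2 := Real.log_two_gt_d9
  have l2' := Real.log_two_lt_d9
  have l3 := Real.log_three_gt_d9
  have l3' := Real.log_three_lt_d9
  have l5 := Real.log_five_gt_d9
  have l5' := Real.log_five_lt_d9
  have hlog : Real.log 12 = 2 * Real.log 2 + Real.log 3 := by
    rw [show (12 : ℝ) = 2 ^ (2 : ℕ) * 3 by norm_num, Real.log_mul (by norm_num) (by norm_num),
      Real.log_pow]; norm_num
  have hc : Real.log (5 / 2) = Real.log 5 - Real.log 2 := by
    rw [Real.log_div (by norm_num) (by norm_num)]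
  have h := log_near (y := Real.log 12) (c := 5 / 2) (by linarith) (by norm_num)
  have hd : 5 / 2 / Real.log 12 ≤ 1.00609 := by
    rw [div_le_iff₀ (by linarith)]; linarith
  push_cast
  refine floor_of (p := 1728) (lo := 33.54) (hi := 33.81) (l := 0.91) (u := 0.9104)
    (rpow_bounds (by norm_num) (by norm_num) (by norm_num) (by norm_num) (by norm_num))
    (by norm_num) (by norm_num) (by norm_num) (by norm_num) (by linarith) (by linarith)
    (by norm_num) (by norm_num)

lemma main_rep : ∃ s : ℕ, ∃ N₀ : ℤ, ∀ N : ℤ, N₀ ≤ N → RepA s N := by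
  have r9 := repA_single (by norm_num) val9
  have r10 := repA_single (by norm_num) val10
  have r12 := repA_single (by norm_num) val12
  have v := (r12.smul 327).add (r9.smul 878)
  have u := r10.smul 1205
  norm_num at u v
  exact main_of v u

/-- The sequence `(⌊π n³ + n^{√2} / log log n⌋)_{n ≥ 3}` is an asymptotic
basis. -/
theorem stmt_14 :
    ∃ s : ℕ, ∃ N₀ : ℤ, ∀ N : ℤ, N₀ ≤ N →
      ∃ n : Fin s → ℕ, (∀ i, 3 ≤ n i) ∧
        ∑ i, ⌊(Real.pi * (n i : ℝ) ^ 3 +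
          (n i : ℝ) ^ Real.sqrt 2 / Real.log (Real.log (n i)))⌋ = N := by
  obtain ⟨s, N₀, h⟩ := main_rep
  refine ⟨s, N₀, fun N hN => ?_⟩
  obtain ⟨m, h1, h2, h3⟩ := h N hN
  induction m using Quotient.inductionOn with
  | _ l =>
    simp only [Multiset.quot_mk_to_coe, Multiset.coe_card, Multiset.mem_coe, Multiset.map_coe,
      Multiset.sum_coe] at h1 h2 h3
    subst h1
    refine ⟨fun i => l.get i, fun i => h2 _ (List.get_mem _ _), ?_⟩
    rw [← h3, ← List.sum_ofFn]
    congr 1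
    apply List.ext_get <;> simp [bF, bG]
end

section
/- The sequence (⌊(log Γ(n))^{√2}⌋)_{n ≥ 3}, where Γ is the Gamma function, is an asymptotic basis: there exist s ∈ ℕ and N_0 such that every integer N ≥ N_0 can be written as a sum of s terms of the form ⌊(log Γ(n_i))^{√2}⌋ with integers n_i ≥ 3. -/
open Finset

/-- convex tangent line inequality for powers -/
lemma aux_tangent_ge {p x y : ℝ} (hp : 1 ≤ p) (hx : 0 < x) (hy : 0 < y) :
    y ^ p + p * y ^ (p - 1) * (x - y) ≤ x ^ p := by
  have h := one_add_mul_self_le_rpow_one_add (s := x / y - 1)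
    (by have := div_pos hx hy; linarith) hp
  have e : 1 + (x / y - 1) = x / y := by ring
  rw [e, Real.div_rpow hx.le hy.le, le_div_iff₀ (Real.rpow_pos_of_pos hy p)] at h
  have e2 : y ^ p = y ^ (p - 1) * y := by
    rw [← Real.rpow_add_one hy.ne']; congr 1; ring
  calc _ = (1 + p * (x / y - 1)) * y ^ p := by rw [e2]; field_simp
    _ ≤ _ := h

lemma aux_tangent_le {p x y : ℝ} (hp0 : 0 ≤ p) (hp : p ≤ 1) (hx : 0 < x) (hy : 0 < y) :
    x ^ p ≤ y ^ p + p * y ^ (p - 1) * (x - y) := by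
  have h := rpow_one_add_le_one_add_mul_self (s := x / y - 1)
    (by have := div_pos hx hy; linarith) hp0 hp
  have e : 1 + (x / y - 1) = x / y := by ring
  rw [e, Real.div_rpow hx.le hy.le, div_le_iff₀ (Real.rpow_pos_of_pos hy p)] at h
  have e2 : y ^ p = y ^ (p - 1) * y := by
    rw [← Real.rpow_add_one hy.ne']; congr 1; ring
  calc _ ≤ (1 + p * (x / y - 1)) * y ^ p := h
    _ = _ := by rw [e2]; field_simp

/-- log Gamma at naturals -/
noncomputable def auxL (n : ℕ) : ℝ := Real.log (Real.Gamma n)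

noncomputable def auxF (n : ℕ) : ℝ := auxL n ^ Real.sqrt 2

lemma auxL_succ {n : ℕ} (hn : 1 ≤ n) : auxL (n + 1) = auxL n + Real.log n := by
  have h0 : (0 : ℝ) < n := by exact_mod_cast hn
  unfold auxL
  push_cast
  rw [Real.Gamma_add_one h0.ne', Real.log_mul h0.ne' (Real.Gamma_pos_of_pos h0).ne', add_comm]

lemma auxL_one : auxL 1 = 0 := by simp [auxL]

lemma aux_log_mono {a b : ℕ} (hb : 1 ≤ b) (h : b ≤ a) : Real.log b ≤ Real.log a :=
  Real.log_le_log (by exact_mod_cast hb) (by exact_mod_cast h)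

lemma auxL_diff {b : ℕ} (hb : 1 ≤ b) (d : ℕ) :
    d * Real.log b ≤ auxL (b + d) - auxL b ∧
    auxL (b + d) - auxL b ≤ d * Real.log ((b + d : ℕ) : ℝ) := by
  induction d with
  | zero => simp
  | succ d ih =>
    have h1 := auxL_succ (n := b + d) (by omega)
    have h2 := aux_log_mono hb (show b ≤ b + d by omega)
    have h3 := aux_log_mono (show 1 ≤ b + d by omega) (show b + d ≤ b + (d + 1) by omega)
    rw [← add_assoc, h1]
    rw [← add_assoc] at h3
    have h4 : (d : ℝ) * Real.log ((b + d : ℕ) : ℝ) ≤ d * Real.log ((b + d + 1 : ℕ) : ℝ) :=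
      mul_le_mul_of_nonneg_left h3 (Nat.cast_nonneg d)
    have e : ((d + 1 : ℕ) : ℝ) = d + 1 := by push_cast; ring
    rw [e]
    constructor <;> linarith [ih.1, ih.2]

lemma auxL_mono {a b : ℕ} (hb : 1 ≤ b) (h : b ≤ a) : auxL b ≤ auxL a := by
  obtain ⟨d, rfl⟩ := Nat.exists_eq_add_of_le h
  have := (auxL_diff hb d).1
  have h2 : 0 ≤ Real.log b := Real.log_nonneg (by exact_mod_cast hb)
  have : 0 ≤ (d : ℝ) * Real.log b := by positivity
  linarith

lemma auxL_three : auxL 3 = Real.log 2 := by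
  have h1 := auxL_succ (n := 1) le_rfl
  have h2 := auxL_succ (n := 2) (by norm_num)
  norm_num [auxL_one] at h1 h2
  rw [h2, h1]; ring

lemma auxL_pos {n : ℕ} (hn : 3 ≤ n) : 0 < auxL n := by
  have := auxL_mono (by norm_num) hn
  rw [auxL_three] at this
  linarith [Real.log_pos (show (1 : ℝ) < 2 by norm_num)]

lemma auxL_le {n : ℕ} (hn : 1 ≤ n) : auxL n ≤ n * Real.log n := by
  obtain ⟨d, rfl⟩ := Nat.exists_eq_add_of_le hn
  have := (auxL_diff le_rfl d).2
  rw [auxL_one] at this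
  have h2 : 0 ≤ Real.log ((1 + d : ℕ) : ℝ) := Real.log_nonneg (by exact_mod_cast hn)
  have e : ((1 + d : ℕ) : ℝ) = 1 + d := by push_cast; ring
  have e2 : ((1 + d : ℕ) : ℝ) * Real.log ((1 + d : ℕ) : ℝ) =
      Real.log ((1 + d : ℕ) : ℝ) + d * Real.log ((1 + d : ℕ) : ℝ) := by rw [← one_add_mul, ← e]
  rw [e2]
  linarith

lemma auxL_ge {n : ℕ} (hn : 16 ≤ n) : (n : ℝ) ≤ auxL n := by
  obtain ⟨d, rfl⟩ := Nat.exists_eq_add_of_le (show 8 ≤ n by omega)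
  have h := (auxL_diff (b := 8) (by norm_num) d).1
  have h8 := auxL_pos (n := 8) (by norm_num)
  have hl : (2 : ℝ) ≤ Real.log ((8 : ℕ) : ℝ) := by
    have : ((8 : ℕ) : ℝ) = 2 ^ 3 := by norm_num
    rw [this, Real.log_pow]
    have := Real.log_two_gt_d9
    push_cast; linarith
  have hd : (8 : ℝ) ≤ d := by
    have : 8 ≤ d := by omega
    exact_mod_cast this
  push_cast at *
  nlinarith

lemma aux_p1 : (1.414 : ℝ) ≤ Real.sqrt 2 := Real.le_sqrt_of_sq_le (by norm_num)
lemma aux_p2 : Real.sqrt 2 ≤ (1.415 : ℝ) := by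
  rw [Real.sqrt_le_left (by norm_num)]; norm_num

local notation "P" => Real.sqrt 2
local notation "Q" => (Real.sqrt 2 - 1)

lemma auxD_ge {n : ℕ} (hn : 3 ≤ n) :
    P * auxL n ^ Q * Real.log n ≤ auxF (n + 1) - auxF n := by
  have h := aux_tangent_ge (p := P) (by linarith [aux_p1]) (auxL_pos (n := n + 1) (by omega))
    (auxL_pos hn)
  have e := auxL_succ (n := n) (by omega)
  have e2 : auxL (n + 1) - auxL n = Real.log n := by linarith
  rw [e2] at h
  unfold auxF
  linarith

lemma auxD_le {n : ℕ} (hn : 3 ≤ n) :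
    auxF (n + 1) - auxF n ≤ P * auxL (n + 1) ^ Q * Real.log n := by
  have h := aux_tangent_ge (p := P) (by linarith [aux_p1])
    (auxL_pos hn) (auxL_pos (n := n + 1) (by omega))
  have e := auxL_succ (n := n) (by omega)
  have e2 : auxL n - auxL (n + 1) = - Real.log n := by linarith
  rw [e2] at h
  unfold auxF
  linarith

lemma aux_rpow_mono {a b : ℕ} (hb : 3 ≤ b) (h : b ≤ a) : auxL b ^ Q ≤ auxL a ^ Q :=
  Real.rpow_le_rpow (auxL_pos hb).le (auxL_mono (by omega) h) (by linarith [aux_p1])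

lemma auxF_mono {a b : ℕ} (hb : 3 ≤ b) (h : b ≤ a) : auxF b ≤ auxF a :=
  Real.rpow_le_rpow (auxL_pos hb).le (auxL_mono (by omega) h) (by linarith [aux_p1])

/-- upper bound for a step -/
lemma aux_step_le {u v A B : ℕ} (hB : 16 ≤ B) (hv : B ≤ v) (huv : v ≤ u) (hA : u + 1 ≤ A) :
    (auxF (u + 1) - auxF u) - (auxF (v + 1) - auxF v) ≤
      P * (2 * (A - B : ℝ) * (B : ℝ) ^ (Q - 1) * Real.log A ^ 2) := by
  have hp1 := aux_p1
  have hp2 := aux_p2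
  have h1 := auxD_le (n := u) (by omega)
  have h2 := auxD_ge (n := v) (by omega)
  have hB0 : (0 : ℝ) < B := by exact_mod_cast (show 0 < B by omega)
  have hAB : (B : ℝ) ≤ A := by exact_mod_cast (show B ≤ A by omega)
  have hLB := auxL_pos (n := B) (by omega)
  have hLA := auxL_pos (n := A) (by omega)
  have hlB : 0 ≤ Real.log B := Real.log_nonneg (by exact_mod_cast (show 1 ≤ B by omega))
  have hlu : 0 ≤ Real.log u := Real.log_nonneg (by exact_mod_cast (show 1 ≤ u by omega))
  have hlBA := aux_log_mono (show 1 ≤ B by omega) (show B ≤ A by omega)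
  have hlA : 1 ≤ Real.log A := by
    rw [Real.le_log_iff_exp_le (by linarith)]
    have : (16 : ℝ) ≤ A := by exact_mod_cast (show 16 ≤ A by omega)
    linarith [Real.exp_one_lt_d9]
  have hLBQ : 0 < auxL B ^ Q := Real.rpow_pos_of_pos hLB _
  have hLAQ : 0 < auxL A ^ Q := Real.rpow_pos_of_pos hLA _
  have h3 : auxL (u + 1) ^ Q * Real.log u ≤ auxL A ^ Q * Real.log A :=
    mul_le_mul (aux_rpow_mono (by omega) hA) (aux_log_mono (by omega) (by omega)) hlu hLAQ.le
  have h4 : auxL B ^ Q * Real.log B ≤ auxL v ^ Q * Real.log v :=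
    mul_le_mul (aux_rpow_mono (by omega) hv) (aux_log_mono (by omega) (by omega)) hlB
      (Real.rpow_pos_of_pos (auxL_pos (by omega)) _).le
  have h5 := aux_tangent_le (p := Q) (by linarith) (by linarith) hLA hLB
  have h6 : auxL A - auxL B ≤ (A - B : ℝ) * Real.log A := by
    obtain ⟨d, rfl⟩ := Nat.exists_eq_add_of_le (show B ≤ A by omega)
    have := (auxL_diff (show 1 ≤ B by omega) d).2
    have e : ((B + d : ℕ) : ℝ) - B = d := by push_cast; ring
    rw [e]; exact this
  have h7 : auxL B ^ (Q - 1) ≤ (B : ℝ) ^ (Q - 1) :=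
    Real.rpow_le_rpow_of_nonpos hB0 (auxL_ge hB) (by linarith)
  have h7' : 0 < auxL B ^ (Q - 1) := Real.rpow_pos_of_pos hLB _
  have hBQ : 0 < (B : ℝ) ^ (Q - 1) := Real.rpow_pos_of_pos hB0 _
  have h8 : auxL B ^ Q ≤ (B : ℝ) ^ (Q - 1) * (B * Real.log A) := by
    have e : auxL B ^ Q = auxL B ^ (Q - 1) * auxL B := by
      rw [← Real.rpow_add_one hLB.ne']; congr 1; ring
    rw [e]
    refine mul_le_mul h7 ?_ hLB.le hBQ.le
    exact (auxL_le (by omega)).trans (mul_le_mul_of_nonneg_left hlBA hB0.le)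
  have h9 : Real.log A - Real.log B ≤ (A - B : ℝ) / B := by
    rw [← Real.log_div (by linarith) hB0.ne']
    have := Real.log_le_sub_one_of_pos (show (0 : ℝ) < A / B from div_pos (by linarith) hB0)
    have e : (A - B : ℝ) / B = A / B - 1 := by field_simp
    rw [e]; exact this
  -- combine
  have hd : 0 ≤ (A - B : ℝ) := by linarith
  have h10 : auxL A ^ Q - auxL B ^ Q ≤ (B : ℝ) ^ (Q - 1) * ((A - B : ℝ) * Real.log A) := by
    have : Q * auxL B ^ (Q - 1) * (auxL A - auxL B)
        ≤ (B : ℝ) ^ (Q - 1) * ((A - B : ℝ) * Real.log A) := by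
      apply mul_le_mul _ h6 (by linarith [auxL_mono (show 1 ≤ B by omega) (show B ≤ A by omega)])
        hBQ.le
      nlinarith
    linarith
  have h11 : auxL B ^ Q * (Real.log A - Real.log B) ≤
      (B : ℝ) ^ (Q - 1) * ((A - B : ℝ) * Real.log A) := by
    calc _ ≤ ((B : ℝ) ^ (Q - 1) * (B * Real.log A)) * ((A - B : ℝ) / B) :=
          mul_le_mul h8 h9 (by linarith) (by positivity)
      _ = _ := by field_simp
  set X := (B : ℝ) ^ (Q - 1) * (A - B : ℝ) with hX
  have hX0 : 0 ≤ X := by positivity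
  have h12 : auxL A ^ Q * Real.log A - auxL B ^ Q * Real.log B ≤ 2 * X * Real.log A ^ 2 := by
    have h13 := mul_le_mul_of_nonneg_right h10 (show 0 ≤ Real.log A by linarith)
    have h14 : X * Real.log A ≤ X * Real.log A ^ 2 := by
      apply mul_le_mul_of_nonneg_left _ hX0
      nlinarith
    have e1 : (B : ℝ) ^ (Q - 1) * ((A - B : ℝ) * Real.log A) * Real.log A
      = X * Real.log A ^ 2 := by rw [hX]; ring
    have e2 : (B : ℝ) ^ (Q - 1) * ((A - B : ℝ) * Real.log A)
      = X * Real.log A := by rw [hX]; ring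
    rw [e1] at h13
    rw [e2] at h11
    nlinarith
  calc _ ≤ P * (auxL (u + 1) ^ Q * Real.log u - auxL v ^ Q * Real.log v) := by linarith
    _ ≤ P * (2 * X * Real.log A ^ 2) := by
        apply mul_le_mul_of_nonneg_left _ (by linarith)
        linarith
    _ = _ := by rw [hX]; ring

/-- lower bound for a step; here `m = v + k + 1`, `u = m + k`. -/
lemma aux_step_ge {m k v K : ℕ} (hm : m = v + k + 1) (hk : k < K) (hK : K + 3 ≤ m) :
    P * (Q * auxL (m + K) ^ (Q - 1) * (2 * k * Real.log ((m - K : ℕ) : ℝ))) * Real.log m ≤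
    (auxF (m + k + 1) - auxF (m + k)) - (auxF (v + 1) - auxF v) := by
  have hp1 := aux_p1
  have hp2 := aux_p2
  have h1 := auxD_ge (n := m + k) (by omega)
  have h2 := auxD_le (n := v) (by omega)
  have hlm : 0 ≤ Real.log m := Real.log_nonneg (by exact_mod_cast (show 1 ≤ m by omega))
  have hLu := auxL_pos (n := m + k) (by omega)
  have hLv := auxL_pos (n := v + 1) (by omega)
  have h3 : auxL (m + k) ^ Q * Real.log m ≤ auxL (m + k) ^ Q * Real.log ((m + k : ℕ) : ℝ) :=
    mul_le_mul_of_nonneg_left (aux_log_mono (by omega) (by omega))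
      (Real.rpow_pos_of_pos hLu _).le
  have h4 : auxL (v + 1) ^ Q * Real.log v ≤ auxL (v + 1) ^ Q * Real.log m :=
    mul_le_mul_of_nonneg_left (aux_log_mono (by omega) (by omega))
      (Real.rpow_pos_of_pos hLv _).le
  have h5 := aux_tangent_le (p := Q) (by linarith) (by linarith) hLv hLu
  have h6 : auxL (m + K) ^ (Q - 1) ≤ auxL (m + k) ^ (Q - 1) :=
    Real.rpow_le_rpow_of_nonpos hLu (auxL_mono (by omega) (by omega)) (by linarith)
  have h7 : 2 * k * Real.log ((m - K : ℕ) : ℝ) ≤ auxL (m + k) - auxL (v + 1) := by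
    have e : m + k = (v + 1) + 2 * k := by omega
    have h := (auxL_diff (show 1 ≤ v + 1 by omega) (2 * k)).1
    rw [← e] at h
    refine le_trans ?_ h
    push_cast
    apply mul_le_mul_of_nonneg_left _ (by positivity)
    exact_mod_cast aux_log_mono (show 1 ≤ m - K by omega) (show m - K ≤ v + 1 by omega)
  have h8 : 0 ≤ Real.log ((m - K : ℕ) : ℝ) :=
    Real.log_nonneg (by exact_mod_cast (show 1 ≤ m - K by omega))
  have h9 : Q * auxL (m + K) ^ (Q - 1) * (2 * k * Real.log ((m - K : ℕ) : ℝ)) ≤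
      auxL (m + k) ^ Q - auxL (v + 1) ^ Q := by
    have : Q * auxL (m + K) ^ (Q - 1) * (2 * k * Real.log ((m - K : ℕ) : ℝ)) ≤
      Q * auxL (m + k) ^ (Q - 1) * (auxL (m + k) - auxL (v + 1)) := by
      apply mul_le_mul _ h7 (by positivity)
      · exact mul_nonneg (by linarith) (Real.rpow_pos_of_pos hLu _).le
      · exact mul_le_mul_of_nonneg_left h6 (by linarith)
    linarith
  calc _ = P * (Q * auxL (m + K) ^ (Q - 1) * (2 * k * Real.log ((m - K : ℕ) : ℝ)) * Real.log m) := by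
        ring
    _ ≤ P * ((auxL (m + k) ^ Q - auxL (v + 1) ^ Q) * Real.log m) := by
        apply mul_le_mul_of_nonneg_left _ (by linarith)
        exact mul_le_mul_of_nonneg_right h9 hlm
    _ ≤ P * (auxL (m + k) ^ Q * Real.log ((m + k : ℕ) : ℝ) - auxL (v + 1) ^ Q * Real.log v) := by
        apply mul_le_mul_of_nonneg_left _ (by linarith)
        linarith
    _ ≤ _ := by linarith

lemma aux_sum_ge {m K : ℕ} (hK : K + 3 ≤ m) (k : ℕ) (hk : k ≤ K) :
    2 * auxF m + P * (Q * auxL (m + K) ^ (Q - 1) * (k * (k - 1) * Real.log ((m - K : ℕ) : ℝ)))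
      * Real.log m ≤ auxF (m + k) + auxF (m - k) := by
  induction k with
  | zero => simp; linarith
  | succ k ih =>
    have ih := ih (by omega)
    have h := aux_step_ge (m := m) (k := k) (v := m - (k + 1)) (K := K) (by omega) (by omega) hK
    have e : m - (k + 1) + 1 = m - k := by omega
    rw [e] at h
    rw [← add_assoc]
    push_cast
    linarith

lemma aux_main {m K : ℕ} (h1 : K + 16 ≤ m) (h2 : (20 : ℝ) * m ≤ K * (K - 1))
    (h3 : Real.log (2 * m) ≤ 2 * Real.log ((m - K : ℕ) : ℝ))
    (h4 : P * (2 * (2 * K : ℝ) * ((m - K : ℕ) : ℝ) ^ (Q - 1) * Real.log ((m + K : ℕ) : ℝ) ^ 2) < 1)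
    {N : ℝ} (hN : 2 * auxF m ≤ N) (hN' : N < 2 * auxF (m + 1)) :
    ∃ k ≤ K, N ≤ auxF (m + k) + auxF (m - k) ∧ auxF (m + k) + auxF (m - k) < N + 1 := by
  have hp1 := aux_p1
  have hp2 := aux_p2
  have hS := aux_sum_ge (m := m) (K := K) (by omega) K le_rfl
  have hmpos : (16 : ℝ) ≤ m := by exact_mod_cast (show 16 ≤ m by omega)
  have hK1 : 1 ≤ K := by
    rcases Nat.eq_zero_or_pos K with h | h
    · subst h; norm_num at h2; linarith
    · exact h
  have hend : N ≤ auxF (m + K) + auxF (m - K) := by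
    refine le_trans ?_ hS
    have hD := auxD_le (n := m) (by omega)
    have hL := auxL_pos (n := m + K) (by omega)
    have hlm : 0 ≤ Real.log m := Real.log_nonneg (by linarith)
    have hl2m : 0 < Real.log (2 * m) := Real.log_pos (by linarith)
    have hm1 := aux_rpow_mono (show 3 ≤ m + 1 by omega) (show m + 1 ≤ m + K by omega)
    have hLu : auxL (m + K) ≤ 2 * m * Real.log (2 * m) := by
      refine (auxL_le (by omega)).trans ?_
      have : ((m + K : ℕ) : ℝ) ≤ 2 * m := by exact_mod_cast (show m + K ≤ 2 * m by omega)
      have h0 : (1 : ℝ) ≤ ((m + K : ℕ) : ℝ) := by exact_mod_cast (show 1 ≤ m + K by omega)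
      exact mul_le_mul this (Real.log_le_log (by linarith) this) (Real.log_nonneg h0) (by linarith)
    have e : auxL (m + K) ^ Q = auxL (m + K) ^ (Q - 1) * auxL (m + K) := by
      rw [← Real.rpow_add_one hL.ne']; congr 1; ring
    have hpw : 0 < auxL (m + K) ^ (Q - 1) := Real.rpow_pos_of_pos hL _
    -- key
    have hk : 2 * auxL (m + K) ≤ Q * (K * (K - 1) * Real.log ((m - K : ℕ) : ℝ)) := by
      have a1 : (20 : ℝ) * m * (Real.log (2 * m) / 2) ≤
          K * (K - 1) * Real.log ((m - K : ℕ) : ℝ) :=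
        mul_le_mul h2 (by linarith) (by linarith) (by nlinarith)
      have a2 : 0 ≤ (20 : ℝ) * m * (Real.log (2 * m) / 2) := by positivity
      have a3 : (0.4 : ℝ) * ((20 : ℝ) * m * (Real.log (2 * m) / 2)) ≤
          Q * (K * (K - 1) * Real.log ((m - K : ℕ) : ℝ)) :=
        mul_le_mul (by linarith) a1 a2 (by linarith)
      linarith
    have hk2 : 2 * auxL (m + 1) ^ Q ≤
        Q * auxL (m + K) ^ (Q - 1) * (K * (K - 1) * Real.log ((m - K : ℕ) : ℝ)) := by
      have := mul_le_mul_of_nonneg_left hk hpw.le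
      rw [e] at hm1
      linarith
    have hk3 := mul_le_mul_of_nonneg_right
      (mul_le_mul_of_nonneg_left hk2 (show 0 ≤ P by linarith)) hlm
    linarith
  classical
  have hex : ∃ k, N ≤ auxF (m + k) + auxF (m - k) := ⟨K, hend⟩
  have hle : Nat.find hex ≤ K := Nat.find_min' hex hend
  refine ⟨Nat.find hex, hle, Nat.find_spec hex, ?_⟩
  rcases hj : Nat.find hex with _ | j
  · have := Nat.find_spec hex
    simp only [hj] at this
    simp at this ⊢
    linarith
  · have hlt : ¬ N ≤ auxF (m + j) + auxF (m - j) := Nat.find_min hex (by omega)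
    push Not at hlt
    have hs := aux_step_le (u := m + j) (v := m - (j + 1)) (A := m + K) (B := m - K)
      (by omega) (by omega) (by omega) (by omega)
    have e : m - (j + 1) + 1 = m - j := by omega
    have e2 : (((m + K : ℕ) : ℝ) - ((m - K : ℕ) : ℝ)) = 2 * K := by
      rw [Nat.cast_sub (by omega)]; push_cast; ring
    rw [e, e2] at hs
    rw [← add_assoc]
    linarith

lemma aux_eventually : ∃ m₀ : ℕ, 3 ≤ m₀ ∧ ∀ m : ℕ, m₀ ≤ m → ∃ K : ℕ, K + 16 ≤ m ∧
    (20 : ℝ) * m ≤ K * (K - 1) ∧ Real.log (2 * m) ≤ 2 * Real.log ((m - K : ℕ) : ℝ) ∧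
    P * (2 * (2 * K : ℝ) * ((m - K : ℕ) : ℝ) ^ (Q - 1) * Real.log ((m + K : ℕ) : ℝ) ^ 2) < 1 := by
  have hp1 := aux_p1
  have hp2 := aux_p2
  have ho := (isLittleO_log_rpow_rpow_atTop 2 (show 0 < 1 / 2 - Q by linarith)).bound
    (show (0 : ℝ) < 1 / 1000 by norm_num)
  obtain ⟨x₀, hx₀⟩ := Filter.eventually_atTop.1 ho
  refine ⟨max 400 (⌈x₀⌉₊), by omega, fun m hm => ?_⟩
  have hm4 : (400 : ℝ) ≤ m := by exact_mod_cast (le_max_left _ _).trans hm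
  have hmx : x₀ ≤ m := (Nat.le_ceil x₀).trans (by exact_mod_cast (le_max_right _ _).trans hm)
  have hlog := hx₀ (2 * m) (by linarith)
  set r := Real.sqrt m with hr
  have hrr : r * r = m := Real.mul_self_sqrt (by linarith)
  have hr20 : 20 ≤ r := Real.le_sqrt_of_sq_le (by linarith)
  have hc1 := Nat.le_ceil (5 * r)
  have hc2 := Nat.ceil_lt_add_one (show 0 ≤ 5 * r by linarith)
  set c := ⌈5 * r⌉₊
  have hKm : ((c + 1 : ℕ) : ℝ) ≤ 6 * r := by push_cast; linarith
  have hKm2 : ((c + 1 : ℕ) : ℝ) ≤ m / 2 := by nlinarith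
  have hK16 : c + 1 + 16 ≤ m := by
    have : ((c + 1 + 16 : ℕ) : ℝ) ≤ m := by push_cast at *; linarith
    exact_mod_cast this
  have hsub : ((m - (c + 1) : ℕ) : ℝ) = m - ((c + 1 : ℕ) : ℝ) := Nat.cast_sub (by omega)
  have hB : (m : ℝ) / 2 ≤ ((m - (c + 1) : ℕ) : ℝ) := by rw [hsub]; linarith
  refine ⟨c + 1, hK16, ?_, ?_, ?_⟩
  · push_cast; nlinarith
  · have : (2 : ℝ) * Real.log ((m - (c + 1) : ℕ) : ℝ) =
        Real.log (((m - (c + 1) : ℕ) : ℝ) ^ 2) := by rw [Real.log_pow]; norm_num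
    rw [this]
    apply Real.log_le_log (by linarith)
    nlinarith
  · have hA : ((m + (c + 1) : ℕ) : ℝ) ≤ 2 * m := by
      rw [Nat.cast_add]; linarith
    have hl0 : 0 ≤ Real.log ((m + (c + 1) : ℕ) : ℝ) := Real.log_nonneg (by push_cast; linarith)
    have hlA : Real.log ((m + (c + 1) : ℕ) : ℝ) ≤ Real.log (2 * m) :=
      Real.log_le_log (by push_cast; linarith) hA
    set x : ℝ := 2 * m with hx
    have hx0 : 0 < x := by linarith
    have hlog2 : Real.log x ^ 2 ≤ 1 / 1000 * x ^ (1 / 2 - Q) := by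
      have e : Real.log x ^ (2 : ℝ) = Real.log x ^ 2 := by norm_cast
      rw [e, Real.norm_of_nonneg (by positivity), Real.norm_of_nonneg (by positivity)] at hlog
      exact hlog
    have hBpow : ((m - (c + 1) : ℕ) : ℝ) ^ (Q - 1) ≤ 4 * x ^ (Q - 1) := by
      have a1 : ((m - (c + 1) : ℕ) : ℝ) ^ (Q - 1) ≤ (x / 4) ^ (Q - 1) :=
        Real.rpow_le_rpow_of_nonpos (by linarith) (by rw [hx]; linarith) (by linarith)
      have a2 : (x / 4) ^ (Q - 1) = x ^ (Q - 1) * 4 ^ (1 - Q) := by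
        rw [Real.div_rpow hx0.le (by norm_num), div_eq_mul_inv, ← Real.rpow_neg (by norm_num)]
        congr 2; ring
      have a3 : (4 : ℝ) ^ (1 - Q) ≤ 4 ^ (1 : ℝ) :=
        Real.rpow_le_rpow_of_exponent_le (by norm_num) (by linarith)
      rw [Real.rpow_one] at a3
      have a4 : 0 < x ^ (Q - 1) := Real.rpow_pos_of_pos hx0 _
      nlinarith
    have hrx : r ≤ x ^ (1 / 2 : ℝ) := by
      rw [← Real.sqrt_eq_rpow]
      exact Real.sqrt_le_sqrt (by linarith)
    have hprod : x ^ (1 / 2 : ℝ) * x ^ (Q - 1) * x ^ (1 / 2 - Q) = 1 := by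
      rw [← Real.rpow_add hx0, ← Real.rpow_add hx0]
      have : (1 / 2 + (Q - 1) + (1 / 2 - Q) : ℝ) = 0 := by ring
      rw [this, Real.rpow_zero]
    have hBp0 : 0 ≤ ((m - (c + 1) : ℕ) : ℝ) ^ (Q - 1) := by positivity
    calc _ ≤ P * (2 * (2 * (6 * x ^ (1 / 2 : ℝ))) * (4 * x ^ (Q - 1)) *
            (1 / 1000 * x ^ (1 / 2 - Q))) := by
          apply mul_le_mul_of_nonneg_left _ (by linarith)
          apply mul_le_mul
          · apply mul_le_mul _ hBpow hBp0 (by positivity)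
            linarith
          · exact (pow_le_pow_left₀ hl0 hlA 2).trans hlog2
          · positivity
          · positivity
      _ = P * (96 / 1000) * (x ^ (1 / 2 : ℝ) * x ^ (Q - 1) * x ^ (1 / 2 - Q)) := by ring
      _ < 1 := by rw [hprod]; linarith

lemma auxF_ge {n : ℕ} (hn : 16 ≤ n) : (n : ℝ) ≤ auxF n := by
  have h := auxL_ge hn
  have h1 : (16 : ℝ) ≤ n := by exact_mod_cast hn
  have := Real.self_le_rpow_of_one_le (x := auxL n) (y := P) (by linarith) (by linarith [aux_p1])
  exact h.trans this

/-- two terms hit `M` or `M - 1`. -/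
lemma aux_two : ∃ N₀ : ℤ, ∀ M : ℤ, N₀ ≤ M → ∃ a b : ℕ, 3 ≤ a ∧ 3 ≤ b ∧
    (⌊auxF a⌋ + ⌊auxF b⌋ = M ∨ ⌊auxF a⌋ + ⌊auxF b⌋ = M - 1) := by
  obtain ⟨m₀, hm₀, H⟩ := aux_eventually
  refine ⟨⌈2 * auxF m₀⌉, fun M hM => ?_⟩
  have hM' : 2 * auxF m₀ ≤ M := Int.ceil_le.1 hM
  classical
  -- first index beyond m₀ where 2F exceeds M
  have hex : ∃ j, (M : ℝ) < 2 * auxF (m₀ + j) := by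
    refine ⟨16 + M.toNat, ?_⟩
    have h := auxF_ge (n := m₀ + (16 + M.toNat)) (by omega)
    have h2 : (M : ℝ) ≤ M.toNat := by exact_mod_cast Int.self_le_toNat M
    push_cast at h
    have : (0 : ℝ) ≤ m₀ := Nat.cast_nonneg _
    have : (0 : ℝ) ≤ M.toNat := Nat.cast_nonneg _
    linarith
  rcases hj : Nat.find hex with _ | j
  · have := Nat.find_spec hex
    simp only [hj] at this
    simp at this
    linarith
  · have hlt : ¬ (M : ℝ) < 2 * auxF (m₀ + j) := Nat.find_min hex (by omega)
    push Not at hlt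
    have hs := Nat.find_spec hex
    simp only [hj] at hs
    obtain ⟨K, h1, h2, h3, h4⟩ := H (m₀ + j) (by omega)
    obtain ⟨k, hk, hk1, hk2⟩ := aux_main h1 h2 h3 h4 hlt hs
    refine ⟨m₀ + j + k, m₀ + j - k, by omega, by omega, ?_⟩
    set α := auxF (m₀ + j + k)
    set β := auxF (m₀ + j - k)
    have f1 := Int.floor_le α
    have f2 := Int.lt_floor_add_one α
    have f3 := Int.floor_le β
    have f4 := Int.lt_floor_add_one β
    have g1 : ⌊α⌋ + ⌊β⌋ < M + 1 := by
      have : (⌊α⌋ : ℝ) + ⌊β⌋ < M + 1 := by linarith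
      exact_mod_cast this
    have g2 : M < ⌊α⌋ + ⌊β⌋ + 2 := by
      have : (M : ℝ) < ⌊α⌋ + ⌊β⌋ + 2 := by linarith
      exact_mod_cast this
    omega

lemma auxL_four : auxL 4 = Real.log 6 := by
  have h := auxL_succ (n := 3) (by norm_num)
  norm_num [auxL_three] at h
  rw [h, ← Real.log_mul (by norm_num) (by norm_num)]; norm_num

lemma auxL_five : auxL 5 = Real.log 24 := by
  have h := auxL_succ (n := 4) (by norm_num)
  norm_num [auxL_four] at h
  rw [h, ← Real.log_mul (by norm_num) (by norm_num)]; norm_num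


lemma aux_floor {x a b : ℝ} {c : ℕ} (ha : 1 ≤ a) (hax : a ≤ x) (hxb : x ≤ b)
    (h1 : (c : ℝ) ^ 5 ≤ a ^ 7) (h2 : b ^ 3 < ((c : ℝ) + 1) ^ 2) : ⌊x ^ P⌋ = (c : ℤ) := by
  have hp1 := aux_p1
  have hp2 := aux_p2
  rw [Int.floor_eq_iff]
  have hx : 1 ≤ x := ha.trans hax
  have hx0 : 0 ≤ x := by linarith
  constructor
  · have h3 : x ^ (7 / 5 : ℝ) ≤ x ^ P := Real.rpow_le_rpow_of_exponent_le hx (by linarith)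
    refine le_trans ?_ h3
    have h4 : (x ^ (7 / 5 : ℝ)) ^ 5 = x ^ 7 := by
      rw [← Real.rpow_natCast, ← Real.rpow_mul hx0, ← Real.rpow_natCast]; norm_num
    have h5 : (c : ℝ) ^ 5 ≤ (x ^ (7 / 5 : ℝ)) ^ 5 := by
      rw [h4]; exact h1.trans (pow_le_pow_left₀ (by linarith) hax 7)
    have := le_of_pow_le_pow_left₀ (by norm_num) (by positivity) h5
    exact_mod_cast this
  · have h3 : x ^ P ≤ x ^ (3 / 2 : ℝ) := Real.rpow_le_rpow_of_exponent_le hx (by linarith)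
    refine lt_of_le_of_lt h3 ?_
    have h4 : (x ^ (3 / 2 : ℝ)) ^ 2 = x ^ 3 := by
      rw [← Real.rpow_natCast, ← Real.rpow_mul hx0, ← Real.rpow_natCast]; norm_num
    have h5 : (x ^ (3 / 2 : ℝ)) ^ 2 < ((c : ℝ) + 1) ^ 2 := by
      rw [h4]; exact lt_of_le_of_lt (pow_le_pow_left₀ hx0 hxb 3) h2
    have := lt_of_pow_lt_pow_left₀ 2 (by positivity) h5
    exact_mod_cast this

lemma aux_le_log {y : ℝ} (hy : 0 < y) (n k : ℕ) (hk : 0 < k)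
    (h : (2.7182818286 : ℝ) ^ n ≤ y ^ k) : (n : ℝ) / k ≤ Real.log y := by
  have hk' : (0 : ℝ) < k := by exact_mod_cast hk
  rw [div_le_iff₀ hk', mul_comm, ← Real.log_pow, Real.le_log_iff_exp_le (by positivity)]
  refine le_trans ?_ h
  rw [← mul_one (n : ℝ), Real.exp_nat_mul]
  exact pow_le_pow_left₀ (Real.exp_pos _).le Real.exp_one_lt_d9.le n

lemma aux_log_le {y : ℝ} (hy : 0 < y) (n k : ℕ) (hk : 0 < k)
    (h : y ^ k ≤ (2.7182818283 : ℝ) ^ n) : Real.log y ≤ (n : ℝ) / k := by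
  have hk' : (0 : ℝ) < k := by exact_mod_cast hk
  rw [le_div_iff₀ hk', mul_comm, ← Real.log_pow, Real.log_le_iff_le_exp (by positivity)]
  refine le_trans h ?_
  rw [← mul_one (n : ℝ), Real.exp_nat_mul]
  exact pow_le_pow_left₀ (by norm_num) Real.exp_one_gt_d9.le n

lemma auxF_three : ⌊auxF 3⌋ = 0 := by
  rw [Int.floor_eq_iff, auxF, auxL_three]
  have h := Real.log_two_gt_d9
  have h2 := Real.log_two_lt_d9
  constructor
  · push_cast; positivity
  · have := Real.rpow_lt_one (x := Real.log 2) (z := P) (by linarith) (by linarith)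
      (by linarith [aux_p1])
    push_cast; linarith

lemma auxF_four : ⌊auxF 4⌋ = 2 := by
  rw [auxF, auxL_four]
  have h1 := aux_le_log (y := 6) (by norm_num) 7 4 (by norm_num) (by norm_num)
  have h2 := aux_log_le (y := 6) (by norm_num) 9 5 (by norm_num) (by norm_num)
  exact aux_floor (c := 2) (by norm_num) h1 h2 (by norm_num) (by norm_num)

lemma auxF_five : ⌊auxF 5⌋ = 5 := by
  rw [auxF, auxL_five]
  have h1 := aux_le_log (y := 24) (by norm_num) 19 6 (by norm_num) (by norm_num)
  have h2 := aux_log_le (y := 24) (by norm_num) 16 5 (by norm_num) (by norm_num)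
  exact aux_floor (c := 5) (by norm_num) h1 h2 (by norm_num) (by norm_num)

/-- The sequence `(⌊(log Γ(n))^{√2}⌋)_{n ≥ 3}` is an asymptotic basis. -/
theorem stmt_15 :
    ∃ s : ℕ, ∃ N₀ : ℤ, ∀ N : ℤ, N₀ ≤ N →
      ∃ n : Fin s → ℕ, (∀ i, 3 ≤ n i) ∧
        ∑ i, ⌊(Real.log (Real.Gamma (n i))) ^ Real.sqrt 2⌋ = N := by
  obtain ⟨N₀, H⟩ := aux_two
  refine ⟨4, N₀ + 4, fun N hN => ?_⟩
  obtain ⟨a, b, ha, hb, h⟩ := H (N - 4) (by omega)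
  have key : ∀ c d : ℕ, 3 ≤ c → 3 ≤ d → ⌊auxF a⌋ + ⌊auxF b⌋ + ⌊auxF c⌋ + ⌊auxF d⌋ = N →
      ∃ n : Fin 4 → ℕ, (∀ i, 3 ≤ n i) ∧
        ∑ i, ⌊(Real.log (Real.Gamma (n i))) ^ Real.sqrt 2⌋ = N := by
    intro c d hc hd he
    refine ⟨![a, b, c, d], ?_, ?_⟩
    · intro i
      fin_cases i <;> simpa
    · rw [Fin.sum_univ_four]
      exact he
  rcases h with h | h
  · exact key 4 4 (by norm_num) (by norm_num) (by rw [auxF_four]; omega)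
  · exact key 3 5 (by norm_num) (by norm_num) (by rw [auxF_three, auxF_five]; omega)
end
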